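/- For any positive integers s, t, k with s < t ≤ k, there exists an integer v* (depending only on t and k+t−s) such that for every integer v ≥ v* there exists an AOA(s,t,k,v). -/

import Mathlib

/-- An orthogonal array OA(t,k,v): a `v^t × k` array with entries from `Fin v`
such that in any `t` columns every `t`-tuple appears exactly once among the rows. -/
def IsOA (t k v : ℕ) (A : Fin (v ^ t) → Fin k → Fin v) : Prop :=
  ∀ c : Fin t → Fin k, Function.Injective c →
    Function.Bijective fun r : Fin (v ^ t) => fun i : Fin t => A r (c i)

/-- An augmented orthogonal array AOA(s,t,k,v): the first `k` columns `A` form an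
OA(t,k,v), the last column `L` has entries from a set of size `v^(t-s)`, and any `s`
of the first `k` columns together with the last column contain every `(s+1)`-tuple
exactly once. -/
def IsAOA (s t k v : ℕ) (A : Fin (v ^ t) → Fin k → Fin v)
    (L : Fin (v ^ t) → Fin (v ^ (t - s))) : Prop :=
  IsOA t k v A ∧
    ∀ c : Fin s → Fin k, Function.Injective c →
      Function.Bijective fun r : Fin (v ^ t) =>
        ((fun i : Fin s => A r (c i)), L r)

/-- Existence of an AOA(s,t,k,v). -/
def ExistsAOA (s t k v : ℕ) : Prop := ∃ A L, IsAOA s t k v A L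

namespace AOAConstruction

open Finset

set_option linter.unusedSectionVars false

/-- The integer indicator of a proposition. -/
noncomputable def ind (p : Prop) : ℤ := by
  classical exact if p then 1 else 0

theorem ind_of {p : Prop} (h : p) : ind p = 1 := by simp [ind, h]

theorem ind_of_not {p : Prop} (h : ¬ p) : ind p = 0 := by simp [ind, h]

theorem ind_congr {p q : Prop} (h : p ↔ q) : ind p = ind q := by rw [propext h]

theorem ind_nonneg (p : Prop) : 0 ≤ ind p := by
  by_cases h : p <;> simp [ind, h]

theorem ind_le_one (p : Prop) : ind p ≤ 1 := by
  by_cases h : p <;> simp [ind, h]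

theorem ind_mul (p q : Prop) : ind p * ind q = ind (p ∧ q) := by
  by_cases h : p <;> by_cases h' : q <;> simp [ind, h, h']

theorem sum_ind_eq {α : Type*} [Fintype α] {p : α → Prop} (a : α) (h : ∀ b, p b ↔ b = a) :
    ∑ b, ind (p b) = 1 := by
  classical
  simp [ind, h]

theorem sum_ind_of_forall_not {α : Type*} [Fintype α] {p : α → Prop} (h : ∀ a, ¬ p a) :
    ∑ b, ind (p b) = 0 := by
  simp [ind_of_not, h]

theorem exists_of_sum_ind_pos {α : Type*} [Fintype α] {p : α → Prop}
    (h : 0 < ∑ b, ind (p b)) : ∃ a, p a := by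
  by_contra! hc
  rw [sum_ind_of_forall_not hc] at h
  exact lt_irrefl _ h

theorem sum_ind_le_one_iff {α : Type*} [Fintype α] {p : α → Prop} :
    ∑ b, ind (p b) ≤ 1 ↔ ∀ a b, p a → p b → a = b := by
  classical
  have h1 : (#{a | p a} : ℤ) = ∑ b, ind (p b) := by simp [ind]
  rw [← h1]
  norm_cast
  rw [card_le_one]
  simp
  tauto

/-- A `ℤ`-valued function of `t`-tuples is compatible if its marginals on `t - 1` columns do not
depend on the column summed out. -/
def Compat {I M : Type} [DecidableEq I] [Fintype M] (K : Finset I) (t : ℕ)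
    (f : Finset I → (I → M) → ℤ) : Prop :=
  (∀ T x x', (∀ i ∈ T, x i = x' i) → f T x = f T x') ∧
  ∀ S ⊆ K, #S + 1 = t → ∀ a ∈ K, a ∉ S → ∀ b ∈ K, b ∉ S → ∀ x,
    ∑ y, f (insert a S) (Function.update x a y) = ∑ y, f (insert b S) (Function.update x b y)

/-- Coverage of a tuple by a signed family of rows. -/
noncomputable def cov {I α L : Type} [Fintype L] (ε : L → ℤ) (r : L → I → α) (T : Finset I)
    (x : I → α) : ℤ := ∑ l, ε l * ind (∀ i ∈ T, r l i = x i)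

theorem cov_sum {I α L L' : Type} [Fintype L] [Fintype L'] (ε : L → ℤ) (ε' : L' → ℤ)
    (r : L → I → α) (r' : L' → I → α) (T : Finset I) (x : I → α) :
    cov (Sum.elim ε ε') (Sum.elim r r') T x = cov ε r T x + cov ε' r' T x := by
  simp [cov]

theorem cov_congr {I α L : Type} [Fintype L] (ε : L → ℤ) {r r' : L → I → α} {T : Finset I}
    {x x' : I → α} (h : ∀ l, (∀ i ∈ T, r l i = x i) ↔ ∀ i ∈ T, r' l i = x' i) :
    cov ε r T x = cov ε r' T x' :=
  sum_congr rfl fun l _ => by rw [ind_congr (h l)]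

theorem cov_insert {I α L : Type} [DecidableEq I] [Fintype L] (ε : L → ℤ) (r : L → I → α)
    (S : Finset I) (x : I → α) (a : I) (b : α) (h : ∀ l, r l a = b) :
    cov ε r (insert a S) x = ind (b = x a) * cov ε r S x := by
  simp only [cov, mul_sum]
  refine sum_congr rfl fun l _ => ?_
  rw [mul_left_comm, ind_mul]
  simp [h]

theorem sum_cov_insert {I α L : Type} [DecidableEq I] [Fintype L] [Fintype α] (ε : L → ℤ)
    (r : L → I → α) (S : Finset I) (x : I → α) (c : I) (hc : c ∉ S) :
    ∑ z, cov ε r (insert c S) (Function.update x c z) = cov ε r S x := by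
  simp only [cov]
  rw [sum_comm]
  refine sum_congr rfl fun l _ => ?_
  rw [← mul_sum]
  congr 1
  have (z : α) : ind (∀ i ∈ insert c S, r l i = Function.update x c z i) =
      ind (r l c = z) * ind (∀ i ∈ S, r l i = x i) := by
    rw [ind_mul]
    apply ind_congr
    simp only [mem_insert, forall_eq_or_imp, Function.update_self]
    refine and_congr Iff.rfl (forall₂_congr fun i hi => ?_)
    rw [Function.update_of_ne (ne_of_mem_of_not_mem hi hc)]
  simp only [this, ← sum_mul]
  rw [sum_ind_eq (r l c) (fun b => eq_comm), one_mul]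

theorem exists_rows_of_compat {I M : Type} [DecidableEq I] [Fintype M] [DecidableEq M] (b : M)
    (t : ℕ) : ∀ (K : Finset I) (_ : t ≤ #K) (f : Finset I → (I → M) → ℤ) (_ : Compat K t f),
    ∃ (L : Type) (_ : Fintype L) (ε : L → ℤ) (r : L → I → M),
      (∀ l, ∀ i ∉ K, r l i = b) ∧
      ∀ T ⊆ K, #T = t → ∀ x, f T x = cov ε r T x := by
  induction t with
  | zero =>
    intro K _ f hf
    refine ⟨Unit, inferInstance, fun _ => f ∅ fun _ => b, fun _ _ => b, by simp, ?_⟩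
    intro T _ hT x
    obtain rfl := card_eq_zero.1 hT
    simpa [cov, ind_of] using hf.1 ∅ _ _ (by simp)
  | succ t iht =>
    intro K
    induction K using Finset.induction_on with
    | empty => intro h; simp at h
    | insert a K' ha ihK =>
      intro hK f hf
      rw [card_insert_of_notMem ha] at hK
      by_cases hc : t = #K'
      · refine ⟨({i // i ∈ insert a K'} → M), inferInstance,
          fun l => f (insert a K') fun i => if h : i ∈ insert a K' then l ⟨i, h⟩ else b,
          fun l i => if h : i ∈ insert a K' then l ⟨i, h⟩ else b, ?_, ?_⟩
        · intro l i hi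
          simp only [hi, dite_false]
        · intro T hT hTt x
          obtain rfl : T = insert a K' :=
            eq_of_subset_of_card_le hT (by rw [card_insert_of_notMem ha]; omega)
          simp only [cov]
          rw [Fintype.sum_eq_single (fun i : {i // i ∈ insert a K'} => x i)]
          · rw [ind_of (by intro i hi; simp only [hi, dite_true]), mul_one]
            exact hf.1 _ _ _ (by intro i hi; simp only [hi, dite_true])
          · intro l hl
            rw [ind_of_not, mul_zero]
            intro h
            apply hl
            ext i
            have := h i.1 i.2
            simpa using this
      have hcompat : Compat K' (t + 1) f := ⟨hf.1, fun S hS hS1 c hc hcS d hd hdS x =>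
        hf.2 S (hS.trans (subset_insert _ _)) hS1 c (mem_insert_of_mem hc) hcS d
          (mem_insert_of_mem hd) hdS x⟩
      obtain ⟨L, _, ε, r, hr, hfr⟩ := ihK (by omega) f hcompat
      have key : ∀ y, ∃ (L : Type) (_ : Fintype L) (ε : L → ℤ) (r : L → I → M),
          (∀ l, ∀ i ∉ K', r l i = b) ∧ ∀ T ⊆ K', #T = t → ∀ x,
            f (insert a T) (Function.update x a y) = cov ε r T x := by
        intro y
        refine iht K' (by omega) (fun T x => f (insert a T) (Function.update x a y)) ⟨?_, ?_⟩
        · intro T x x' h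
          refine hf.1 _ _ _ fun i hi => ?_
          by_cases hia : i = a
          · subst hia; simp
          · simp [hia]
            exact h i (mem_of_mem_insert_of_ne hi hia)
        · intro S hS hS1 c hc hcS d hd hdS x
          have haS : a ∉ S := fun h => ha (hS h)
          have hca : c ≠ a := fun h => ha (h ▸ hc)
          have hda : d ≠ a := fun h => ha (h ▸ hd)
          have := hf.2 (insert a S) (insert_subset_insert _ hS)
            (by rw [card_insert_of_notMem haS]; omega) c (mem_insert_of_mem hc)
            (by simp [hca, hcS]) d (mem_insert_of_mem hd) (by simp [hda, hdS])
            (Function.update x a y)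
          simp only [Function.update_comm hca, Function.update_comm hda, insert_comm c a,
            insert_comm d a] at this ⊢
          exact this
      choose L' _ ε' r' hr' hfr' using key
      refine ⟨L ⊕ Σ y : {y : M // y ≠ b}, (L' y ⊕ L' y), inferInstance,
        Sum.elim ε fun z => Sum.elim (ε' z.1) (fun l => - ε' z.1 l) z.2,
        Sum.elim r fun z => Sum.elim (fun l => Function.update (r' z.1 l) a z.1)
          (r' z.1) z.2, ?_, ?_⟩
      · rintro (l | ⟨y, l | l⟩) i hi
        · exact hr l i fun h => hi (mem_insert_of_mem h)
        · have hia : i ≠ a := fun h => hi (h ▸ mem_insert_self _ _)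
          simp only [Sum.elim_inr, Sum.elim_inl, Function.update_of_ne hia]
          exact hr' y l i fun h => hi (mem_insert_of_mem h)
        · exact hr' y l i fun h => hi (mem_insert_of_mem h)
      · intro T hT hTt x
        rw [cov_sum]
        have hsig : cov (fun z : Σ y : {y : M // y ≠ b}, (L' y ⊕ L' y) =>
              Sum.elim (ε' z.1) (fun l => - ε' z.1 l) z.2)
            (fun z => Sum.elim (fun l => Function.update (r' z.1 l) a z.1) (r' z.1) z.2) T x =
            ∑ y : {y : M // y ≠ b},
              (cov (ε' y) (fun l => Function.update (r' y l) a y) T x - cov (ε' y) (r' y) T x) := by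
          simp only [cov, Fintype.sum_sigma, Fintype.sum_sum_type, Sum.elim_inl, Sum.elim_inr,
            neg_mul, sum_neg_distrib, sub_eq_add_neg]
        rw [hsig]
        by_cases haT : a ∈ T
        · obtain ⟨S, haS, rfl⟩ : ∃ S, a ∉ S ∧ T = insert a S :=
            ⟨T.erase a, notMem_erase _ _, (insert_erase haT).symm⟩
          have hS : S ⊆ K' := fun i hi => mem_of_mem_insert_of_ne (hT (mem_insert_of_mem hi))
            fun h => haS (h ▸ hi)
          have hSt : #S = t := by
            rw [card_insert_of_notMem haS] at hTt; omega
          rw [cov_insert ε r S x a b fun l => hr l a ha]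
          have h1 (y : {y : M // y ≠ b}) :
              cov (ε' y) (fun l => Function.update (r' y l) a y) (insert a S) x =
                ind (y.1 = x a) * f (insert a S) (Function.update x a y) := by
            rw [cov_insert _ _ _ _ a y.1 (by simp), hfr' _ S hS hSt]
            congr 1
            refine cov_congr _ fun l => forall₂_congr fun i hi => ?_
            rw [Function.update_of_ne (ne_of_mem_of_not_mem hi haS)]
          have h2 (y : {y : M // y ≠ b}) : cov (ε' y) (r' y) (insert a S) x =
              ind (b = x a) * f (insert a S) (Function.update x a y) := by
            rw [cov_insert _ _ _ _ a b fun l => hr' y l a ha, hfr' _ S hS hSt]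
          simp only [h1, h2]
          by_cases hxa : x a = b
          · obtain ⟨c, hc, hcS⟩ : ∃ c ∈ K', c ∉ S := by
              by_contra! hcon
              have := card_le_card (show K' ⊆ S from hcon)
              omega
            have h3 : cov ε r S x = ∑ y, f (insert a S) (Function.update x a y) := by
              rw [← sum_cov_insert ε r S x c hcS, hf.2 S (hS.trans (subset_insert _ _)) (by omega)
                a (mem_insert_self _ _) haS c (mem_insert_of_mem hc) hcS x]
              refine sum_congr rfl fun z _ => (hfr _ (insert_subset hc hS) ?_ _).symm
              rw [card_insert_of_notMem hcS, hSt]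
            rw [h3, ind_of hxa.symm, one_mul]
            have h4 (y : {y : M // y ≠ b}) : ind (y.1 = x a) = 0 :=
              ind_of_not (by rw [hxa]; exact y.2)
            simp only [h4, zero_mul, one_mul, zero_sub, sum_neg_distrib]
            rw [← Fintype.sum_subtype_add_sum_subtype (fun y => y ≠ b)
              fun y => f (insert a S) (Function.update x a y)]
            have h5 : ∑ y : {y : M // ¬ y ≠ b}, f (insert a S) (Function.update x a y) =
                f (insert a S) x := by
              rw [Fintype.sum_eq_single ⟨b, by simp⟩]
              · simp [← hxa]
              · rintro ⟨y, hy⟩ h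
                simp at hy
                simp [hy] at h
            rw [h5]; ring
          · rw [ind_of_not (fun h => hxa h.symm), zero_mul, zero_add]
            simp only [zero_mul, sub_zero]
            rw [sum_eq_single ⟨x a, hxa⟩]
            · simp [ind_of]
            · intro y _ hy
              rw [ind_of_not, zero_mul]
              exact fun h => hy (Subtype.ext h)
            · simp
        · have hS : T ⊆ K' := fun i hi => mem_of_mem_insert_of_ne (hT hi) fun h => haT (h ▸ hi)
          rw [← hfr T hS hTt, sum_eq_zero, add_zero]
          intro y _
          rw [sub_eq_zero]
          refine cov_congr _ fun l => forall₂_congr fun i hi => ?_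
          rw [Function.update_of_ne (ne_of_mem_of_not_mem hi haT)]

/-- Number of rows of a family that agree with `x` on `T`. -/
noncomputable def cnt {I α P : Type} [Fintype P] (r : P → I → α) (T : Finset I) (x : I → α) : ℤ :=
  ∑ p, ind (∀ i ∈ T, r p i = x i)

section cnt

variable {I α P Q : Type} [Fintype P] [Fintype Q]

theorem cnt_sigma {Q : P → Type} [∀ p, Fintype (Q p)] (r : (Σ p, Q p) → I → α) (T : Finset I)
    (x : I → α) : cnt r T x = ∑ p, cnt (fun q => r ⟨p, q⟩) T x := by
  simp [cnt, Fintype.sum_sigma]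

theorem cnt_prod (r : P × Q → I → α) (T : Finset I)
    (x : I → α) : cnt r T x = ∑ p, cnt (fun q => r (p, q)) T x := by
  simp [cnt, Fintype.sum_prod_type]

theorem cnt_equiv (s : P ≃ Q) {r : P → I → α} {r' : Q → I → α} {T : Finset I} {x : I → α}
    (h : ∀ p, ∀ i ∈ T, r p i = r' (s p) i) : cnt r T x = cnt r' T x := by
  refine Fintype.sum_equiv s _ _ fun p => ind_congr (forall₂_congr fun i hi => ?_)
  rw [h p i hi]

theorem cnt_subtype_add (q : P → Prop) [DecidablePred q] (r : P → I → α) (T : Finset I)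
    (x : I → α) : cnt (fun p : {p // q p} => r p) T x + cnt (fun p : {p // ¬ q p} => r p) T x =
      cnt r T x :=
  Fintype.sum_subtype_add_sum_subtype q fun p => ind (∀ i ∈ T, r p i = x i)

theorem cnt_unique (a : P) [DecidableEq P] (r : P → I → α) (T : Finset I) (x : I → α) :
    cnt r T x = ind (∀ i ∈ T, r a i = x i) + cnt (fun p : {p // p ≠ a} => r p) T x := by
  exact Fintype.sum_eq_add_sum_subtype_ne (fun p => ind (∀ i ∈ T, r p i = x i)) a

end cnt

theorem exists_injective_of_card_fiber_le {A B K : Type} [Fintype A] [Fintype B] (a : A → K)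
    (b : B → K) (h : ∀ k, ∑ x, ind (a x = k) ≤ ∑ y, ind (b y = k)) :
    ∃ π : A → B, Function.Injective π ∧ ∀ x, b (π x) = a x := by
  classical
  have hk (k : K) : Nonempty ({x // a x = k} ↪ {y // b y = k}) := by
    apply Function.Embedding.nonempty_of_card_le
    rw [Fintype.card_subtype, Fintype.card_subtype]
    have := h k
    simp only [ind, sum_boole] at this
    exact_mod_cast this
  let φ := fun k => (hk k).some
  refine ⟨fun x => φ (a x) ⟨x, rfl⟩, fun x y hxy => ?_, fun x => (φ (a x) ⟨x, rfl⟩).2⟩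
  have hb : a x = a y := by
    rw [← (φ (a x) ⟨x, rfl⟩).2, ← (φ (a y) ⟨y, rfl⟩).2]
    exact congrArg b hxy
  have key : ∀ k (hx : a x = k) (hy : a y = k), (φ k ⟨x, hx⟩ : B) = φ k ⟨y, hy⟩ → x = y := by
    intro k hx hy hh
    simpa using (φ k).injective (Subtype.ext hh)
  have key' : ∀ k (hx : a x = k), (φ (a x) ⟨x, rfl⟩ : B) = φ k ⟨x, hx⟩ := by
    rintro k rfl
    rfl
  exact key (a y) hb rfl ((key' (a y) hb).symm.trans hxy)

section Code

variable {F I E : Type} [Field F] [Fintype I] [DecidableEq I] [AddCommGroup E] [Module F E]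

/-- `e` exhibits `E` as a maximum distance separable code of dimension `t`. -/
def IsCode (t : ℕ) (e : I → E →ₗ[F] F) : Prop :=
  ∀ T : Finset I, #T = t → ∀ x : I → F, ∃! g : E, ∀ i ∈ T, e i g = x i

variable {t : ℕ} {e : I → E →ₗ[F] F}

theorem IsCode.eq_of_agree (h : IsCode t e) {T : Finset I} (hT : t ≤ #T) {g g' : E}
    (hg : ∀ i ∈ T, e i g = e i g') : g = g' := by
  obtain ⟨T', hT', hc⟩ := exists_subset_card_eq hT
  exact (h T' hc fun i => e i g').unique (fun i hi => hg i (hT' hi)) fun i _ => rfl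

theorem IsCode.eq_zero (h : IsCode t e) {T : Finset I} (hT : t ≤ #T) {g : E}
    (hg : ∀ i ∈ T, e i g = 0) : g = 0 :=
  h.eq_of_agree hT fun i hi => by rw [hg i hi, map_zero]

theorem IsCode.exists_interp (h : IsCode t e) (hI : t ≤ Fintype.card I) {T : Finset I}
    (hT : #T ≤ t) (x : I → F) : ∃ g : E, ∀ i ∈ T, e i g = x i := by
  obtain ⟨T', hT', hc⟩ := exists_superset_card_eq hT hI
  obtain ⟨g, hg, -⟩ := h T' hc x
  exact ⟨g, fun i hi => hg i (hT' hi)⟩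

theorem IsCode.exists_ne_zero (h : IsCode t e) (hI : t ≤ Fintype.card I) {T : Finset I}
    (hT : #T < t) : ∃ g : E, g ≠ 0 ∧ ∀ i ∈ T, e i g = 0 := by
  obtain ⟨a, ha⟩ : ∃ a, a ∉ T := by
    by_contra! hc
    have : #T = Fintype.card I := by rw [eq_univ_of_forall hc, card_univ]
    omega
  obtain ⟨g, hg⟩ := h.exists_interp hI (T := insert a T)
    (by rw [card_insert_of_notMem ha]; omega) fun i => if i = a then 1 else 0
  refine ⟨g, ?_, fun i hi => ?_⟩
  · rintro rfl
    simpa using hg a (mem_insert_self _ _)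
  · rw [hg i (mem_insert_of_mem hi), if_neg (ne_of_mem_of_not_mem hi ha)]

theorem IsCode.box_trade [Fintype E] (h : IsCode t e) {β : Type} (d : I → F) (θ : I → F → β)
    {T : Finset I} (hT : #T = t) (y : I → β) :
    cnt (fun (g : E) i => θ i (d i + e i g)) T y = cnt (fun (g : E) i => θ i (e i g)) T y := by
  obtain ⟨k, hk, -⟩ := h T hT d
  refine cnt_equiv (Equiv.addLeft k) fun g i hi => ?_
  simp [hk i hi]

/-- Two codewords can be chosen distinct, vanishing on prescribed sets and agreeing on another. -/
theorem IsCode.exists_separating (h : IsCode t e) (hI : t ≤ Fintype.card I)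
    {O O' Z Z' A : Finset I} (hO : #O ≤ t) (hO' : #O' ≤ t) (hZ : #Z < t)
    (hZO : Z ⊆ O) (hZO' : Z' ⊆ O') (hAO : A ⊆ O) (hAO' : A ⊆ O')
    (hAZ : Disjoint A Z) (hAZ' : Disjoint A Z')
    (hne : t ≤ #(A ∪ (Z ∩ Z')) → False) :
    ∃ q q' : E, q ≠ q' ∧ (∀ i ∈ Z, e i q = 0) ∧ (∀ i ∈ Z', e i q' = 0) ∧
      ∀ i ∈ A, e i q = e i q' := by
  by_cases h1 : #(Z ∪ A) < t
  · obtain ⟨q, hq, hq0⟩ := h.exists_ne_zero hI h1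
    exact ⟨q, 0, hq, fun i hi => hq0 i (mem_union_left _ hi), by simp,
      fun i hi => by rw [hq0 i (mem_union_right _ hi), map_zero]⟩
  by_cases h2 : #(Z' ∪ A) < t
  · obtain ⟨q, hq, hq0⟩ := h.exists_ne_zero hI h2
    exact ⟨0, q, hq.symm, by simp, fun i hi => hq0 i (mem_union_left _ hi),
      fun i hi => by rw [hq0 i (mem_union_right _ hi), map_zero]⟩
  have hOe : Z ∪ A = O := eq_of_subset_of_card_le (union_subset hZO hAO) (by omega)
  have hOe' : Z' ∪ A = O' := eq_of_subset_of_card_le (union_subset hZO' hAO') (by omega)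
  obtain ⟨a, ha⟩ : A.Nonempty := by
    rw [nonempty_iff_ne_empty]
    rintro rfl
    simp at h1
    omega
  obtain ⟨q, hq⟩ := h.exists_interp hI hO fun i => if i = a then 1 else 0
  obtain ⟨q', hq'⟩ := h.exists_interp hI hO' fun i => if i = a then 1 else 0
  refine ⟨q, q', ?_, fun i hi => ?_, fun i hi => ?_, fun i hi => ?_⟩
  · rintro rfl
    have hq0 : q = 0 := by
      have hlt : O ⊂ O ∪ O' := by
        refine ⟨subset_union_left, fun hsub => hne ?_⟩
        have hO'O : O' = O := eq_of_subset_of_card_le (subset_union_right.trans hsub)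
          (by rw [← hOe'] at hO' ⊢; omega)
        have : O ⊆ A ∪ (Z ∩ Z') := by
          intro i hi
          have hi' := hi
          rw [← hO'O, ← hOe'] at hi'
          rw [← hOe] at hi
          simp only [mem_union, mem_inter] at hi hi' ⊢
          tauto
        have := card_le_card this
        rw [← hOe] at this
        omega
      refine h.eq_zero (T := (O ∪ O').erase a) ?_ fun i hi => ?_
      · have := card_lt_card hlt
        rw [card_erase_of_mem (mem_union_left _ (hAO ha))]
        rw [← hOe] at this ⊢
        omega
      · rw [mem_erase, mem_union] at hi
        rcases hi.2 with hi2 | hi2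
        · rw [hq i hi2, if_neg hi.1]
        · rw [hq' i hi2, if_neg hi.1]
    have := hq a (hAO ha)
    simp [hq0] at this
  · rw [hq i (hZO hi), if_neg]
    rintro rfl
    exact disjoint_left.1 hAZ ha hi
  · rw [hq' i (hZO' hi), if_neg]
    rintro rfl
    exact disjoint_left.1 hAZ' ha hi
  · rw [hq i (hAO hi), hq' i (hAO' hi)]

end Code

theorem cnt_range_add {I α P A : Type} [Fintype P] [Fintype A] (s : A → P)
    (hs : Function.Injective s) [DecidablePred fun p => p ∈ Set.range s] (r : P → I → α)
    (T : Finset I) (x : I → α) :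
    cnt r T x = cnt (fun a => r (s a)) T x + cnt (fun p : {p // p ∉ Set.range s} => r p) T x := by
  rw [← cnt_subtype_add (fun p => p ∈ Set.range s) r T x]
  congr 1
  exact (cnt_equiv (Equiv.ofInjective s hs) fun _ _ _ => rfl).symm

theorem cnt_sum_type {I α P Q : Type} [Fintype P] [Fintype Q] (r : P ⊕ Q → I → α) (T : Finset I)
    (x : I → α) : cnt r T x = cnt (fun p => r (Sum.inl p)) T x + cnt (fun q => r (Sum.inr q)) T x :=
  Fintype.sum_sum_type _

section boxes

variable {F I M B : Type} [Field F] [DecidableEq F] [DecidableEq I]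

/-- The symbol at column `i` of the box on fresh symbols whose zero row is `r`. -/
def privBox (r : I → M) (b : B) (i : I) (c : F) : M ⊕ (B × I × F) :=
  if c = 0 then Sum.inl (r i) else Sum.inr (b, i, c)

/-- The box joining two rows that agree on `T`. -/
def pairBox (r : I → M) (T : Finset I) (δ : I → F) (bp bn bt : B) (i : I) (c : F) :
    M ⊕ (B × I × F) :=
  if i ∈ T then (if c = 0 then Sum.inl (r i) else Sum.inr (bt, i, c))
  else if c = 0 then Sum.inr (bp, i, δ i)
  else if c = δ i then Sum.inr (bn, i, δ i) else Sum.inr (bt, i, c)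

variable {r r' : I → M} {b b' bp bn bt bp' bn' bt' : B} {T T' : Finset I} {δ δ' : I → F} {i : I}
  {c c' : F}

theorem label_privBox : (privBox r b i c).getRight? = if c = 0 then none else some (b, i, c) := by
  simp only [privBox]
  split_ifs <;> rfl

theorem label_pairBox : (pairBox r T δ bp bn bt i c).getRight? =
    if i ∈ T then (if c = 0 then none else some (bt, i, c))
    else if c = 0 then some (bp, i, δ i)
    else if c = δ i then some (bn, i, δ i) else some (bt, i, c) := by
  simp only [pairBox]
  split_ifs <;> rfl

theorem of_label_privBox (h : (privBox r b i c).getRight? = (privBox r' b' i c').getRight?) :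
    c = c' ∧ (b ≠ b' → c = 0) := by
  rw [label_privBox, label_privBox] at h
  split_ifs at h <;> simp_all

theorem zero_of_label_pairBox
    (h : (pairBox r T δ bp bn bt i c).getRight? = (privBox r' b i c').getRight?)
    (h1 : b ≠ bn) (h2 : b ≠ bt) : c = 0 := by
  rw [label_pairBox, label_privBox] at h
  split_ifs at h <;> simp_all

theorem of_label_pairBox_privBox
    (h : (pairBox r T δ bp bn bt i c).getRight? = (privBox r' b i c').getRight?)
    (h2 : b ≠ bt) : (i ∈ T ∧ c' = 0) ∨ (i ∉ T ∧ c' = δ i) := by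
  rw [label_pairBox, label_privBox] at h
  split_ifs at h <;> simp_all

theorem of_label_pairBox
    (h : (pairBox r T δ bp bn bt i c).getRight? = (pairBox r' T' δ' bp' bn' bt' i c').getRight?)
    (h1 : bt ≠ bt') (h2 : bp ≠ bt') (h3 : bn ≠ bt') (h4 : bt ≠ bp') (h5 : bt ≠ bn')
    (h6 : bp ≠ bn') (h7 : bn ≠ bp') :
    (i ∈ T ∧ i ∈ T') ∨ (i ∉ T ∧ i ∉ T' ∧ δ i = δ' i) := by
  rw [label_pairBox, label_pairBox] at h
  split_ifs at h <;> simp_all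

theorem zero_of_label_pairBox_pairBox
    (h : (pairBox r T δ bp bn bt i c).getRight? = (pairBox r' T δ' bp' bn' bt' i c').getRight?)
    (h1 : bt ≠ bt') (h2 : bp ≠ bt') (h3 : bn ≠ bt') (h4 : bt ≠ bp') (h5 : bt ≠ bn')
    (h6 : bp ≠ bn') (h7 : bn ≠ bp') (h8 : bp ≠ bp') (h9 : bn ≠ bn') : c = 0 := by
  rw [label_pairBox, label_pairBox] at h
  split_ifs at h <;> simp_all

theorem eq_of_label_pairBox
    (h : (pairBox r T δ bp bn bt i c).getRight? = (pairBox r T δ bp bn bt i c').getRight?)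
    (h1 : bp ≠ bn) (h2 : bp ≠ bt) (h3 : bn ≠ bt) : c = c' := by
  rw [label_pairBox, label_pairBox] at h
  split_ifs at h <;> simp_all

end boxes

section resolve

variable {F I E : Type} [Field F] [DecidableEq F] [Fintype F] [Fintype I] [DecidableEq I]
  [AddCommGroup E] [Module F E] [Fintype E] {t : ℕ} {e : I → E →ₗ[F] F}

theorem exists_resolution (h : IsCode t e) (d : I → F)
    (hd : ∀ (g : E) (T : Finset I), (∀ i ∈ T, d i + e i g = 0) → #T ≤ t)
    {Lp Ln M : Type} [Fintype Lp] [Fintype Ln] (rp : Lp → I → M) (rn : Ln → I → M)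
    (π : {T : Finset I // #T = t} → Ln → Lp) (hπ : ∀ T, Function.Injective (π T))
    (hπ' : ∀ T n, ∀ i ∈ T.1, rp (π T n) i = rn n i) :
    ∃ (Φ : Type) (_ : Fintype Φ) (col : Φ → I) (P : Type) (_ : Fintype P) (N : Type)
      (_ : Fintype N) (pos : P → I → M ⊕ Φ) (neg : N → I → M ⊕ Φ),
      (∀ p i φ, pos p i = Sum.inr φ → col φ = i) ∧ (∀ n i φ, neg n i = Sum.inr φ → col φ = i) ∧
      (∀ p, #{i | (pos p i).isLeft} ≤ t) ∧ (∀ n, #{i | (neg n i).isLeft} < t) ∧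
      (∀ n n' (T : Finset I), #T = t → (∀ i ∈ T, (neg n i).getRight? = (neg n' i).getRight?) →
        n = n') ∧
      ∀ (β : Type) (σ : I → M ⊕ Φ → β) (T : Finset I), #T = t → ∀ y : I → β,
        cnt (fun p i => σ i (pos p i)) T y + cnt (fun n i => σ i (Sum.inl (rn n i))) T y =
        cnt (fun p i => σ i (Sum.inl (rp p i))) T y + cnt (fun n i => σ i (neg n i)) T y := by
  classical
  have hδ : ∀ T : {T : Finset I // #T = t}, ∃ g : E, ∀ i ∈ T.1, d i + e i g = 0 := by
    intro T
    obtain ⟨g, hg, -⟩ := h T.1 T.2 fun i => - d i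
    exact ⟨g, fun i hi => by rw [hg i hi, add_neg_cancel]⟩
  choose γ hγ using hδ
  have hγ' : ∀ T i, d i + e i (γ T) = 0 ↔ i ∈ T.1 := by
    refine fun T i => ⟨fun hi => ?_, hγ T i⟩
    by_contra hc
    have := hd (γ T) (insert i T.1) (by simpa [hi] using hγ T)
    rw [card_insert_of_notMem hc, T.2] at this
    omega
  have hγinj : Function.Injective γ := by
    intro T T' hTT
    ext i
    rw [← hγ', ← hγ', hTT]
  have hfew : ∀ (g : E) (T : Finset I), g ∉ Set.range γ → (∀ i ∈ T, d i + e i g = 0) → #T < t := by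
    intro g T hg hT
    by_contra! hc
    have hTt := le_antisymm (hd g T hT) hc
    exact hg ⟨⟨T, hTt⟩, h.eq_of_agree hc fun i hi =>
      add_left_cancel ((hγ ⟨T, hTt⟩ i hi).trans (hT i hi).symm)⟩
  have hnz : ∀ (g : E) (T : Finset I), g ≠ 0 → (∀ i ∈ T, e i g = 0) → #T < t := by
    intro g T hg hT
    by_contra! hc
    exact hg (h.eq_zero hc hT)
  let B := Lp ⊕ Ln ⊕ (Ln × {T : Finset I // #T = t})
  let bp : Lp → B := Sum.inl
  let bn : Ln → B := fun n => Sum.inr (Sum.inl n)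
  let bt : (Ln × {T : Finset I // #T = t}) → B := fun q => Sum.inr (Sum.inr q)
  let boxp : Lp → I → F → M ⊕ (B × I × F) := fun p => privBox (rp p) (bp p)
  let boxn : Ln → I → F → M ⊕ (B × I × F) := fun n => privBox (rn n) (bn n)
  let boxt : (Ln × {T : Finset I // #T = t}) → I → F → M ⊕ (B × I × F) := fun q =>
    pairBox (rn q.1) q.2.1 (fun i => d i + e i (γ q.2)) (bp (π q.2 q.1)) (bn q.1) (bt q)
  let s : (Ln × {T : Finset I // #T = t}) → Lp × {T : Finset I // #T = t} :=
    fun q => (π q.2 q.1, q.2)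
  have hs : Function.Injective s := by
    rintro ⟨n, T⟩ ⟨n', T'⟩ hq
    simp only [s, Prod.mk.injEq] at hq
    obtain ⟨h1, rfl⟩ := hq
    rw [hπ T h1]
  refine ⟨B × I × F, inferInstance, fun φ => φ.2.1,
    {q : Lp × {T : Finset I // #T = t} // q ∉ Set.range s} ⊕ (Lp × {g : E // g ∉ Set.range γ}) ⊕
      (Ln × {g : E // g ≠ 0}) ⊕
      (Σ q : Ln × {T : Finset I // #T = t}, {g : E // g ≠ γ q.2}), inferInstance,
    (Lp × {g : E // g ≠ 0}) ⊕ (Ln × {g : E // g ∉ Set.range γ}) ⊕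
      ((Ln × {T : Finset I // #T = t}) × {g : E // g ≠ 0}), inferInstance,
    Sum.elim (fun q i => boxp q.1.1 i (d i + e i (γ q.1.2))) <|
      Sum.elim (fun q i => boxp q.1 i (d i + e i q.2)) <|
      Sum.elim (fun q i => boxn q.1 i (e i q.2)) fun q i => boxt q.1 i (d i + e i q.2),
    Sum.elim (fun q i => boxp q.1 i (e i q.2)) <|
      Sum.elim (fun q i => boxn q.1 i (d i + e i q.2)) fun q i => boxt q.1 i (e i q.2),
    ?_, ?_, ?_, ?_, ?_, ?_⟩
  · rintro (⟨q, _⟩ | q | q | q) i φ hφ <;>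
      simp only [Sum.elim_inl, Sum.elim_inr, boxp, boxn, boxt, privBox, pairBox] at hφ <;>
      split_ifs at hφ <;> simp at hφ <;> simp [← hφ]
  · rintro (q | q | q) i φ hφ <;>
      simp only [Sum.elim_inl, Sum.elim_inr, boxp, boxn, boxt, privBox, pairBox] at hφ <;>
      split_ifs at hφ <;> simp at hφ <;> simp [← hφ]
  · have hp : ∀ p i c, (boxp p i c).isLeft → c = 0 := by
      intro p i c hc; by_contra h0; simp [boxp, privBox, h0] at hc
    have hn : ∀ p i c, (boxn p i c).isLeft → c = 0 := by
      intro p i c hc; by_contra h0; simp [boxn, privBox, h0] at hc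
    have ht : ∀ q i c, (boxt q i c).isLeft → i ∈ q.2.1 := by
      intro q i c hc
      by_contra h0
      simp only [boxt, pairBox, h0, if_false] at hc
      split_ifs at hc <;> simp at hc
    rintro (q | q | q | q)
    · exact hd _ _ fun i hi => hp _ _ _ (mem_filter.1 hi).2
    · exact hd _ _ fun i hi => hp _ _ _ (mem_filter.1 hi).2
    · exact (hnz _ _ q.2.2 fun i hi => hn _ _ _ (mem_filter.1 hi).2).le
    · refine le_of_le_of_eq ?_ q.1.2.2
      exact card_le_card fun i hi => ht _ _ _ (mem_filter.1 hi).2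
  · have hp : ∀ p i c, (boxp p i c).isLeft → c = 0 := by
      intro p i c hc; by_contra h0; simp [boxp, privBox, h0] at hc
    have hn : ∀ p i c, (boxn p i c).isLeft → c = 0 := by
      intro p i c hc; by_contra h0; simp [boxn, privBox, h0] at hc
    have ht : ∀ q i c, (boxt q i c).isLeft → c = 0 := by
      intro q i c hc
      by_contra h0
      simp only [boxt, pairBox, h0, if_false] at hc
      split_ifs at hc <;> simp at hc
    rintro (q | q | q)
    · exact hnz _ _ q.2.2 fun i hi => hp _ _ _ (mem_filter.1 hi).2
    · exact hfew _ _ q.2.2 fun i hi => hn _ _ _ (mem_filter.1 hi).2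
    · exact hnz _ _ q.2.2 fun i hi => ht _ _ _ (mem_filter.1 hi).2
  · have hbpn : ∀ p n, bp p ≠ bn n := fun _ _ => Sum.inl_ne_inr
    have hbpt : ∀ p q, bp p ≠ bt q := fun _ _ => Sum.inl_ne_inr
    have hbnt : ∀ n q, bn n ≠ bt q := fun _ _ hq => Sum.inl_ne_inr (Sum.inr.inj hq)
    have hbp : Function.Injective bp := Sum.inl_injective
    have hbn : Function.Injective bn := Sum.inr_injective.comp Sum.inl_injective
    have hbt : Function.Injective bt := Sum.inr_injective.comp Sum.inr_injective
    have hpn : ∀ (p : Lp) (g : {g : E // g ≠ 0}) (n : Ln) (g' : {g : E // g ∉ Set.range γ})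
        (T : Finset I), #T = t →
        ¬ ∀ i ∈ T, (boxp p i (e i g)).getRight? = (boxn n i (d i + e i g')).getRight? :=
      fun p g n g' T hT hc => (hnz g T g.2 fun i hi =>
        (of_label_privBox (hc i hi)).2 (hbpn _ _)).ne hT
    have htp : ∀ (q : Ln × {T : Finset I // #T = t}) (g : {g : E // g ≠ 0}) (p : Lp)
        (g' : {g : E // g ≠ 0}) (T : Finset I), #T = t →
        ¬ ∀ i ∈ T, (boxt q i (e i g)).getRight? = (boxp p i (e i g')).getRight? :=
      fun q g p g' T hT hc => (hnz g T g.2 fun i hi =>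
        zero_of_label_pairBox (hc i hi) (hbpn _ _) (hbpt _ _)).ne hT
    have htn : ∀ (q : Ln × {T : Finset I // #T = t}) (g : {g : E // g ≠ 0}) (n : Ln)
        (g' : {g : E // g ∉ Set.range γ}) (T : Finset I), #T = t →
        ¬ ∀ i ∈ T, (boxt q i (e i g)).getRight? = (boxn n i (d i + e i g')).getRight? := by
      intro q g n g' T hT hc
      refine g'.2 ⟨q.2, h.eq_of_agree hT.ge fun i hi => add_left_cancel (a := d i) ?_⟩
      rcases of_label_pairBox_privBox (hc i hi) (hbnt _ _) with h1 | h1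
      · rw [h1.2, hγ _ _ h1.1]
      · exact h1.2.symm
    rintro (⟨p, g⟩ | ⟨n, g⟩ | ⟨q, g⟩) (⟨p', g'⟩ | ⟨n', g'⟩ | ⟨q', g'⟩) T hT hc <;>
      simp only [Sum.elim_inl, Sum.elim_inr] at hc
    · obtain rfl : p = p' := by
        by_contra hpp
        exact (hnz g T g.2 fun i hi => (of_label_privBox (hc i hi)).2 (hbp.ne hpp)).ne hT
      have : g = g' := Subtype.ext <| h.eq_of_agree hT.ge fun i hi => (of_label_privBox (hc i hi)).1
      rw [this]
    · exact absurd hc (hpn _ _ _ _ _ hT)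
    · exact absurd (fun i hi => (hc i hi).symm) (htp _ _ _ _ _ hT)
    · exact absurd (fun i hi => (hc i hi).symm) (hpn _ _ _ _ _ hT)
    · obtain rfl : n = n' := by
        by_contra hpp
        exact (hfew g T g.2 fun i hi => (of_label_privBox (hc i hi)).2 (hbn.ne hpp)).ne hT
      have : g = g' := Subtype.ext <| h.eq_of_agree hT.ge fun i hi =>
        add_left_cancel (of_label_privBox (hc i hi)).1
      rw [this]
    · exact absurd (fun i hi => (hc i hi).symm) (htn _ _ _ _ _ hT)
    · exact absurd hc (htp _ _ _ _ _ hT)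
    · exact absurd hc (htn _ _ _ _ _ hT)
    · obtain rfl : q = q' := by
        obtain ⟨n, T₁⟩ := q
        obtain ⟨n', T₂⟩ := q'
        by_contra hqq
        have hbq : bt (n, T₁) ≠ bt (n', T₂) := hbt.ne hqq
        obtain rfl : T₁ = T₂ := hγinj <| h.eq_of_agree hT.ge fun i hi => by
          apply add_left_cancel (a := d i)
          rcases of_label_pairBox (hc i hi) hbq (hbpt _ _) (hbnt _ _)
            (hbpt _ _).symm (hbnt _ _).symm (hbpn _ _) (hbpn _ _).symm
            with h1 | h1
          · rw [hγ _ _ h1.1, hγ _ _ h1.2]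
          · exact h1.2.2
        have hnn : n ≠ n' := fun hnn => hqq (by rw [hnn])
        exact (hnz g T g.2 fun i hi => zero_of_label_pairBox_pairBox (hc i hi) hbq
          (hbpt _ _) (hbnt _ _) (hbpt _ _).symm (hbnt _ _).symm (hbpn _ _) (hbpn _ _).symm
          (hbp.ne ((hπ T₁).ne hnn)) (hbn.ne hnn)).ne hT
      have : g = g' := Subtype.ext <| h.eq_of_agree hT.ge fun i hi =>
        eq_of_label_pairBox (hc i hi) (hbpn _ _) (hbpt _ _) (hbnt _ _)
      rw [this]
  · intro β σ T hT y
    have e1 : cnt (fun p i => σ i (Sum.inl (rp p i))) T y +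
        cnt (fun (q : Lp × {g : E // g ≠ 0}) i => σ i (boxp q.1 i (e i q.2))) T y =
        cnt (fun (q : Lp × {T : Finset I // #T = t}) i =>
          σ i (boxp q.1 i (d i + e i (γ q.2)))) T y +
        cnt (fun (q : Lp × {g : E // g ∉ Set.range γ}) i =>
          σ i (boxp q.1 i (d i + e i q.2))) T y := by
      simp only [cnt_prod]
      rw [cnt, ← sum_add_distrib, ← sum_add_distrib]
      refine sum_congr rfl fun p _ => ?_
      rw [← cnt_range_add γ hγinj (fun g i => σ i (boxp p i (d i + e i g))),
        h.box_trade d (fun i c => σ i (boxp p i c)) hT, cnt_unique (0 : E)]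
      simp [boxp, privBox]
    have e2 : cnt (fun p i => σ i (Sum.inl (rn p i))) T y +
        cnt (fun (q : Ln × {g : E // g ≠ 0}) i => σ i (boxn q.1 i (e i q.2))) T y =
        cnt (fun (q : Ln × {T : Finset I // #T = t}) i =>
          σ i (boxn q.1 i (d i + e i (γ q.2)))) T y +
        cnt (fun (q : Ln × {g : E // g ∉ Set.range γ}) i =>
          σ i (boxn q.1 i (d i + e i q.2))) T y := by
      simp only [cnt_prod]
      rw [cnt, ← sum_add_distrib, ← sum_add_distrib]
      refine sum_congr rfl fun p _ => ?_
      rw [← cnt_range_add γ hγinj (fun g i => σ i (boxn p i (d i + e i g))),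
        h.box_trade d (fun i c => σ i (boxn p i c)) hT, cnt_unique (0 : E)]
      simp [boxn, privBox]
    have e3 : cnt (fun (q : Ln × {T : Finset I // #T = t}) i =>
          σ i (boxp (s q).1 i (d i + e i (γ (s q).2)))) T y +
        cnt (fun (q : (Ln × {T : Finset I // #T = t}) × {g : E // g ≠ 0}) i =>
          σ i (boxt q.1 i (e i q.2))) T y =
        cnt (fun (q : Ln × {T : Finset I // #T = t}) i =>
          σ i (boxn q.1 i (d i + e i (γ q.2)))) T y +
        cnt (fun (q : Σ q : Ln × {T : Finset I // #T = t}, {g : E // g ≠ γ q.2}) i =>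
          σ i (boxt q.1 i (d i + e i q.2))) T y := by
      rw [cnt_prod (Q := {g : E // g ≠ 0}), cnt_sigma, cnt, cnt, ← sum_add_distrib,
        ← sum_add_distrib]
      refine sum_congr rfl fun q _ => ?_
      have := h.box_trade d (fun i c => σ i (boxt q i c)) hT y
      rw [cnt_unique (0 : E) (fun g i => σ i (boxt q i (e i g))), cnt_unique (γ q.2)] at this
      rw [eq_comm]
      convert this using 3
      · refine forall₂_congr fun i hi => ?_
        congr! 2
        by_cases hi : i ∈ q.2.1
        · simp [boxn, boxt, privBox, pairBox, hi, hγ]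
        · have := mt (hγ' q.2 i).1 hi
          simp [boxn, boxt, privBox, pairBox, hi, this]
      · refine forall₂_congr fun i hi => ?_
        congr! 2
        by_cases hi : i ∈ q.2.1
        · simp [boxp, boxt, privBox, pairBox, hi, hγ, s, hπ']
        · have := mt (hγ' q.2 i).1 hi
          simp [boxp, boxt, privBox, pairBox, hi, this, s]
    have e4 := cnt_range_add s hs (fun q i => σ i (boxp q.1 i (d i + e i (γ q.2)))) T y
    simp only [cnt_sum_type, Sum.elim_inl, Sum.elim_inr]
    linarith

end resolve

section labelled

variable {F I E : Type} [Field F] [DecidableEq F] [Fintype F] [Fintype I] [DecidableEq I]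
  [AddCommGroup E] [Module F E] [Fintype E] {t : ℕ} {e : I → E →ₗ[F] F}

/-- The value of a symbol under a labelling of the fresh symbols; the other symbols have value
zero. -/
def lab {M Φ : Type} (ℓ : Φ → F) : M ⊕ Φ → F := Sum.elim (fun _ => 0) ℓ

/-- `privBox` with the fresh symbols collected on the right. -/
def boxSym {M Φ N : Type} (r : I → M ⊕ Φ) (n : N) (i : I) (c : F) : M ⊕ (Φ ⊕ (N × I × F)) :=
  if c = 0 then (r i).map id Sum.inl else Sum.inr (Sum.inr (n, i, c))

/-- All but at most `t` columns of the row contain a fresh symbol occurring in no other column. -/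
def MostlyFresh {M Φ : Type} (t : ℕ) (r : I → M ⊕ Φ) : Prop :=
  ∃ Z : Finset I, #Z ≤ t ∧ ∀ i ∉ Z, ∃ φ, r i = Sum.inr φ ∧ ∀ j ≠ i, r j ≠ Sum.inr φ

theorem mostlyFresh_boxSym {M Φ N : Type} {r : I → M ⊕ Φ} (col : Φ → I)
    (hcol : ∀ i φ, r i = Sum.inr φ → col φ = i) (hr : #{i | (r i).isLeft} ≤ t) (n : N)
    (c : I → F) : MostlyFresh t fun i => boxSym r n i (c i) := by
  refine ⟨_, hr, fun i hi => ?_⟩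
  rw [mem_filter_univ, Sum.not_isLeft, Sum.isRight_iff] at hi
  obtain ⟨φ, hφ⟩ := hi
  by_cases h0 : c i = 0
  · refine ⟨Sum.inl φ, by simp [boxSym, h0, hφ], fun j hj hc => hj ?_⟩
    simp only [boxSym] at hc
    split_ifs at hc
    · rcases hm : r j with m | φ' <;> simp [hm] at hc
      rw [← hcol i φ hφ, ← hcol j φ' hm, hc]
    · simp at hc
  · refine ⟨Sum.inr (n, i, c i), by simp [boxSym, h0], fun j hj hc => hj ?_⟩
    simp only [boxSym] at hc
    split_ifs at hc
    · rcases hm : r j with m | φ' <;> simp [hm] at hc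
    · simp only [Sum.inr.injEq, Prod.mk.injEq] at hc
      exact hc.2.1

theorem exists_labelled_resolution (h : IsCode t e) (hI : t ≤ Fintype.card I) (d : I → F)
    (hd : ∀ (g : E) (T : Finset I), (∀ i ∈ T, d i + e i g = 0) → #T ≤ t)
    {S : Type} (star : S → E →ₗ[F] F)
    (hstar : ∀ Z : Finset I, #Z < t → ∀ s, ∃ g : E, (∀ i ∈ Z, e i g = 0) ∧ star s g ≠ 0)
    {Lp Ln M : Type} [Fintype Lp] [Fintype Ln] (rp : Lp → I → M) (rn : Ln → I → M)
    (π : {T : Finset I // #T = t} → Ln → Lp) (hπ : ∀ T, Function.Injective (π T))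
    (hπ' : ∀ T n, ∀ i ∈ T.1, rp (π T n) i = rn n i) :
    ∃ (Φ : Type) (_ : Fintype Φ) (P : Type) (_ : Fintype P) (N : Type)
      (_ : Fintype N) (pos : P → I → M ⊕ Φ) (neg : N → I → M ⊕ Φ),
      (∀ p, MostlyFresh t (pos p)) ∧ (∀ n, MostlyFresh t (neg n)) ∧
      (∀ n s, ∃ (ℓ : Φ → F) (q : E), star s q ≠ 0 ∧ ∀ i, lab ℓ (neg n i) = e i q) ∧
      (∀ n n', n ≠ n' → ∃ (ℓ : Φ → F) (q q' : E), q ≠ q' ∧ (∀ i, lab ℓ (neg n i) = e i q) ∧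
        ∀ i, lab ℓ (neg n' i) = e i q') ∧
      ∀ (β : Type) (σ : I → M ⊕ Φ → β) (T : Finset I), #T = t → ∀ y : I → β,
        cnt (fun p i => σ i (pos p i)) T y + cnt (fun n i => σ i (Sum.inl (rn n i))) T y =
        cnt (fun p i => σ i (Sum.inl (rp p i))) T y + cnt (fun n i => σ i (neg n i)) T y := by
  classical
  obtain ⟨Φ, _, col, P, _, N, _, pos, neg, hcp, hcn, hpl, hnl, hcol, hcnt⟩ :=
    exists_resolution h d hd rp rn π hπ hπ'
  refine ⟨Φ ⊕ (N × I × F), inferInstance, P ⊕ (N × {g : E // g ≠ 0}), inferInstance, N × E,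
    inferInstance, Sum.elim (fun p i => (pos p i).map id Sum.inl)
      fun q i => boxSym (neg q.1) q.1 i (e i q.2),
    fun q i => boxSym (neg q.1) q.1 i (d i + e i q.2), ?_, ?_, ?_, ?_, ?_⟩
  · rintro (p | ⟨n, g⟩)
    · refine ⟨_, hpl p, fun i hi => ?_⟩
      rw [mem_filter_univ, Sum.not_isLeft, Sum.isRight_iff] at hi
      obtain ⟨φ, hφ⟩ := hi
      refine ⟨Sum.inl φ, by simp [hφ], fun j hj hc => hj ?_⟩
      rcases hm : pos p j with m | φ' <;> simp [hm] at hc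
      rw [← hcp p i φ hφ, ← hcp p j φ' hm, hc]
    · exact mostlyFresh_boxSym col (hcn n) (hnl n).le n _
  · rintro ⟨n, g⟩
    exact mostlyFresh_boxSym col (hcn n) (hnl n).le n _
  · rintro ⟨n, g⟩ s
    obtain ⟨q, hq, hsq⟩ := hstar _ (hnl n) s
    refine ⟨Sum.elim (fun φ => e (col φ) q) fun b => e b.2.1 q, q, hsq, fun i => ?_⟩
    simp only [boxSym]
    split_ifs
    · rcases hm : neg n i with m | φ
      · simpa [lab] using (hq i (by simp [hm])).symm
      · simp [lab, hcn n i φ hm]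
    · simp [lab]
  · rintro ⟨n, g⟩ ⟨n', g'⟩ hne
    by_cases hnn : n = n'
    · subst hnn
      obtain ⟨q, hq⟩ := h.exists_interp hI (hnl n).le d
      have key : ∀ g i, lab (Sum.elim (fun φ => e (col φ) q - d (col φ))
          fun b : N × I × F => e b.2.1 q + b.2.2 - d b.2.1)
          (boxSym (neg n) n i (d i + e i g)) = e i (q + g) := by
        intro g i
        simp only [boxSym]
        split_ifs with h0
        · rcases hm : neg n i with m | φ
          · rw [map_add, hq i (by simp [hm]), h0]
            simp [lab]
          · simp only [lab, Sum.map_inr, Sum.elim_inr, Sum.elim_inl, hcn n i φ hm, map_add]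
            linear_combination - h0
        · simp only [lab, Sum.elim_inr, map_add]
          ring
      refine ⟨_, q + g, q + g', fun hc => hne ?_, key g, key g'⟩
      rw [add_left_cancel hc]
    · let O : Finset I := {i | d i + e i g = 0}
      let O' : Finset I := {i | d i + e i g' = 0}
      let Z : Finset I := {i | d i + e i g = 0 ∧ (neg n i).isLeft}
      let Z' : Finset I := {i | d i + e i g' = 0 ∧ (neg n' i).isLeft}
      let A : Finset I := {i | d i + e i g = 0 ∧ d i + e i g' = 0 ∧ (neg n i).isRight ∧
        neg n i = neg n' i}
      obtain ⟨q, q', hqq, hq, hq', hA⟩ := h.exists_separating hI (O := O) (O' := O') (Z := Z)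
        (Z' := Z') (A := A) (hd g _ fun i hi => (mem_filter_univ i).1 hi)
        (hd g' _ fun i hi => (mem_filter_univ i).1 hi)
        ((card_le_card fun i hi => by
          simp only [Z, mem_filter_univ] at hi ⊢; exact hi.2).trans_lt (hnl n))
        (fun i hi => by simp only [Z, O, mem_filter_univ] at hi ⊢; exact hi.1)
        (fun i hi => by simp only [Z', O', mem_filter_univ] at hi ⊢; exact hi.1)
        (fun i hi => by simp only [A, O, mem_filter_univ] at hi ⊢; exact hi.1)
        (fun i hi => by simp only [A, O', mem_filter_univ] at hi ⊢; exact hi.2.1)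
        (disjoint_left.2 fun i hi hi' => by
          simp only [A, Z, mem_filter_univ] at hi hi'
          simp [← Sum.not_isLeft, hi'.2] at hi)
        (disjoint_left.2 fun i hi hi' => by
          simp only [A, Z', mem_filter_univ] at hi hi'
          simp [← Sum.not_isLeft, hi.2.2.2, hi'.2] at hi)
        (fun hc => by
          obtain ⟨T, hT, hTt⟩ := exists_subset_card_eq hc
          refine hnn (hcol n n' T hTt fun i hi => ?_)
          have := hT hi
          simp only [A, Z, Z', mem_union, mem_inter, mem_filter_univ] at this
          rcases this with h1 | h1
          · rw [h1.2.2.2]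
          · rw [Sum.getRight?_eq_none_iff.2 h1.1.2, Sum.getRight?_eq_none_iff.2 h1.2.2])
      refine ⟨Sum.elim (fun φ => if d (col φ) + e (col φ) g = 0 ∧ neg n (col φ) = Sum.inr φ then
        e (col φ) q else e (col φ) q') fun b => if b.1 = n then e b.2.1 q else e b.2.1 q',
        q, q', hqq, fun i => ?_, fun i => ?_⟩
      · simp only [boxSym]
        split_ifs with h0
        · rcases hm : neg n i with m | φ
          · simpa [lab] using (hq i (by simp [Z, hm, h0])).symm
          · simp [lab, hcn n i φ hm, h0, hm]
        · simp [lab]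
      · simp only [boxSym]
        split_ifs with h0
        · rcases hm : neg n' i with m | φ
          · simpa [lab] using (hq' i (by simp [Z', hm, h0])).symm
          · simp only [lab, Sum.map_inr, Sum.elim_inr, Sum.elim_inl, hcn n' i φ hm]
            split_ifs with h1
            · exact hA i (by simp [A, h0, h1, hm])
            · rfl
        · simp [lab, Ne.symm hnn]
  · intro β σ T hT y
    have h1 := hcnt β (fun i x => σ i (x.map id Sum.inl)) T hT y
    have h2 : cnt (fun n i => σ i ((neg n i).map id Sum.inl)) T y +
        cnt (fun (q : N × {g : E // g ≠ 0}) i => σ i (boxSym (neg q.1) q.1 i (e i q.2))) T y =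
        cnt (fun (q : N × E) i => σ i (boxSym (neg q.1) q.1 i (d i + e i q.2))) T y := by
      simp only [cnt_prod]
      rw [cnt, ← sum_add_distrib]
      refine sum_congr rfl fun n _ => ?_
      rw [h.box_trade d (fun i c => σ i (boxSym (neg n) n i c)) hT, cnt_unique (0 : E)]
      simp [boxSym]
    simp only [cnt_sum_type, Sum.elim_inl, Sum.elim_inr, Sum.map_inl, id] at h1 ⊢
    linarith

end labelled

theorem cnt_sigma_fin {I α L : Type} [Fintype L] (m : L → ℕ) (r : L → I → α) (T : Finset I)
    (x : I → α) : cnt (fun q : Σ l, Fin (m l) => r q.1) T x = cov (fun l => (m l : ℤ)) r T x := by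
  rw [cnt_sigma, cov]
  simp [cnt]

theorem exists_signed_rows {I M : Type} [Fintype I] [DecidableEq I] [Fintype M] (o : M) {t : ℕ}
    (hI : t ≤ Fintype.card I) (f : Finset I → (I → M) → ℤ) (hf : Compat univ t f)
    (hf0 : ∀ T x, 0 ≤ f T x) :
    ∃ (Lp : Type) (_ : Fintype Lp) (Ln : Type) (_ : Fintype Ln) (rp : Lp → I → M)
      (rn : Ln → I → M) (π : {T : Finset I // #T = t} → Ln → Lp),
      (∀ T, Function.Injective (π T)) ∧ (∀ T n, ∀ i ∈ T.1, rp (π T n) i = rn n i) ∧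
      ∀ T, #T = t → ∀ x, cnt rp T x = f T x + cnt rn T x := by
  classical
  obtain ⟨L, _, ε, r, -, hL⟩ := exists_rows_of_compat o t univ (by simpa using hI) f hf
  have hcnt : ∀ T, #T = t → ∀ x, cnt (fun q : Σ l, Fin (ε l).toNat => r q.1) T x =
      f T x + cnt (fun q : Σ l, Fin (- ε l).toNat => r q.1) T x := by
    intro T hT x
    rw [cnt_sigma_fin (fun l => (ε l).toNat), cnt_sigma_fin (fun l => (- ε l).toNat),
      hL T (subset_univ _) hT]
    simp only [cov, ← sum_add_distrib]
    refine sum_congr rfl fun l _ => ?_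
    rw [← add_mul]
    congr 1
    omega
  have hπ : ∀ T : {T : Finset I // #T = t}, ∃ π : (Σ l, Fin (- ε l).toNat) → Σ l, Fin (ε l).toNat,
      Function.Injective π ∧ ∀ n, ∀ i ∈ T.1, r (π n).1 i = r n.1 i := by
    intro T
    obtain ⟨π, hπ, hπ'⟩ := exists_injective_of_card_fiber_le
      (fun (q : Σ l, Fin (- ε l).toNat) (i : T.1) => r q.1 i)
      (fun (q : Σ l, Fin (ε l).toNat) (i : T.1) => r q.1 i) (fun k => by
        have h1 : ∀ q : I → M, (fun i : T.1 => q i) = k ↔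
            ∀ i ∈ T.1, q i = if hi : i ∈ T.1 then k ⟨i, hi⟩ else o := by
          intro q
          rw [funext_iff, Subtype.forall]
          exact forall₂_congr fun i hi => by rw [dif_pos hi]
        simp only [h1]
        have := hcnt T.1 T.2 fun i => if hi : i ∈ T.1 then k ⟨i, hi⟩ else o
        have h0 := hf0 T.1 fun i => if hi : i ∈ T.1 then k ⟨i, hi⟩ else o
        simp only [cnt] at this
        linarith)
    exact ⟨π, hπ, fun n i hi => congrFun (hπ' n) ⟨i, hi⟩⟩
  choose π hπ hπ' using hπ
  exact ⟨_, inferInstance, _, inferInstance, _, _, π, hπ, hπ', hcnt⟩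

section absorber

variable {F I E S : Type} [Field F] [DecidableEq F] [Fintype F] [Fintype I] [DecidableEq I]
  [AddCommGroup E] [Module F E] [Fintype E] {t : ℕ}

/-- A row agreeing with no special codeword in many columns, and also with no codeword with
nonzero multiplicities outside the special ones. -/
def Good {Φ : Type} [Fintype Φ] (t : ℕ) (e : I → E →ₗ[F] F) (star : S → E →ₗ[F] F)
    (y : I → Φ → F) : Prop :=
  ∃ (x : I → Φ → F) (h : Φ → E), (∀ i φ, y i φ = x i φ + e i (h φ)) ∧
    (∃ Z : Finset I, #Z ≤ t ∧ ∀ i ∉ Z, ∃ φ, x i φ = 1 ∧ ∀ j ≠ i, x j φ = 0) ∧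
    (h = 0 ∨ ∀ s, ∃ (ℓ : Φ → F) (q : E), star s q ≠ 0 ∧ ∀ i, ∑ φ, ℓ φ * y i φ = e i q)

theorem exists_absorber {e : I → E →ₗ[F] F} (he : IsCode t e) (hI : t ≤ Fintype.card I)
    (d : I → F) (hd : ∀ (g : E) (T : Finset I), (∀ i ∈ T, d i + e i g = 0) → #T ≤ t)
    (star : S → E →ₗ[F] F)
    (hstar : ∀ Z : Finset I, #Z < t → ∀ s, ∃ g : E, (∀ i ∈ Z, e i g = 0) ∧ star s g ≠ 0)
    {M : Type} [Fintype M] (o : M) (f : Finset I → (I → M) → ℤ) (hf : Compat univ t f)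
    (hf0 : ∀ T x, 0 ≤ f T x) :
    ∃ (Φ : Type) (_ : Fintype Φ) (P : Type) (_ : Fintype P) (N : Type) (_ : Fintype N)
      (pos : P → I → (Φ → F) × M) (host : N → Φ → E) (ρ : N → I → M),
      Function.Injective host ∧ (∀ n s, ∃ φ, star s (host n φ) ≠ 0) ∧
      (∀ p, Good t e star fun i => (pos p i).1) ∧
      ∀ T, #T = t → ∀ y : I → (Φ → F) × M, cnt pos T y =
        ind (∀ i ∈ T, (y i).1 = 0) * f T (fun i => (y i).2) +
        cnt (fun n i => ((fun φ => e i (host n φ), ρ n i) : (Φ → F) × M)) T y := by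
  classical
  obtain ⟨Lp, _, Ln, _, rp, rn, π, hπ, hπ', hpn⟩ := exists_signed_rows o hI f hf hf0
  obtain ⟨Φ, _, P, _, N, _, pos, neg, hpos, hneg, hS1, hS2, hcnt⟩ :=
    exists_labelled_resolution he hI d hd star hstar rp rn π hπ hπ'
  obtain ⟨T₀, -, hT₀⟩ := exists_subset_card_eq (s := (univ : Finset I)) (by simpa using hI)
  let sym : M ⊕ Φ → (Φ → F) × M :=
    Sum.elim (fun m => (0, m)) fun φ => (fun φ' => if φ' = φ then 1 else 0, o)
  have hsym : ∀ (ℓ : Φ → F) s, ∑ φ, ℓ φ * (sym s).1 φ = lab ℓ s := by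
    rintro ℓ (m | φ) <;> simp [sym, lab]
  have hfresh : ∀ r : I → M ⊕ Φ, MostlyFresh t r →
      ∃ Z : Finset I, #Z ≤ t ∧ ∀ i ∉ Z, ∃ φ, (sym (r i)).1 φ = 1 ∧
        ∀ j ≠ i, (sym (r j)).1 φ = 0 := by
    rintro r ⟨Z, hZ, hr⟩
    refine ⟨Z, hZ, fun i hi => ?_⟩
    obtain ⟨φ, h1, h2⟩ := hr i hi
    refine ⟨φ, by simp [sym, h1], fun j hj => ?_⟩
    have := h2 j hj
    rcases hm : r j with m | φ'
    · simp [sym]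
    · rw [hm] at this
      have : φ ≠ φ' := fun hc => this (by rw [hc])
      simp [sym, this]
  have hp : ∀ n, ∃ p : Φ → E, ∀ i ∈ T₀, ∀ φ, e i (p φ) = (sym (neg n i)).1 φ := by
    intro n
    choose p hp using fun φ => he.exists_interp hI hT₀.le fun i => (sym (neg n i)).1 φ
    exact ⟨p, fun i hi φ => hp φ i hi⟩
  choose p hp using hp
  let H : N → AddSubgroup (Φ → E) := fun n =>
    { carrier := {h | ∀ (ℓ : Φ → F) (q : E), (∀ i, lab ℓ (neg n i) = e i q) →
        ∑ φ, ℓ φ • h φ = 0}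
      zero_mem' := by simp
      add_mem' := fun {a b} ha hb ℓ q hℓ => by
        simp [smul_add, sum_add_distrib, ha ℓ q hℓ, hb ℓ q hℓ]
      neg_mem' := fun {a} ha ℓ q hℓ => by simp [ha ℓ q hℓ] }
  have hpq : ∀ n (ℓ : Φ → F) (q : E), (∀ i, lab ℓ (neg n i) = e i q) → ∀ h ∈ H n,
      ∑ φ, ℓ φ • (p n + h) φ = q := by
    intro n ℓ q hℓ h hh
    simp only [Pi.add_apply, smul_add, sum_add_distrib, hh ℓ q hℓ, add_zero]
    refine he.eq_of_agree hT₀.ge fun i hi => ?_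
    simp [hp n i hi, hsym, hℓ]
  refine ⟨Φ, inferInstance, P ⊕ (Σ n, {h : H n // h ≠ 0}), inferInstance, Σ n, H n, inferInstance,
    Sum.elim (fun a i => sym (pos a i)) fun q i =>
      (fun φ => (sym (neg q.1 i)).1 φ + e i (q.2.1.1 φ), (sym (neg q.1 i)).2),
    fun q => p q.1 + q.2.1, fun q i => (sym (neg q.1 i)).2, ?_, ?_, ?_, ?_⟩
  · rintro ⟨n, h, hh⟩ ⟨n', h', hh'⟩ hq
    obtain rfl : n = n' := by
      by_contra hnn
      obtain ⟨ℓ, q, q', hqq, h1, h2⟩ := hS2 n n' hnn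
      refine hqq ?_
      rw [← hpq n ℓ q h1 h hh, ← hpq n' ℓ q' h2 h' hh']
      exact sum_congr rfl fun φ _ => by rw [show p n + h = p n' + h' from hq]
    obtain rfl : h = h' := add_left_cancel hq
    rfl
  · rintro ⟨n, h, hh⟩ s
    obtain ⟨ℓ, q, hs, hq⟩ := hS1 n s
    by_contra! hc
    refine hs ?_
    rw [← hpq n ℓ q hq h hh]
    simp only [map_sum, map_smul, smul_eq_mul]
    exact sum_eq_zero fun φ _ => by rw [hc φ, mul_zero]
  · rintro (a | ⟨n, h, hh⟩)
    · exact ⟨fun i => (sym (pos a i)).1, 0, by simp, hfresh _ (hpos a), Or.inl rfl⟩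
    · refine ⟨fun i => (sym (neg n i)).1, h.1, by simp, hfresh _ (hneg n), Or.inr fun s => ?_⟩
      obtain ⟨ℓ, q, hs, hq⟩ := hS1 n s
      refine ⟨ℓ, q, hs, fun i => ?_⟩
      have := congrArg (e i) (h.2 ℓ q hq)
      simp only [map_sum, map_smul, smul_eq_mul, map_zero] at this
      simp [mul_add, sum_add_distrib, this, hsym, hq]
  · intro T hT y
    have h1 := hcnt _ (fun _ => sym) T hT y
    have h2 : cnt (fun n i => sym (neg n i)) T y +
        cnt (fun (q : Σ n, {h : H n // h ≠ 0}) i => ((fun φ => (sym (neg q.1 i)).1 φ +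
          e i (q.2.1.1 φ), (sym (neg q.1 i)).2) : (Φ → F) × M)) T y =
        cnt (fun (q : Σ n, H n) i => ((fun φ => e i ((p q.1 + q.2.1) φ),
          (sym (neg q.1 i)).2) : (Φ → F) × M)) T y := by
      rw [cnt_sigma, cnt_sigma, cnt, ← sum_add_distrib]
      refine sum_congr rfl fun n _ => ?_
      have h3 := cnt_unique (0 : H n) (fun (h : H n) i => ((fun φ => (sym (neg n i)).1 φ +
          e i (h.1 φ), (sym (neg n i)).2) : (Φ → F) × M)) T y
      choose k hk using fun φ => he.exists_interp hI hT.le fun i =>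
        (sym (neg n i)).1 φ - e i (p n φ)
      have hkH : k ∈ H n := fun ℓ q hℓ => by
        refine he.eq_zero hT.ge fun i hi => ?_
        have h4 := congrArg (e i) (hpq n ℓ q hℓ 0 (H n).zero_mem)
        simp only [map_sum, map_smul, smul_eq_mul, add_zero] at h4
        simp only [map_sum, map_smul, smul_eq_mul, hk _ i hi, mul_sub, sum_sub_distrib, hsym, hℓ,
          h4, sub_self]
      have h5 : cnt (fun (h : H n) i => ((fun φ => (sym (neg n i)).1 φ +
          e i (h.1 φ), (sym (neg n i)).2) : (Φ → F) × M)) T y =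
          cnt (fun (h : H n) i => ((fun φ => e i ((p n + h.1) φ),
          (sym (neg n i)).2) : (Φ → F) × M)) T y := by
        refine cnt_equiv (Equiv.addLeft (⟨k, hkH⟩ : H n)) fun h i hi => ?_
        ext φ
        · simp only [Equiv.coe_addLeft, AddSubgroup.coe_add, Pi.add_apply, map_add, hk φ i hi]
          ring
        · rfl
      rw [← h5, h3]
      simp
    have h6 : ∀ (L : Type) [Fintype L] (r : L → I → M),
        cnt (fun l i => sym (Sum.inl (r l i))) T y =
          ind (∀ i ∈ T, (y i).1 = 0) * cnt r T fun i => (y i).2 := by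
      intro L _ r
      rw [cnt, cnt, mul_sum]
      refine sum_congr rfl fun l _ => ?_
      rw [ind_mul]
      refine ind_congr ?_
      rw [← forall₂_and]
      refine forall₂_congr fun i _ => ?_
      simp [sym, Prod.ext_iff, eq_comm]
    simp only [cnt_sum_type, Sum.elim_inl, Sum.elim_inr]
    rw [h6, h6, hpn T hT] at h1
    linarith

end absorber

section infinities

variable {K S M : Type} [Fintype K] [DecidableEq K] [Fintype S] [DecidableEq S] [DecidableEq M]

/-- The number of occurrences of the capped symbol `s` of the row `w` within the columns `T`. -/
def nInf (T : Finset K) (w : K → M ⊕ S) (s : S) : ℕ := #{i ∈ T | w i = Sum.inr s}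

theorem nInf_mono {T T' : Finset K} (h : T ⊆ T') (w : K → M ⊕ S) : nInf T w ≤ nInf T' w :=
  fun _ => card_le_card (filter_subset_filter _ h)

theorem nInf_congr {M' : Type} [DecidableEq M'] {T : Finset K} {w : K → M ⊕ S} {w' : K → M' ⊕ S}
    (h : ∀ i ∈ T, (w i).getRight? = (w' i).getRight?) : nInf T w = nInf T w' := by
  ext s
  refine congrArg card (filter_congr fun i hi => ?_)
  rw [← Sum.getRight?_eq_some_iff, h i hi, Sum.getRight?_eq_some_iff]

theorem sum_nInf (T : Finset K) (w : K → M ⊕ S) : ∑ s, nInf T w s = #{i ∈ T | (w i).isRight} := by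
  simp only [nInf]
  rw [← card_biUnion]
  · congr 1
    ext i
    simp [Sum.isRight_iff]
  · intro s _ s' _ hs
    rw [Function.onFun, disjoint_left]
    intro i hi hi'
    simp only [mem_filter] at hi hi'
    exact hs (Sum.inr.inj (hi.2.symm.trans hi'.2))

theorem sum_nInf_add (T : Finset K) (w : K → M ⊕ S) :
    ∑ s, nInf T w s + #{i ∈ T | (w i).isLeft} = #T := by
  rw [sum_nInf, ← card_filter_add_card_filter_not (s := T) fun i => (w i).isRight = true]
  simp

/-- The rows with at least `j` capped symbols of a design of strength `t`, in which the number of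
occurrences of `s` in a row is at most `R s`. -/
structure IsP (t : ℕ) (R : S → ℕ) (j : ℕ) (W : Set (K → M ⊕ S)) : Prop where
  cap : ∀ w ∈ W, nInf univ w ≤ R
  ge : ∀ w ∈ W, j ≤ ∑ s, nInf univ w s
  cover : ∀ T : Finset K, #T = t → ∀ x : K → M ⊕ S, nInf T x ≤ R → j ≤ ∑ s, nInf T x s →
    ∃ w ∈ W, ∀ i ∈ T, w i = x i
  simple : ∀ w ∈ W, ∀ w' ∈ W, ∀ T : Finset K, #T = t → (∀ i ∈ T, w i = w' i) → w = w'

end infinities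

section polynomials

open Polynomial

variable {F K S M κ : Type} [Field F] [Fintype K] [DecidableEq K] [Fintype S] [DecidableEq S]
  [DecidableEq M]

/-- The polynomial vanishing to order `τ s` at `β s`. -/
noncomputable def rootPoly (β : S → F) (τ : S → ℕ) : F[X] := ∏ s, (X - C (β s)) ^ τ s

theorem rootPoly_monic (β : S → F) (τ : S → ℕ) : (rootPoly β τ).Monic :=
  monic_prod_of_monic _ _ fun _ _ => (monic_X_sub_C _).pow _

theorem natDegree_rootPoly (β : S → F) (τ : S → ℕ) : (rootPoly β τ).natDegree = ∑ s, τ s := by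
  rw [rootPoly, natDegree_prod_of_monic _ _ fun _ _ => (monic_X_sub_C _).pow _]
  simp

theorem degree_rootPoly (β : S → F) (τ : S → ℕ) :
    (rootPoly β τ).degree = ((∑ s, τ s : ℕ) : WithBot ℕ) := by
  rw [degree_eq_natDegree (rootPoly_monic β τ).ne_zero, natDegree_rootPoly]

theorem eval_rootPoly_ne_zero {α : K → F} {β : S → F} (hαβ : ∀ i s, α i ≠ β s) (τ : S → ℕ)
    (i : K) : (rootPoly β τ).eval (α i) ≠ 0 := by
  rw [rootPoly, eval_prod, prod_ne_zero_iff]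
  intro s _
  simp only [eval_pow, eval_sub, eval_X, eval_C]
  exact pow_ne_zero _ (sub_ne_zero.2 (hαβ i s))

theorem rootPoly_dvd_iff {β : S → F} (hβ : Function.Injective β) {τ : S → ℕ} {f : F[X]} :
    rootPoly β τ ∣ f ↔ ∀ s, (X - C (β s)) ^ τ s ∣ f := by
  refine ⟨fun h s => (dvd_prod_of_mem (fun s => (X - C (β s)) ^ τ s) (mem_univ s)).trans h,
    fun h => Fintype.prod_dvd_of_coprime (fun s s' hs => ?_) h⟩
  exact (pairwise_coprime_X_sub_C hβ hs).pow

theorem rootPoly_dvd_of_le (β : S → F) {τ τ' : S → ℕ} (h : τ ≤ τ') :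
    rootPoly β τ ∣ rootPoly β τ' :=
  prod_dvd_prod_of_dvd _ _ fun s _ => pow_dvd_pow _ (h s)

/-- A polynomial of degree less than `t` with `t` zeros, some of them prescribed as divisibility by
`rootPoly`, vanishes. -/
theorem eq_zero_of_rootPoly_dvd {α : K → F} (hα : Function.Injective α) {β : S → F}
    (hαβ : ∀ i s, α i ≠ β s) {t : ℕ} {τ : S → ℕ} {A : Finset K}
    (hA : t ≤ ∑ s, τ s + #A) {f : F[X]} (hf : f.degree < t) (hτ : rootPoly β τ ∣ f)
    (hfA : ∀ i ∈ A, f.eval (α i) = 0) : f = 0 := by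
  obtain ⟨g, rfl⟩ := hτ
  have hg : g = 0 := by
    refine eq_zero_of_degree_lt_of_eval_index_eq_zero (s := A) (v := α) hα.injOn ?_ fun i hi => ?_
    · by_contra! hc
      refine hf.not_ge ?_
      rw [degree_mul, degree_rootPoly]
      refine le_trans ?_ (add_le_add_right hc _)
      exact_mod_cast hA
    · have := hfA i hi
      rw [eval_mul] at this
      exact (mul_eq_zero.1 this).resolve_left (eval_rootPoly_ne_zero hαβ τ i)
  rw [hg, mul_zero]

theorem exists_interpolation {α : K → F} (hα : Function.Injective α) {β : S → F}
    (hαβ : ∀ i s, α i ≠ β s) (q : F[X]) {t : ℕ} {τ : S → ℕ} {A : Finset K}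
    (hA : ∑ s, τ s + #A = t) (z : K → F) :
    ∃ f : F[X], (f - q).degree < t ∧ rootPoly β τ ∣ f ∧ ∀ i ∈ A, f.eval (α i) = z i := by
  by_cases ht : t = 0
  · subst ht
    obtain ⟨h1, h2⟩ := Nat.add_eq_zero_iff.1 hA
    refine ⟨q, by simp, ?_, by simp [card_eq_zero.1 h2]⟩
    have : rootPoly β τ = 1 :=
      (rootPoly_monic β τ).natDegree_eq_zero.1 (by rw [natDegree_rootPoly, h1])
    simp [this]
  have hm := rootPoly_monic β τ
  let r : K → F := fun i => z i / (rootPoly β τ).eval (α i) - (q /ₘ rootPoly β τ).eval (α i)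
  let g := Lagrange.interpolate A α r
  refine ⟨rootPoly β τ * (q /ₘ rootPoly β τ + g), ?_, dvd_mul_right _ _, fun i hi => ?_⟩
  · have h1 : rootPoly β τ * (q /ₘ rootPoly β τ + g) - q =
        rootPoly β τ * g - q %ₘ rootPoly β τ := by
      linear_combination modByMonic_add_div q (rootPoly β τ)
    rw [h1]
    refine (degree_sub_le _ _).trans_lt (max_lt ?_ ?_)
    · by_cases hg : g = 0
      · rw [hg, mul_zero, degree_zero]
        exact WithBot.bot_lt_coe _
      · have h2 : g.degree < #A := Lagrange.degree_interpolate_lt r hα.injOn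
        rw [degree_eq_natDegree hg] at h2
        rw [degree_mul, degree_rootPoly, degree_eq_natDegree hg]
        have h3 : g.natDegree < #A := by exact_mod_cast h2
        exact_mod_cast (by omega : ∑ s, τ s + g.natDegree < t)
    · refine (degree_modByMonic_lt q hm).trans_le ?_
      rw [degree_rootPoly]
      exact_mod_cast (by omega : ∑ s, τ s ≤ t)
  · have h0 := eval_rootPoly_ne_zero hαβ τ i
    have h2 : g.eval (α i) = r i := Lagrange.eval_interpolate_at_node r hα.injOn hi
    rw [eval_mul, eval_add, h2]
    simp only [r]
    field_simp
    ring

/-- The row obtained from `w` by appending to each uncapped symbol the value of `f`. -/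
def lift (α : K → F) (w : K → M ⊕ S) (f : κ → F[X]) (i : K) : (M × (κ → F)) ⊕ S :=
  (w i).map (fun m => (m, fun x => (f x).eval (α i))) id

theorem getRight?_lift (α : K → F) (w : K → M ⊕ S) (f : κ → F[X]) (i : K) :
    (lift α w f i).getRight? = (w i).getRight? := by
  rw [lift]
  cases w i <;> rfl

theorem nInf_lift [DecidableEq F] [Fintype κ] (α : K → F) (w : K → M ⊕ S) (f : κ → F[X])
    (T : Finset K) : nInf T (lift α w f) = nInf T w :=
  nInf_congr fun _ _ => getRight?_lift _ _ _ _

theorem eq_of_lift_eq {α : K → F} {w w' : K → M ⊕ S} {f f' : κ → F[X]} {i : K}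
    (h : lift α w f i = lift α w' f' i) :
    w i = w' i ∧ ((w i).isLeft → ∀ x, (f x).eval (α i) = (f' x).eval (α i)) := by
  rw [lift, lift] at h
  rcases hw : w i with m | s <;> rcases hw' : w' i with m' | s' <;> simp [hw, hw'] at h ⊢
  · exact ⟨h.1, fun x => congrFun h.2 x⟩
  · exact h

theorem eq_of_lift_agree {α : K → F} (hα : Function.Injective α) {β : S → F}
    (hαβ : ∀ i s, α i ≠ β s) {q : F[X]} {t : ℕ} {w w' : K → M ⊕ S} {f f' : κ → F[X]}
    (hf : ∀ x, (f x - q).degree < t) (hf' : ∀ x, (f' x - q).degree < t)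
    (hw : ∀ x, rootPoly β (nInf univ w) ∣ f x) (hw' : ∀ x, rootPoly β (nInf univ w') ∣ f' x)
    {T : Finset K} (hT : #T = t) (h : ∀ i ∈ T, lift α w f i = lift α w' f' i) :
    f = f' ∧ ∀ i ∈ T, w i = w' i := by
  have h1 : ∀ i ∈ T, w i = w' i := fun i hi => (eq_of_lift_eq (h i hi)).1
  refine ⟨funext fun x => sub_eq_zero.1 ?_, h1⟩
  refine eq_zero_of_rootPoly_dvd hα hαβ (τ := nInf T w) (A := {i ∈ T | (w i).isLeft})
    ((sum_nInf_add T w).trans hT).ge ?_ ?_ fun i hi => ?_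
  · rw [← sub_sub_sub_cancel_right _ _ q]
    exact (degree_sub_le _ _).trans_lt (max_lt (hf x) (hf' x))
  · refine dvd_sub ((rootPoly_dvd_of_le β (nInf_mono (subset_univ T) w)).trans (hw x)) ?_
    rw [nInf_congr fun i hi => congrArg Sum.getRight? (h1 i hi)]
    exact (rootPoly_dvd_of_le β (nInf_mono (subset_univ T) w')).trans (hw' x)
  · rw [mem_filter] at hi
    rw [eval_sub, (eq_of_lift_eq (h i hi.1)).2 hi.2 x, sub_self]

theorem exists_lift [DecidableEq F] [Fintype κ] {α : K → F} (hα : Function.Injective α)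
    {β : S → F} (hαβ : ∀ i s, α i ≠ β s) (q : F[X]) {t : ℕ} {T : Finset K} (hT : #T = t)
    (x : K → (M × (κ → F)) ⊕ S) :
    ∃ f : κ → F[X], (∀ c, (f c - q).degree < t) ∧ (∀ c, rootPoly β (nInf T x) ∣ f c) ∧
      ∀ w : K → M ⊕ S, (∀ i ∈ T, w i = (x i).map Prod.fst id) → ∀ i ∈ T, lift α w f i = x i := by
  have := fun c : κ => exists_interpolation hα hαβ q ((sum_nInf_add T x).trans hT)
    fun i => Sum.elim (fun m => m.2 c) (fun _ => 0) (x i)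
  choose f h1 h2 h3 using this
  refine ⟨f, h1, h2, fun w hw i hi => ?_⟩
  rw [lift, hw i hi]
  rcases hm : x i with m | s
  · refine congrArg Sum.inl (Prod.ext rfl (funext fun c => ?_))
    have := h3 c i (mem_filter.2 ⟨hi, by simp [hm]⟩)
    simpa [hm] using this
  · rfl

/-- The caps `R` restricted to the orders of vanishing of `f`. -/
noncomputable def capm (β : S → F) (R : S → ℕ) (f : κ → F[X]) (s : S) : ℕ :=
  @Nat.findGreatest (fun r => ∀ x, (X - C (β s)) ^ r ∣ f x) (Classical.decPred _) (R s)

theorem capm_le (β : S → F) (R : S → ℕ) (f : κ → F[X]) : capm β R f ≤ R :=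
  fun _ => @Nat.findGreatest_le _ (Classical.decPred _) _

theorem rootPoly_capm_dvd {β : S → F} (hβ : Function.Injective β) (R : S → ℕ) (f : κ → F[X])
    (x : κ) : rootPoly β (capm β R f) ∣ f x := by
  refine (rootPoly_dvd_iff hβ).2 fun s => ?_
  exact @Nat.findGreatest_spec _ (fun r => ∀ x, (X - C (β s)) ^ r ∣ f x) (Classical.decPred _) _
    (Nat.zero_le (R s)) (by simp) x

theorem le_capm {β : S → F} (hβ : Function.Injective β) {R τ : S → ℕ} {f : κ → F[X]} (hτ : τ ≤ R)
    (h : ∀ x, rootPoly β τ ∣ f x) : τ ≤ capm β R f := fun s =>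
  @Nat.le_findGreatest _ _ (Classical.decPred _) _ (hτ s) fun x => (rootPoly_dvd_iff hβ).1 (h x) s

theorem nInf_map_fst {V : Type} [DecidableEq V] (T : Finset K) (x : K → (M × V) ⊕ S) :
    nInf T (fun i => (x i).map Prod.fst id) = nInf T x :=
  nInf_congr fun i _ => by cases x i <;> rfl

theorem exists_glued [DecidableEq F] [Fintype κ] {α : K → F} (hα : Function.Injective α)
    {β : S → F} (hβ : Function.Injective β) (hαβ : ∀ i s, α i ≠ β s) (q : F[X]) {t : ℕ}
    (R : S → ℕ) (hD : ∀ f : κ → F[X], (∀ x, (f x - q).degree < t) →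
      ∃ W : Set (K → M ⊕ S), IsP t (capm β R f) 0 W) :
    ∃ W : Set (K → (M × (κ → F)) ⊕ S), IsP t R 0 W := by
  choose W hW using hD
  refine ⟨{w' | ∃ f hf, ∃ w ∈ W f hf, lift α w f = w'}, ?_, fun _ _ => Nat.zero_le _, ?_, ?_⟩
  · rintro _ ⟨f, hf, w, hw, rfl⟩
    rw [nInf_lift]
    exact ((hW f hf).cap w hw).trans (capm_le _ _ _)
  · intro T hT x hx _
    obtain ⟨f, hf, hxf, h⟩ := exists_lift hα hαβ q hT x
    obtain ⟨w, hw, hwx⟩ := (hW f hf).cover T hT (fun i => (x i).map Prod.fst id)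
      (by rw [nInf_map_fst]; exact le_capm hβ hx hxf) (Nat.zero_le _)
    exact ⟨_, ⟨f, hf, w, hw, rfl⟩, h w hwx⟩
  · rintro _ ⟨f, hf, w, hw, rfl⟩ _ ⟨f', hf', w', hw', rfl⟩ T hT h
    have hd : ∀ f hf, ∀ w ∈ W f hf, ∀ x, rootPoly β (nInf univ w) ∣ f x := fun f hf w hw x =>
      (rootPoly_dvd_of_le β ((hW f hf).cap w hw)).trans (rootPoly_capm_dvd hβ R f x)
    obtain ⟨rfl, h1⟩ := eq_of_lift_agree hα hαβ hf hf' (hd f hf w hw) (hd f' hf' w' hw') hT h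
    rw [(hW f hf).simple w hw w' hw' T hT h1]

end polynomials

section pattern

variable {K S M : Type} [Fintype K] [DecidableEq K] [Fintype S] [DecidableEq S] [DecidableEq M]

/-- Replace the entries of `w` by capped symbols where the pattern `a` prescribes them. -/
def overlay (a : K → Option S) (w : K → M ⊕ S) (i : K) : M ⊕ S :=
  (a i).elim (w i) Sum.inr

theorem overlay_some {a : K → Option S} {w : K → M ⊕ S} {i : K} {s : S} (h : a i = some s) :
    overlay a w i = Sum.inr s := by simp [overlay, h]

theorem overlay_none {a : K → Option S} {w : K → M ⊕ S} {i : K} (h : a i = none) :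
    overlay a w i = w i := by simp [overlay, h]

/-- The multiplicities of the capped symbols in a pattern. -/
def patCount (a : K → Option S) (s : S) : ℕ := #{i | a i = some s}

theorem sum_patCount (a : K → Option S) : ∑ s, patCount a s = #{i | (a i).isSome} := by
  simp only [patCount]
  rw [← card_biUnion]
  · congr 1
    ext i
    simp [Option.isSome_iff_exists]
  · intro s _ s' _ hs
    rw [Function.onFun, disjoint_left]
    intro i hi hi'
    simp only [mem_filter_univ] at hi hi'
    exact hs (Option.some.inj (hi.symm.trans hi'))

theorem nInf_eq_patCount {a : K → Option S} {w : K → M ⊕ S}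
    (h : ∀ i, (w i).getRight? = a i) : nInf univ w = patCount a := by
  ext s
  refine congrArg card (filter_congr fun i _ => ?_)
  rw [← Sum.getRight?_eq_some_iff, h]

theorem sum_patCount_add (a : K → Option S) :
    ∑ s, patCount a s + #{i | a i = none} = Fintype.card K := by
  rw [sum_patCount, ← card_univ,
    ← card_filter_add_card_filter_not (s := (univ : Finset K)) fun i => (a i).isSome = true]
  simp

end pattern

section top

open Polynomial

variable {F K S M : Type} [Field F] [DecidableEq F] [Fintype K] [DecidableEq K] [Fintype S]
  [DecidableEq S] [DecidableEq M]

theorem exists_top {α : K → F} (hα : Function.Injective α) {t : ℕ} (R : S → ℕ)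
    (hR : ∑ s, R s ≤ t) (o : M) {W : Set (K → M ⊕ S)} (hW : IsP t 0 0 W) :
    ∃ W' : Set (K → (M × ((K → Option S) → F)) ⊕ S), IsP t R (∑ s, R s) W' := by
  classical
  set t' := t - ∑ s, R s with ht'
  have hαβ : ∀ (i : K) (s : Empty), α i ≠ s.elim := fun _ s => s.elim
  have hWl : ∀ r ∈ W, ∀ i, (r i).isLeft := by
    intro r hr i
    rcases hm : r i with m | s
    · rfl
    · have h0 : nInf univ r s = 0 := Nat.le_zero.1 (hW.cap r hr s)
      rw [nInf, card_eq_zero] at h0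
      exact absurd (mem_filter.2 ⟨mem_univ i, hm⟩) (by rw [h0]; simp)
  let q : (K → Option S) → (K → Option S) → F[X] := fun a x =>
    C (if x = a then 1 else 0) * X ^ t'
  have hrow : ∀ a, ∀ r ∈ W, ∀ y : (K → Option S) → F[X], ∀ i,
      (overlay a (lift α r y) i).getRight? = a i := by
    intro a r hr y i
    rcases hai : a i with _ | s
    · rw [overlay_none hai, getRight?_lift, Sum.getRight?_eq_none_iff]
      exact hWl r hr i
    · rw [overlay_some hai, Sum.getRight?_inr]
  refine ⟨{w | ∃ a, patCount a = R ∧ ∃ r ∈ W, (∀ i, (a i).isSome → r i = Sum.inl o) ∧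
    ∃ y : (K → Option S) → F[X], (∀ x, (y x - q a x).degree < t') ∧ overlay a (lift α r y) = w},
    ?_, ?_, ?_, ?_⟩
  · rintro _ ⟨a, ha, r, hr, -, y, -, rfl⟩
    rw [nInf_eq_patCount (hrow a r hr y), ha]
  · rintro _ ⟨a, ha, r, hr, -, y, -, rfl⟩
    rw [nInf_eq_patCount (hrow a r hr y), ha]
  · intro T hT x hx hx'
    have hxR : nInf T x = R := funext fun s =>
      (sum_eq_sum_iff_of_le fun s _ => hx s).1
        (le_antisymm (sum_le_sum fun s _ => hx s) hx') s (mem_univ s)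
    let a : K → Option S := fun i => if i ∈ T then (x i).getRight? else none
    have haR : patCount a = R := by
      rw [← hxR]
      ext s
      simp only [patCount, nInf, a]
      congr 1
      ext i
      by_cases hi : i ∈ T <;> simp [hi]
    obtain ⟨r, hr, hrx⟩ := hW.cover T hT
      (fun i => Sum.inl (Sum.elim (fun m => m.1) (fun _ => o) (x i)))
      (fun s => by simp [nInf]) (Nat.zero_le _)
    have hcard := sum_nInf_add T x
    rw [hxR, hT] at hcard
    have := fun c => exists_interpolation hα hαβ (q a c) (t := t') (τ := 0)
      (A := {i ∈ T | (x i).isLeft}) (by simp; omega)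
      fun i => Sum.elim (fun m => m.2 c) (fun _ => 0) (x i)
    choose y hy _ hyx using this
    refine ⟨_, ⟨a, haR, r, hr, fun i hi => ?_, y, hy, rfl⟩, fun i hi => ?_⟩
    · by_cases hiT : i ∈ T
      · simp only [a, hiT, if_true] at hi
        rw [hrx i hiT]
        rcases hm : x i with m | s
        · simp [hm] at hi
        · rfl
      · simp [a, hiT] at hi
    · rcases hm : x i with m | s
      · rw [overlay_none (by simp [a, hm]), lift, hrx i hi]
        refine congrArg Sum.inl (Prod.ext (by simp [hm]) (funext fun c => ?_))
        simpa [hm] using hyx c i (mem_filter.2 ⟨hi, by simp [hm]⟩)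
      · exact overlay_some (by simp [a, hm, hi])
  · rintro _ ⟨a, ha, r, hr, hro, y, hy, rfl⟩ _ ⟨a', ha', r', hr', hro', y', hy', rfl⟩ T hT h
    have haa : ∀ i ∈ T, a i = a' i := fun i hi => by
      rw [← hrow a r hr y i, ← hrow a' r' hr' y' i, h i hi]
    have hlift : ∀ i ∈ T, a i = none → lift α r y i = lift α r' y' i := fun i hi hai => by
      have := h i hi
      rwa [overlay_none hai, overlay_none ((haa i hi).symm.trans hai)] at this
    have heval : ∀ i ∈ T, a i = none → ∀ c, (y c).eval (α i) = (y' c).eval (α i) :=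
      fun i hi hai => (eq_of_lift_eq (hlift i hi hai)).2 (hWl r hr i)
    have hJ : #{i | (a i).isSome} = ∑ s, R s := by rw [← sum_patCount, ha]
    have hJ' : #{i | (a' i).isSome} = ∑ s, R s := by rw [← sum_patCount, ha']
    have hsplit : #{i ∈ T | (a i).isSome} + #{i ∈ T | a i = none} = t := by
      rw [← hT, ← card_filter_add_card_filter_not (s := T) fun i => (a i).isSome = true]
      simp
    have hsub : ({i ∈ T | (a i).isSome} : Finset K) ⊆ ({i | (a i).isSome} : Finset K) :=
      filter_subset_filter _ (subset_univ _)
    by_cases hne : a = a'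
    · subst hne
      have hle := card_le_card hsub
      obtain rfl : y = y' := funext fun c => sub_eq_zero.1 <| by
        refine eq_zero_of_rootPoly_dvd hα hαβ (τ := 0) (t := t') (A := {i ∈ T | a i = none})
          (by simp; omega) ?_ (by simp [rootPoly]) fun i hi => ?_
        · rw [← sub_sub_sub_cancel_right _ _ (q a c)]
          exact (degree_sub_le _ _).trans_lt (max_lt (hy c) (hy' c))
        · rw [mem_filter] at hi
          rw [eval_sub, heval i hi.1 hi.2, sub_self]
      obtain ⟨T₂, hT₂, hT₂t⟩ := exists_subset_card_eq (n := t)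
        (s := ({i | (a i).isSome} : Finset K) ∪ {i ∈ T | a i = none}) (by
          rw [card_union_of_disjoint]
          · omega
          · rw [disjoint_left]
            intro i hi hi'
            simp only [mem_filter] at hi hi'
            simp [hi'.2] at hi)
      rw [hW.simple r hr r' hr' T₂ hT₂t fun i hi => ?_]
      have := hT₂ hi
      simp only [mem_union, mem_filter, mem_univ, true_and] at this
      rcases this with h1 | h1
      · rw [hro i h1, hro' i h1]
      · exact (eq_of_lift_eq (hlift i h1.1 h1.2)).1
    · exfalso
      have hlt : #{i ∈ T | (a i).isSome} < ∑ s, R s := by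
        rw [← hJ]
        refine lt_of_le_of_ne (card_le_card hsub) fun hc => hne ?_
        have h1 := eq_of_subset_of_card_le hsub hc.ge
        have h2 : ∀ i, (a i).isSome → i ∈ T := fun i hi => by
          have : i ∈ ({i ∈ T | (a i).isSome} : Finset K) := by
            rw [h1]; exact (mem_filter_univ i).2 hi
          exact (mem_filter.1 this).1
        have h3 : ({i | (a i).isSome} : Finset K) = ({i | (a' i).isSome} : Finset K) := by
          refine eq_of_subset_of_card_le (fun i hi => ?_) (hJ'.trans hJ.symm).le
          rw [mem_filter_univ] at hi ⊢
          rwa [← haa i (h2 i hi)]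
        funext i
        by_cases hi : i ∈ T
        · exact haa i hi
        · have h4 : a i = none := by
            by_contra hc
            exact hi (h2 i (Option.isSome_iff_ne_none.2 hc))
          have h5 : i ∉ ({i | (a' i).isSome} : Finset K) := by
            rw [← h3, mem_filter_univ, h4]
            simp
          rw [mem_filter_univ] at h5
          rw [h4]
          exact (by simpa using h5 : a' i = none).symm
      have h0 : y a - y' a = 0 := by
        refine eq_zero_of_rootPoly_dvd hα hαβ (τ := 0) (t := t' + 1) (A := {i ∈ T | a i = none})
          (by simp; omega) ?_ (by simp [rootPoly]) fun i hi => ?_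
        · have h6 : y a - y' a = (y a - q a a) - (y' a - q a' a) + (q a a - q a' a) := by ring
          have h7 : q a a - q a' a = X ^ t' := by simp [q, hne]
          rw [h6, h7]
          refine (degree_add_le _ _).trans_lt (max_lt ?_ ?_)
          · refine ((degree_sub_le _ _).trans_lt (max_lt (hy a) (hy' a))).trans ?_
            exact_mod_cast Nat.lt_succ_self t'
          · rw [degree_X_pow]
            exact_mod_cast Nat.lt_succ_self t'
        · rw [mem_filter] at hi
          rw [eval_sub, heval i hi.1 hi.2, sub_self]
      have h8 := coeff_eq_zero_of_degree_lt (hy a)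
      have h9 := coeff_eq_zero_of_degree_lt (hy' a)
      rw [coeff_sub] at h8 h9
      simp only [q, if_true, hne, if_false, coeff_C_mul, coeff_X_pow, map_zero, zero_mul,
        coeff_zero, mul_one] at h8 h9
      have h10 := congrArg (fun f => f.coeff t') h0
      simp only [coeff_sub, coeff_zero] at h10
      apply one_ne_zero (α := F)
      linear_combination - h8 + h9 + h10

end top

section code

open Polynomial

variable {F I S : Type} [Field F] [DecidableEq F] [Fintype F] [Fintype I] [DecidableEq I]
  [Fintype S] [DecidableEq S]

/-- The `i`-th coordinate of the code of multiples of `rootPoly β σ`. -/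
noncomputable def rootCode (α : I → F) (β : S → F) (σ : S → ℕ) (t : ℕ) (i : I) :
    degreeLT F t →ₗ[F] F :=
  ((rootPoly β σ).eval (α i)) • (leval (α i)).comp (degreeLT F t).subtype

theorem rootCode_apply (α : I → F) (β : S → F) (σ : S → ℕ) (t : ℕ) (i : I) (g : degreeLT F t) :
    rootCode α β σ t i g = (rootPoly β σ * (g : F[X])).eval (α i) := by
  simp [rootCode, leval_apply]

theorem isCode_rootCode {α : I → F} (hα : Function.Injective α) {β : S → F}
    (hαβ : ∀ i s, α i ≠ β s) (σ : S → ℕ) (t : ℕ) : IsCode t (rootCode α β σ t) := by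
  intro T hT x
  have h0 := eval_rootPoly_ne_zero hαβ σ
  obtain ⟨g, hg, -, hgT⟩ := exists_interpolation hα hαβ 0 (t := t) (τ := 0) (A := T)
    (by simp [hT]) fun i => x i / (rootPoly β σ).eval (α i)
  rw [sub_zero] at hg
  refine ⟨⟨g, mem_degreeLT.2 hg⟩, fun i hi => ?_, fun g' hg' => ?_⟩
  · simp only [rootCode_apply, eval_mul, hgT i hi]
    field_simp [h0 i]
  · refine Subtype.ext (sub_eq_zero.1 ?_)
    refine eq_zero_of_rootPoly_dvd hα hαβ (t := t) (τ := 0) (A := T) (by simp [hT])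
      (mem_degreeLT.1 (sub_mem g'.2 (mem_degreeLT.2 hg))) (by simp [rootPoly]) fun i hi => ?_
    have := hg' i hi
    rw [rootCode_apply, eval_mul] at this
    rw [eval_sub, hgT i hi, ← this]
    field_simp [h0 i]
    ring

/-- The array `y` does not agree in more than `t` columns with multiples of some `rootPoly β τ'` in
such a way that all of its capped symbols could agree as well. -/
def Rigid {Φ : Type} (α : I → F) (β : S → F) (σ : S → ℕ) (t : ℕ) (y : I → Φ → F) : Prop :=
  ∀ (g : Φ → F[X]) (τ τ' : S → ℕ) (A : Finset I), (∀ φ, (g φ).degree < (t + ∑ s, σ s : ℕ)) →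
    (∀ φ, rootPoly β τ' ∣ g φ) → ∑ s, σ s ≤ ∑ s, τ' s → τ ≤ σ → τ ≤ τ' →
    #A + ∑ s, τ s = t + ∑ s, σ s → t < #A → ¬ ∀ i ∈ A, ∀ φ, y i φ = (g φ).eval (α i)

theorem degree_rootPoly_mul_lt {β : S → F} (σ : S → ℕ) {t : ℕ} {g : F[X]} (hg : g.degree < t) :
    (rootPoly β σ * g).degree < (t + ∑ s, σ s : ℕ) := by
  by_cases h0 : g = 0
  · rw [h0, mul_zero, degree_zero]
    exact WithBot.bot_lt_coe _
  · rw [degree_eq_natDegree h0] at hg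
    have hg' : g.natDegree < t := by exact_mod_cast hg
    rw [degree_mul, degree_rootPoly, degree_eq_natDegree h0]
    exact_mod_cast (by omega : ∑ s, σ s + g.natDegree < t + ∑ s, σ s)

theorem eval_eq_zero_of_rootPoly_dvd_mul {β : S → F} (hβ : Function.Injective β) {σ τ : S → ℕ}
    {s : S} (hs : σ s < τ s) {q : F[X]} (h : rootPoly β τ ∣ rootPoly β σ * q) :
    q.eval (β s) = 0 := by
  have h1 := (rootPoly_dvd_iff hβ).1 h s
  have h2 : rootPoly β σ = (X - C (β s)) ^ σ s * ∏ s' ∈ univ.erase s, (X - C (β s')) ^ σ s' :=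
    (mul_prod_erase univ (fun s' => (X - C (β s')) ^ σ s') (mem_univ s)).symm
  have h3 := (pow_dvd_pow _ (Nat.succ_le_of_lt hs)).trans h1
  rw [h2, mul_assoc, pow_succ] at h3
  have h4 := (mul_dvd_mul_iff_left (pow_ne_zero _ (X_sub_C_ne_zero _))).1 h3
  have h5 := dvd_iff_isRoot.1 h4
  rw [IsRoot, eval_mul, eval_prod] at h5
  refine (mul_eq_zero.1 h5).resolve_left (prod_ne_zero_iff.2 fun s' hs' => ?_)
  simp only [eval_pow, eval_sub, eval_X, eval_C]
  exact pow_ne_zero _ (sub_ne_zero.2 fun hc => (mem_erase.1 hs').1 (hβ hc).symm)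

theorem Good.rigid {Φ : Type} [Fintype Φ] {α : I → F} (hα : Function.Injective α) {β : S → F}
    (hβ : Function.Injective β) (hαβ : ∀ i s, α i ≠ β s) {σ : S → ℕ} {t : ℕ} {y : I → Φ → F}
    (hy : Good t (rootCode α β σ t) (fun s => (leval (β s)).comp (degreeLT F t).subtype) y) :
    Rigid α β σ t y := by
  obtain ⟨x, h, hxy, ⟨Z, hZ, hx⟩, hh⟩ := hy
  intro g τ τ' A hg hgτ hτ' hτσ hττ' hA htA hgA
  have key : ∀ (u : Φ → F[X]) (ρ : S → ℕ), (∀ φ, (u φ).degree < (t + ∑ s, σ s : ℕ)) →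
      (∀ φ, rootPoly β ρ ∣ u φ) → ∑ s, σ s ≤ ∑ s, ρ s →
      (∀ i ∈ A, ∀ φ, x i φ = (u φ).eval (α i)) → False := by
    intro u ρ hu huρ hρ hux
    obtain ⟨i, hi, hiZ⟩ : ∃ i ∈ A, i ∉ Z := by
      by_contra! hc
      have := card_le_card hc
      omega
    obtain ⟨φ, h1, h2⟩ := hx i hiZ
    have h3 : u φ = 0 := by
      refine eq_zero_of_rootPoly_dvd hα hαβ (τ := ρ) (A := A.erase i) ?_ (hu φ) (huρ φ)
        fun k hk => ?_
      · rw [card_erase_of_mem hi]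
        omega
      · rw [← hux k (mem_of_mem_erase hk), h2 k (ne_of_mem_erase hk)]
    have h4 := hux i hi φ
    rw [h1, h3, eval_zero] at h4
    exact one_ne_zero h4
  by_cases hσ : ∃ s, σ s < τ' s
  · rcases hh with rfl | hh
    · exact key g τ' hg hgτ hτ' fun i hi φ => by simpa [hxy] using hgA i hi φ
    · obtain ⟨s, hs⟩ := hσ
      obtain ⟨ℓ, q, hq, hℓ⟩ := hh s
      have h1 : ∑ φ, C (ℓ φ) * g φ - rootPoly β σ * q = 0 := by
        refine eq_zero_of_rootPoly_dvd hα hαβ (τ := τ) (A := A)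
          (by omega : t + ∑ s, σ s ≤ ∑ s, τ s + #A) ?_ ?_ fun i hi => ?_
        · refine (degree_sub_le _ _).trans_lt (max_lt ?_
            (degree_rootPoly_mul_lt σ (mem_degreeLT.1 q.2)))
          refine mem_degreeLT.1 (Submodule.sum_mem _ fun φ _ => ?_)
          rw [← smul_eq_C_mul]
          exact Submodule.smul_mem _ _ (mem_degreeLT.2 (hg φ))
        · refine dvd_sub (dvd_sum fun φ _ => ?_) ?_
          · exact ((rootPoly_dvd_of_le β hττ').trans (hgτ φ)).mul_left _
          · exact (rootPoly_dvd_of_le β hτσ).mul_right _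
        · rw [eval_sub, ← rootCode_apply, ← hℓ i, eval_finsetSum, sub_eq_zero]
          refine sum_congr rfl fun φ _ => ?_
          rw [eval_mul, eval_C, hgA i hi]
      refine hq (eval_eq_zero_of_rootPoly_dvd_mul hβ hs ?_)
      rw [Submodule.subtype_apply, ← sub_eq_zero.1 h1]
      exact dvd_sum fun φ _ => (hgτ φ).mul_left _
  · push Not at hσ
    have hστ : τ' = σ := funext fun s =>
      (sum_eq_sum_iff_of_le fun s _ => hσ s).1 (le_antisymm (sum_le_sum fun s _ => hσ s) hτ') s
        (mem_univ s)
    subst hστ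
    refine key (fun φ => g φ - rootPoly β τ' * h φ) τ' (fun φ => ?_)
      (fun φ => dvd_sub (hgτ φ) (dvd_mul_right _ _)) le_rfl fun i hi φ => ?_
    · exact (degree_sub_le _ _).trans_lt (max_lt (hg φ)
        (degree_rootPoly_mul_lt τ' (mem_degreeLT.1 (h φ).2)))
    · rw [eval_sub, ← rootCode_apply, ← hgA i hi, hxy]
      ring

theorem exists_rigid_absorber {α : I → F} (hα : Function.Injective α) {β : S → F}
    (hβ : Function.Injective β) (hαβ : ∀ i s, α i ≠ β s) (σ : S → ℕ) {t : ℕ}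
    (hI : t ≤ Fintype.card I) {M : Type} [Fintype M] (o : M) (f : Finset I → (I → M) → ℤ)
    (hf : Compat univ t f) (hf0 : ∀ T x, 0 ≤ f T x) :
    ∃ (Φ : Type) (_ : Fintype Φ) (P : Type) (_ : Fintype P) (N : Type) (_ : Fintype N)
      (pos : P → I → (Φ → F) × M) (host : N → Φ → F[X]) (ρ : N → I → M),
      Function.Injective host ∧ (∀ n φ, (host n φ).degree < t) ∧
      (∀ n s, ∃ φ, (host n φ).eval (β s) ≠ 0) ∧
      (∀ p, Rigid α β σ t fun i => (pos p i).1) ∧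
      ∀ T, #T = t → ∀ y : I → (Φ → F) × M, cnt pos T y =
        ind (∀ i ∈ T, (y i).1 = 0) * f T (fun i => (y i).2) +
        cnt (fun n i => ((fun φ => (rootPoly β σ * host n φ).eval (α i), ρ n i) :
          (Φ → F) × M)) T y := by
  classical
  have : Finite (degreeLT F t) := Finite.of_equiv _ (degreeLTEquiv F t).symm.toEquiv
  have : Fintype (degreeLT F t) := Fintype.ofFinite _
  have hd : ∀ (g : degreeLT F t) (T : Finset I), (∀ i ∈ T,
      (rootPoly β σ * X ^ t).eval (α i) + rootCode α β σ t i g = 0) → #T ≤ t := by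
    intro g T hg
    by_contra! hc
    have hdeg : (X ^ t + (g : F[X])).degree = (t : WithBot ℕ) := by
      rw [degree_add_eq_left_of_degree_lt, degree_X_pow]
      rw [degree_X_pow]
      exact mem_degreeLT.1 g.2
    have h0 : X ^ t + (g : F[X]) = 0 := by
      refine eq_zero_of_rootPoly_dvd hα hαβ (t := t + 1) (τ := 0) (A := T) (by simp; omega) ?_
        (by simp [rootPoly]) fun i hi => ?_
      · rw [hdeg]
        exact_mod_cast Nat.lt_succ_self t
      · have := hg i hi
        rw [rootCode_apply, ← eval_add, ← mul_add, eval_mul] at this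
        exact (mul_eq_zero.1 this).resolve_left (eval_rootPoly_ne_zero hαβ σ i)
    rw [h0, degree_zero] at hdeg
    exact WithBot.bot_ne_coe hdeg
  have hstar : ∀ Z : Finset I, #Z < t → ∀ s, ∃ g : degreeLT F t,
      (∀ i ∈ Z, rootCode α β σ t i g = 0) ∧ (leval (β s)).comp (degreeLT F t).subtype g ≠ 0 := by
    intro Z hZ s
    refine ⟨⟨∏ i ∈ Z, (X - C (α i)), mem_degreeLT.2 ?_⟩, fun i hi => ?_, ?_⟩
    · rw [degree_prod]
      simp only [degree_X_sub_C, sum_const, nsmul_eq_mul, mul_one]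
      exact_mod_cast hZ
    · rw [rootCode_apply, eval_mul, eval_prod]
      rw [prod_eq_zero hi (by simp), mul_zero]
    · simp only [LinearMap.comp_apply, Submodule.subtype_apply, leval_apply, eval_prod]
      refine prod_ne_zero_iff.2 fun i _ => ?_
      simpa [sub_eq_zero] using (hαβ i s).symm
  obtain ⟨Φ, iΦ, P, iP, N, iN, pos, host, ρ, h1, h2, h3, h4⟩ :=
    exists_absorber (isCode_rootCode hα hαβ σ t) hI
      (fun i => (rootPoly β σ * X ^ t).eval (α i)) hd
      (fun s => (leval (β s)).comp (degreeLT F t).subtype) hstar o f hf hf0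
  refine ⟨Φ, iΦ, P, iP, N, iN, pos, fun n φ => host n φ, ρ, fun n n' h => h1 ?_,
    fun n φ => mem_degreeLT.1 (host n φ).2, h2, fun p => (h3 p).rigid hα hβ hαβ, ?_⟩
  · exact funext fun φ => Subtype.ext (congrFun h φ)
  · intro T hT y
    rw [h4 T hT y]
    simp only [rootCode_apply]

end code

section fill

variable {K S V : Type} [Fintype K] [DecidableEq K] [Fintype S] [DecidableEq S] [DecidableEq V]

/-- The columns of the capped symbols of a pattern together with further columns. -/
def withPat (a : K → Option S) (T : Finset {i // a i = none}) : Finset K :=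
  univ.filter (fun i => (a i).isSome) ∪ T.map (Function.Embedding.subtype _)

/-- The row with the capped symbols of a pattern and prescribed entries elsewhere. -/
def fill (a : K → Option S) (x : {i // a i = none} → V ⊕ S) (i : K) : V ⊕ S :=
  match h : a i with
  | none => x ⟨i, h⟩
  | some s => Sum.inr s

theorem fill_some {a : K → Option S} {x : {i // a i = none} → V ⊕ S} {i : K} {s : S}
    (h : a i = some s) : fill a x i = Sum.inr s := by
  unfold fill
  split <;> simp_all

theorem fill_coe {a : K → Option S} {x : {i // a i = none} → V ⊕ S} (i : {i // a i = none}) :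
    fill a x i = x i := by
  have := i.2
  unfold fill
  split <;> simp_all

theorem mem_withPat {a : K → Option S} {T : Finset {i // a i = none}} {i : K} :
    i ∈ withPat a T ↔ (∃ s, a i = some s) ∨ ∃ h, ⟨i, h⟩ ∈ T := by
  simp [withPat, Option.isSome_iff_exists]

theorem card_withPat (a : K → Option S) (T : Finset {i // a i = none}) :
    #(withPat a T) = ∑ s, patCount a s + #T := by
  rw [withPat, card_union_of_disjoint, card_map, sum_patCount]
  rw [disjoint_left]
  intro i hi hi'
  rw [mem_filter_univ] at hi
  obtain ⟨k, -, rfl⟩ := mem_map.1 hi'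
  simp [k.2] at hi

theorem forall_mem_withPat {a : K → Option S} {T : Finset {i // a i = none}} {p : K → Prop} :
    (∀ i ∈ withPat a T, p i) ↔ (∀ i s, a i = some s → p i) ∧ ∀ i ∈ T, p i := by
  refine ⟨fun h => ⟨fun i s hi => h i (mem_withPat.2 (Or.inl ⟨s, hi⟩)), fun i hi =>
    h i (mem_withPat.2 (Or.inr ⟨i.2, hi⟩))⟩, fun h i hi => ?_⟩
  rcases mem_withPat.1 hi with ⟨s, hs⟩ | ⟨h1, h2⟩
  · exact h.1 i s hs
  · exact h.2 _ h2

theorem agree_fill_iff {a : K → Option S} {T : Finset {i // a i = none}} {w : K → V ⊕ S}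
    {x : {i // a i = none} → V ⊕ S} : (∀ i ∈ withPat a T, w i = fill a x i) ↔
      (∀ i s, a i = some s → w i = Sum.inr s) ∧ ∀ i ∈ T, w (i : K) = x i := by
  rw [forall_mem_withPat]
  refine and_congr (forall₃_congr fun i s hi => by rw [fill_some hi])
    (forall₂_congr fun i _ => by rw [fill_coe])

theorem getRight?_fill {a : K → Option S} (x : {i // a i = none} → V) (i : K) :
    (fill a (fun i => Sum.inl (x i)) i).getRight? = a i := by
  rcases h : a i with _ | s
  · rw [fill_coe ⟨i, h⟩, Sum.getRight?_inl]
  · rw [fill_some h, Sum.getRight?_inr]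

theorem nInf_univ_fill (a : K → Option S) (x : {i // a i = none} → V) :
    nInf univ (fill a fun i => Sum.inl (x i)) = patCount a :=
  nInf_eq_patCount (getRight?_fill x)

theorem nInf_fill (a : K → Option S) (T : Finset {i // a i = none})
    (x : {i // a i = none} → V ⊕ S) :
    nInf (withPat a T) (fill a x) = patCount a + fun s => #{i ∈ T | x i = Sum.inr s} := by
  ext s
  rw [nInf, withPat, filter_union, card_union_of_disjoint, filter_map, card_map, Pi.add_apply,
    patCount, filter_filter]
  · congr 2
    · ext i
      rw [mem_filter_univ, mem_filter_univ]
      refine ⟨fun h => ?_, fun h => ⟨by simp [h], fill_some h⟩⟩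
      obtain ⟨s', hs'⟩ := Option.isSome_iff_exists.1 h.1
      rw [fill_some hs'] at h
      rw [hs', Sum.inr.inj h.2]
    · ext i
      simp only [mem_filter, Function.comp_apply, Function.Embedding.subtype_apply, fill_coe]
  · rw [disjoint_left]
    intro i hi hi'
    replace hi := (mem_filter.1 hi).1
    replace hi' := (mem_filter.1 hi').1
    rw [mem_filter_univ] at hi
    obtain ⟨k, -, rfl⟩ := mem_map.1 hi'
    simp [k.2] at hi

theorem exists_isP_fill_mem {t : ℕ} (a : K → Option S) (hat : ∑ s, patCount a s ≤ t)
    (ht : t ≤ Fintype.card K) (x : {i // a i = none} → V) {W : Set (K → V ⊕ S)}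
    (hW : IsP t (patCount a) 0 W) :
    ∃ W' : Set (K → V ⊕ S), IsP t (patCount a) 0 W' ∧ fill a (fun i => Sum.inl (x i)) ∈ W' := by
  obtain ⟨T, hT⟩ : ∃ T : Finset {i // a i = none}, #T = t - ∑ s, patCount a s := by
    have h := sum_patCount_add a
    rw [← Fintype.card_subtype] at h
    obtain ⟨T, -, hT⟩ := exists_subset_card_eq (s := (univ : Finset {i // a i = none}))
      (n := t - ∑ s, patCount a s) (by rw [card_univ]; omega)
    exact ⟨T, hT⟩
  have hTc : #(withPat a T) = t := by rw [card_withPat]; omega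
  have hTn : nInf (withPat a T) (fill a fun i => Sum.inl (x i)) = patCount a := by
    rw [nInf_fill]
    ext s
    simp
  obtain ⟨w, hw, hwT⟩ := hW.cover _ hTc (fill a fun i => Sum.inl (x i)) hTn.le (Nat.zero_le _)
  have hwa : ∀ i s, a i = some s → w i = Sum.inr s := fun i s hi => by
    rw [hwT i (mem_withPat.2 (Or.inl ⟨s, hi⟩)), fill_some hi]
  have hwl : ∀ i : {i // a i = none}, ∃ m, w i = Sum.inl m := by
    intro i
    rcases hm : w i with m | s
    · exact ⟨m, rfl⟩
    · exfalso
      have h1 := hW.cap w hw s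
      have h2 : insert (i : K) ({k | a k = some s} : Finset K) ⊆
          ({k | w k = Sum.inr s} : Finset K) := by
        intro k hk
        rcases mem_insert.1 hk with rfl | hk
        · simpa using hm
        · rw [mem_filter_univ] at hk ⊢
          exact hwa k s hk
      have h3 := card_le_card h2
      rw [card_insert_of_notMem (by simp [i.2])] at h3
      simp only [nInf, patCount] at h1 h3
      omega
  choose m hm using hwl
  let π : K → Equiv.Perm V := fun i =>
    if h : a i = none then Equiv.swap (m ⟨i, h⟩) (x ⟨i, h⟩) else 1
  let ψ : (K → V ⊕ S) → K → V ⊕ S := fun w i => (w i).map (π i) id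
  have hψψ : ∀ w, ψ (ψ w) = w := by
    intro w
    funext i
    simp only [ψ, π]
    split_ifs <;> rcases w i <;> simp
  have hψn : ∀ T w, nInf T (ψ w) = nInf T w := fun T w => nInf_congr fun i _ => by
    simp only [ψ]
    rcases w i <;> rfl
  refine ⟨ψ ⁻¹' W, ⟨fun w hw => ?_, fun _ _ => Nat.zero_le _, fun T hT x hx _ => ?_,
    fun w hw w' hw' T hT h => ?_⟩, ?_⟩
  · rw [← hψn]
    exact hW.cap _ hw
  · obtain ⟨w, hw, h⟩ := hW.cover T hT (ψ x) (by rwa [hψn]) (Nat.zero_le _)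
    refine ⟨ψ w, by rwa [Set.mem_preimage, hψψ], fun i hi => ?_⟩
    rw [← congrFun (hψψ x) i]
    simp only [ψ, h i hi]
  · rw [← hψψ w, ← hψψ w', hW.simple _ hw _ hw' T hT fun i hi => by simp only [ψ, h i hi]]
  · rw [Set.mem_preimage]
    convert hw using 1
    funext i
    rcases hi : a i with _ | s
    · simp only [ψ, π, dif_pos hi, fill_coe ⟨i, hi⟩]
      rw [hm ⟨i, hi⟩]
      simp
    · simp only [ψ, fill_some hi, hwa i s hi]
      rfl

end fill

section residual

variable {K S M : Type} [Fintype K] [DecidableEq K] [Fintype S] [DecidableEq S] [DecidableEq M]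
  [Fintype M]

theorem ind_exists {α : Type*} [Fintype α] {p : α → Prop} (h : ∀ a b, p a → p b → a = b) :
    ∑ a, ind (p a) = ind (∃ a, p a) := by
  by_cases hp : ∃ a, p a
  · obtain ⟨a, ha⟩ := hp
    rw [ind_of ⟨a, ha⟩, sum_ind_eq a fun b => ⟨fun hb => h b a hb ha, fun hb => hb ▸ ha⟩]
  · rw [ind_of_not hp, sum_ind_of_forall_not (not_exists.1 hp)]

theorem ind_add_not (p : Prop) : ind p + ind (¬ p) = 1 := by
  by_cases h : p <;> simp [ind, h]

theorem exists_residual {t : ℕ} {R : S → ℕ} {W : Set (K → M ⊕ S)} (a : K → Option S)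
    (haR : patCount a ≤ R) {t' : ℕ} (ht : ∑ s, patCount a s + t' = t)
    (hW : IsP t R (∑ s, patCount a s + 1) W) :
    ∃ f : Finset {i // a i = none} → ({i // a i = none} → M) → ℤ,
      Compat univ t' f ∧ (∀ T x, 0 ≤ f T x) ∧ ∀ T, #T = t' → ∀ x,
        f T x = ind (¬ ∃ w ∈ W, ∀ i ∈ withPat a T, w i = fill a (fun i => Sum.inl (x i)) i) := by
  classical
  refine ⟨fun T x => ind (¬ ∃ w ∈ W, ∀ i ∈ withPat a T, w i = fill a (fun i => Sum.inl (x i)) i),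
    ⟨fun T x x' h => ?_, ?_⟩, fun T x => ind_nonneg _, fun T _ x => rfl⟩
  · simp only [agree_fill_iff]
    refine ind_congr (not_congr (exists_congr fun w => and_congr Iff.rfl (and_congr Iff.rfl
      (forall₂_congr fun i hi => by rw [h i hi]))))
  · intro U _ hU
    suffices h : ∃ c : (({i // a i = none} → M) → ℤ), ∀ k ∉ U, ∀ x,
        ∑ y, ind (∃ w ∈ W, ∀ i ∈ withPat a (insert k U),
          w i = fill a (fun i => Sum.inl (Function.update x k y i)) i) = c x by
      obtain ⟨c, hc⟩ := h
      have h1 : ∀ k ∉ U, ∀ x, ∑ y : M, ind (¬ ∃ w ∈ W, ∀ i ∈ withPat a (insert k U),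
          w i = fill a (fun i => Sum.inl (Function.update x k y i)) i) =
          Fintype.card M - c x := by
        intro k hk x
        rw [← hc k hk x, eq_sub_iff_add_eq', ← sum_add_distrib]
        simp only [ind_add_not, sum_const, card_univ, nsmul_eq_mul, mul_one]
      intro k _ hk l _ hl x
      rw [h1 k hk, h1 l hl]
    refine ⟨fun x => ∑ w : K → M ⊕ S, ind (w ∈ W ∧
      ∀ i ∈ withPat a U, w i = fill a (fun i => Sum.inl (x i)) i) -
      ∑ s, ind (patCount a s < R s), fun k hk x => ?_⟩
    have hcard : #(withPat a (insert k U)) = t := by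
      rw [card_withPat, card_insert_of_notMem hk]
      omega
    have hsplit : ∀ (w : K → M ⊕ S) (z : M ⊕ S),
        (∀ i ∈ withPat a (insert k U),
          w i = fill a (Function.update (fun i => Sum.inl (x i)) k z) i) ↔
        (∀ i ∈ withPat a U, w i = fill a (fun i => Sum.inl (x i)) i) ∧ w k = z := by
      intro w z
      rw [agree_fill_iff, agree_fill_iff, forall_mem_insert, Function.update_self, and_assoc]
      refine and_congr Iff.rfl ((and_comm).trans (and_congr (forall₂_congr fun i hi => ?_) Iff.rfl))
      rw [Function.update_of_ne (by rintro rfl; exact hk hi)]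
    have huniq : ∀ z, ∑ w : K → M ⊕ S, ind (w ∈ W ∧ (∀ i ∈ withPat a U,
        w i = fill a (fun i => Sum.inl (x i)) i) ∧ w k = z) =
        ind (∃ w ∈ W, ∀ i ∈ withPat a (insert k U),
          w i = fill a (Function.update (fun i => Sum.inl (x i)) k z) i) := by
      intro z
      simp only [← hsplit]
      refine ind_exists fun w w' h h' => hW.simple w h.1 w' h'.1 _ hcard fun i hi => ?_
      rw [h.2 i hi, h'.2 i hi]
    have htot : ∑ z : M ⊕ S, ind (∃ w ∈ W, ∀ i ∈ withPat a (insert k U),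
        w i = fill a (Function.update (fun i => Sum.inl (x i)) k z) i) =
        ∑ w : K → M ⊕ S, ind (w ∈ W ∧
          ∀ i ∈ withPat a U, w i = fill a (fun i => Sum.inl (x i)) i) := by
      simp only [← huniq]
      rw [sum_comm]
      refine sum_congr rfl fun w _ => ?_
      simp only [← and_assoc, ← ind_mul _ (w k = _), ← mul_sum]
      rw [sum_ind_eq (w k) fun b => eq_comm, mul_one]
    beta_reduce
    rw [← htot, Fintype.sum_sum_type, eq_sub_iff_add_eq]
    congr 1
    · refine sum_congr rfl fun y _ => ind_congr ?_
      have : (fun i => Sum.inl (Function.update x k y i) : {i // a i = none} → M ⊕ S) =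
          Function.update (fun i => Sum.inl (x i)) k (Sum.inl y) := by
        funext i
        by_cases h : i = k
        · subst h; simp
        · simp [h]
      rw [this]
    · refine sum_congr rfl fun s _ => ind_congr ?_
      have hn : nInf (withPat a (insert k U))
          (fill a (Function.update (fun i => Sum.inl (x i) : {i // a i = none} → M ⊕ S) k
            (Sum.inr s))) = patCount a + Pi.single s 1 := by
        rw [nInf_fill]
        congr 1
        ext s'
        by_cases hs : s' = s
        · subst hs
          rw [Pi.single_eq_same, card_eq_one]
          refine ⟨k, ?_⟩
          ext i
          by_cases h : i = k <;> simp [h]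
        · rw [Pi.single_eq_of_ne hs, card_eq_zero]
          ext i
          by_cases h : i = k <;> simp [h, Ne.symm hs]
      refine ⟨fun h => ?_, ?_⟩
      · refine hW.cover _ hcard _ ?_ ?_
        · rw [hn]
          intro s'
          by_cases hs : s' = s
          · subst hs
            simpa using h
          · simpa [hs] using haR s'
        · rw [hn]
          simp [sum_add_distrib]
      · rintro ⟨w, hw, hwx⟩
        have h1 := hW.cap w hw s
        have h2 := nInf_mono (subset_univ (withPat a (insert k U))) w s
        rw [nInf_congr fun i hi => congrArg Sum.getRight? (hwx i hi), hn, Pi.add_apply,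
          Pi.single_eq_same] at h2
        exact Nat.lt_of_succ_le (h2.trans h1)

end residual

section absorber

open Polynomial

variable {F K S M : Type} [Field F] [DecidableEq F] [Fintype K] [DecidableEq K]
  [Fintype S] [DecidableEq S] [DecidableEq M]

/-- Rows `pos` with the pattern `a` covering, once the rows given by `host` are removed, exactly
what the rows `W` leave uncovered. -/
structure Absorber (α : K → F) (β : S → F) (t : ℕ) (W : Set (K → M ⊕ S)) (a : K → Option S) where
  Φ : Type
  [fintypeΦ : Fintype Φ]
  P : Type
  N : Type
  pos : P → {i // a i = none} → (Φ → F) × M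
  host : N → Φ → F[X]
  ρ : N → {i // a i = none} → M
  host_injective : Function.Injective host
  degree_host : ∀ n φ, (host n φ).degree < t
  exists_host_ne : ∀ n s, ∃ φ, (host n φ).eval (β s) ≠ 0
  rigid : ∀ y, Rigid (fun i : {i // a i = none} => α i) β (patCount a) t fun i => (pos y i).1
  pos_unique : ∀ y y' T, #T = t → (∀ i ∈ T, pos y i = pos y' i) → y = y'
  pos_cases : ∀ y T, #T = t → ((∀ i ∈ T, (pos y i).1 = 0) ∧
    ¬ ∃ w ∈ W, ∀ i ∈ withPat a T, w i = fill a (fun i => Sum.inl (pos y i).2) i) ∨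
    ∃ n, ∀ i ∈ T, pos y i = (fun φ => (rootPoly β (patCount a) * host n φ).eval (α i), ρ n i)
  exists_pos : ∀ T, #T = t → ∀ x : {i // a i = none} → M,
    (¬ ∃ w ∈ W, ∀ i ∈ withPat a T, w i = fill a (fun i => Sum.inl (x i)) i) →
    ∃ y, ∀ i ∈ T, pos y i = (0, x i)
  exists_pos_host : ∀ n T, #T = t → ∃ y, ∀ i ∈ T,
    pos y i = (fun φ => (rootPoly β (patCount a) * host n φ).eval (α i), ρ n i)

attribute [instance] Absorber.fintypeΦ

theorem nonempty_absorber [Fintype F] [Fintype M] (o : M) [Nonempty S] {α : K → F}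
    (hα : Function.Injective α)
    {β : S → F} (hβ : Function.Injective β) (hαβ : ∀ i s, α i ≠ β s) {R : S → ℕ} {t j : ℕ}
    {W : Set (K → M ⊕ S)} (hW : IsP (t + j) R (j + 1) W) (hK : t + j ≤ Fintype.card K)
    (a : K → Option S) (haR : patCount a ≤ R) (haj : ∑ s, patCount a s = j) :
    Nonempty (Absorber α β t W a) := by
  subst haj
  obtain ⟨f, hf, hf0, hfx⟩ := exists_residual a haR (add_comm _ _) hW
  have hαI : Function.Injective fun i : {i // a i = none} => α i :=
    hα.comp Subtype.val_injective
  obtain ⟨Φ, _, P, _, N, _, pos, host, ρ, h1, h2, h3, h4, h5⟩ := exists_rigid_absorber hαI hβ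
    (fun i s => hαβ i s) (patCount a) (t := t) (by
      have := sum_patCount_add a
      rw [← Fintype.card_subtype] at this
      omega) o f hf hf0
  have hcases : ∀ T, #T = t → ∀ x : {i // a i = none} → (Φ → F) × M, cnt pos T x =
      ind ((∀ i ∈ T, (x i).1 = 0) ∧
        ¬ ∃ w ∈ W, ∀ i ∈ withPat a T, w i = fill a (fun i => Sum.inl (x i).2) i) +
      ∑ n, ind (∀ i ∈ T,
        ((fun φ => (rootPoly β (patCount a) * host n φ).eval (α i), ρ n i) :
          (Φ → F) × M) = x i) := by
    intro T hT x
    rw [h5 T hT, hfx T hT, ind_mul]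
    rfl
  have hhost : ∀ g g' : F[X], g.degree < t → g'.degree < t → ∀ T : Finset {i // a i = none},
      #T = t → (∀ i ∈ T, (rootPoly β (patCount a) * g).eval (α i) =
      (rootPoly β (patCount a) * g').eval (α i)) → g = g' := by
    intro g g' hg hg' T hT h
    refine sub_eq_zero.1 (eq_zero_of_rootPoly_dvd hαI (fun i s => hαβ i s)
      (τ := 0) (A := T) (t := t) (by simp [hT]) ?_ (by simp [rootPoly]) fun i hi => ?_)
    · exact (degree_sub_le _ _).trans_lt (max_lt hg hg')
    · have := h i hi
      rw [eval_mul, eval_mul] at this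
      rw [eval_sub, mul_left_cancel₀ (eval_rootPoly_ne_zero hαβ _ _) this, sub_self]
  have hle : ∀ T, #T = t → ∀ x, cnt pos T x ≤ 1 := by
    intro T hT x
    rw [hcases T hT]
    by_cases hx : ∀ i ∈ T, (x i).1 = 0
    · rw [sum_ind_of_forall_not fun n hn => ?_, add_zero]
      · exact ind_le_one _
      · obtain ⟨φ, hφ⟩ := h3 n (Classical.arbitrary S)
        have h0 := hhost (host n φ) 0 (h2 n φ) (by simp) T hT fun i hi => by
          have := hx i hi
          rw [← hn i hi] at this
          simpa using congrFun this φ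
        rw [h0] at hφ
        simp at hφ
    · rw [ind_of_not fun h => hx h.1, zero_add, sum_ind_le_one_iff]
      intro n n' hn hn'
      refine h1 (funext fun φ => hhost _ _ (h2 n φ) (h2 n' φ) T hT fun i hi => ?_)
      have := (hn i hi).trans (hn' i hi).symm
      exact congrFun (congrArg Prod.fst this) φ
  refine ⟨⟨Φ, P, N, pos, host, ρ, h1, h2, h3, h4, fun y y' T hT h => ?_, fun y T hT => ?_,
    fun T hT x hx => ?_, fun n T hT => ?_⟩⟩
  · exact sum_ind_le_one_iff.1 (hle T hT (pos y')) y y' h fun _ _ => rfl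
  · have hpos : 0 < cnt pos T (pos y) := by
      refine lt_of_lt_of_le zero_lt_one ?_
      rw [← ind_of (fun i (_ : i ∈ T) => rfl : ∀ i ∈ T, pos y i = pos y i)]
      exact single_le_sum (f := fun p => ind (∀ i ∈ T, pos p i = pos y i))
        (fun _ _ => ind_nonneg _) (mem_univ y)
    rw [hcases T hT] at hpos
    by_cases hx : (∀ i ∈ T, (pos y i).1 = 0) ∧
        ¬ ∃ w ∈ W, ∀ i ∈ withPat a T, w i = fill a (fun i => Sum.inl (pos y i).2) i
    · exact Or.inl hx
    · rw [ind_of_not hx, zero_add] at hpos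
      obtain ⟨n, hn⟩ := exists_of_sum_ind_pos hpos
      exact Or.inr ⟨n, fun i hi => (hn i hi).symm⟩
  · refine exists_of_sum_ind_pos (p := fun y => ∀ i ∈ T, pos y i = (0, x i)) ?_
    have := hcases T hT fun i => (0, x i)
    rw [ind_of ⟨fun _ _ => rfl, hx⟩] at this
    rw [cnt] at this
    rw [this]
    have : 0 ≤ ∑ n, ind (∀ i ∈ T, ((fun φ => (rootPoly β (patCount a) * host n φ).eval
        (α i), ρ n i) : (Φ → F) × M) = (0, x i)) := sum_nonneg fun _ _ => ind_nonneg _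
    omega
  · refine exists_of_sum_ind_pos (p := fun y => ∀ i ∈ T, pos y i = _) ?_
    have := hcases T hT fun i => (fun φ => (rootPoly β (patCount a) * host n φ).eval (α i), ρ n i)
    rw [cnt] at this
    rw [this]
    refine add_pos_of_nonneg_of_pos (ind_nonneg _) (lt_of_lt_of_le zero_lt_one ?_)
    refine le_trans ?_ (single_le_sum (fun _ _ => ind_nonneg _) (mem_univ n))
    rw [ind_of fun _ _ => rfl]

end absorber

section blocks

open Polynomial

variable {F K S M : Type} [Field F] [DecidableEq F] [Fintype F] [Fintype K] [DecidableEq K]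
  [Fintype S] [DecidableEq S] [DecidableEq M]

/-- The patterns with `j` capped symbols. -/
abbrev Pat (K : Type) [Fintype K] [DecidableEq K] (R : S → ℕ) (j : ℕ) : Type :=
  {a : K → Option S // patCount a ≤ R ∧ ∑ s, patCount a s = j}

/-- The polynomials of degree less than `t` divisible by `rootPoly β R`. -/
abbrev Special (β : S → F) (R : S → ℕ) (t : ℕ) : Type :=
  {f : F[X] // f.degree < t ∧ rootPoly β R ∣ f}

/-- Absorbers for all patterns, with disjoint sets of coordinates for their labels. -/
structure Blocks (α : K → F) (β : S → F) (t j : ℕ) (R : S → ℕ) (W : Set (K → M ⊕ S)) where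
  absorber : ∀ a : Pat K R j, Absorber α β t W a.1
  κ : Type
  [fintypeκ : Fintype κ]
  block : ∀ a, (κ → Special β R (t + j)) → (absorber a).Φ → κ
  injective : ∀ a p, Function.Injective (block a p)
  eq_of_meet : ∀ a a' p p' φ φ', block a p φ = block a' p' φ' → a = a'
  block_eq_of_meet : ∀ a p p' φ φ', block a p φ = block a p' φ' → block a p = block a p'
  eq_of_block_eq : ∀ a p p', block a p = block a p' →
    (∀ x, x ∉ Set.range (block a p) → p x = p' x) → p = p'

attribute [instance] Blocks.fintypeκ

theorem nonempty_blocks {α : K → F} {β : S → F} {t j : ℕ} {R : S → ℕ}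
    {W : Set (K → M ⊕ S)}
    (h : ∀ a : Pat K R j, Nonempty (Absorber α β t W a.1)) : Nonempty (Blocks α β t j R W) := by
  classical
  let D := fun a => (h a).some
  let V : Submodule F F[X] :=
    degreeLT F (t + j) ⊓ (Ideal.span {rootPoly β R}).restrictScalars F
  have hV : ∀ f, f ∈ V ↔ f.degree < (t + j : ℕ) ∧ rootPoly β R ∣ f := fun f => by
    rw [Submodule.mem_inf, mem_degreeLT, Submodule.restrictScalars_mem, Ideal.mem_span_singleton]
  have : Finite (degreeLT F (t + j)) :=
    Finite.of_equiv _ (degreeLTEquiv F (t + j)).symm.toEquiv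
  have : Finite (Special β R (t + j)) :=
    Finite.of_injective (β := degreeLT F (t + j)) (fun f => ⟨f.1, mem_degreeLT.2 f.2.1⟩)
      fun f f' h => Subtype.ext (congrArg (fun g => g.1) h)
  have : Fintype (Special β R (t + j)) := Fintype.ofFinite _
  let κ := Σ a : Pat K R j, ((D a).Φ → Special β R (t + j)) × (D a).Φ
  let χ : ∀ a : Pat K R j, (κ → Special β R (t + j)) → (D a).Φ → Special β R (t + j) :=
    fun a p φ => ⟨∑ c, (p ⟨a, c, φ⟩ : F[X]),
      (hV _).1 (Submodule.sum_mem _ fun c _ => (hV _).2 (p ⟨a, c, φ⟩).2)⟩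
  refine ⟨⟨D, κ, fun a p φ => ⟨a, χ a p, φ⟩, fun a p φ φ' h => ?_, fun a a' p p' φ φ' h => ?_,
    fun a p p' φ φ' h => ?_, fun a p p' h hp => funext fun x => ?_⟩⟩
  · exact (Prod.mk.inj (eq_of_heq (Sigma.mk.inj h).2)).2
  · exact congrArg Sigma.fst h
  · have : χ a p = χ a p' := by
      have := eq_of_heq (Sigma.mk.inj h).2
      exact (Prod.mk.inj this).1
    simp only [this]
  · by_cases hx : x ∈ Set.range fun φ => (⟨a, χ a p, φ⟩ : κ)
    · obtain ⟨φ, rfl⟩ := hx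
      have h1 : χ a p = χ a p' := by
        have := eq_of_heq (Sigma.mk.inj (congrFun h φ)).2
        exact (Prod.mk.inj this).1
      have h2 := congrArg Subtype.val (congrFun h1 φ)
      simp only [χ] at h2
      rw [← add_sum_erase _ _ (mem_univ (χ a p)), ← add_sum_erase _ _ (mem_univ (χ a p)),
        sum_congr rfl fun c hc => ?_] at h2
      · exact Subtype.ext (add_right_cancel h2)
      · rw [hp]
        rintro ⟨φ', h3⟩
        have h4 := eq_of_heq (Sigma.mk.inj h3).2
        exact (mem_erase.1 hc).1 (Prod.mk.inj h4).1.symm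
    · exact hp x hx

namespace Blocks

variable {α : K → F} {β : S → F} {t j : ℕ} {R : S → ℕ} {W : Set (K → M ⊕ S)}
  (B : Blocks α β t j R W)

/-- Add the labels `g` in a block to the special coordinates `p`. -/
noncomputable def add {A : Type} [AddZeroClass A] (a : Pat K R j)
    (p : B.κ → Special β R (t + j)) (v : B.κ → A) (g : (B.absorber a).Φ → A) (x : B.κ) : A :=
  v x + Function.extend (B.block a p) g 0 x

theorem add_block {A : Type} [AddZeroClass A] (a : Pat K R j) (p : B.κ → Special β R (t + j))
    (v : B.κ → A) (g : (B.absorber a).Φ → A) (φ : (B.absorber a).Φ) :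
    B.add a p v g (B.block a p φ) = v (B.block a p φ) + g φ := by
  rw [add, (B.injective a p).extend_apply]

theorem add_of_notMem {A : Type} [AddZeroClass A] (a : Pat K R j) (p : B.κ → Special β R (t + j))
    (v : B.κ → A) (g : (B.absorber a).Φ → A) {x : B.κ} (hx : x ∉ Set.range (B.block a p)) :
    B.add a p v g x = v x := by
  rw [add, Function.extend_apply' _ _ _ (by simpa using hx), Pi.zero_apply, add_zero]

theorem add_induction {A : Type} [AddZeroClass A] (a : Pat K R j) (p : B.κ → Special β R (t + j))
    (v : B.κ → A) (g : (B.absorber a).Φ → A) {q : A → B.κ → Prop}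
    (h : ∀ φ, q (v (B.block a p φ) + g φ) (B.block a p φ))
    (h' : ∀ x, x ∉ Set.range (B.block a p) → q (v x) x) (x : B.κ) : q (B.add a p v g x) x := by
  by_cases hx : x ∈ Set.range (B.block a p)
  · obtain ⟨φ, rfl⟩ := hx
    rw [B.add_block]
    exact h φ
  · rw [B.add_of_notMem a p v g hx]
    exact h' x hx

/-- The polynomials of the row of a glued family to be replaced by the absorber. -/
noncomputable def hostPoly (a : Pat K R j) (p : B.κ → Special β R (t + j))
    (n : (B.absorber a).N) : B.κ → F[X] :=
  B.add a p (fun x => (p x : F[X])) fun φ => rootPoly β (patCount a.1) * (B.absorber a).host n φ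

theorem degree_hostPoly (a : Pat K R j) (p : B.κ → Special β R (t + j)) (n : (B.absorber a).N)
    (x : B.κ) : (B.hostPoly a p n x).degree < (t + j : ℕ) := by
  refine B.add_induction a p _ _ (q := fun (f : F[X]) _ => f.degree < (t + j : ℕ)) (fun φ => ?_)
    (fun x _ => (p x).2.1) x
  refine (degree_add_le _ _).trans_lt (max_lt (p _).2.1 ?_)
  have := degree_rootPoly_mul_lt (β := β) (patCount a.1) ((B.absorber a).degree_host n φ)
  rwa [a.2.2] at this

theorem rootPoly_dvd_hostPoly (a : Pat K R j) (p : B.κ → Special β R (t + j))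
    (n : (B.absorber a).N) (x : B.κ) : rootPoly β (patCount a.1) ∣ B.hostPoly a p n x := by
  have h := fun x => (rootPoly_dvd_of_le β a.2.1).trans (p x).2.2
  exact B.add_induction a p _ _ (q := fun (f : F[X]) _ => rootPoly β (patCount a.1) ∣ f)
    (fun φ => dvd_add (h _) (dvd_mul_right _ _)) (fun x _ => h x) x

theorem exists_not_dvd (hβ : Function.Injective β) (a : Pat K R j)
    (p : B.κ → Special β R (t + j)) (n : (B.absorber a).N) {τ : S → ℕ} (hτ : τ ≤ R)
    {s : S} (hs : patCount a.1 s < τ s) :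
    ∃ φ, ¬ rootPoly β τ ∣ B.hostPoly a p n (B.block a p φ) := by
  obtain ⟨φ, hφ⟩ := (B.absorber a).exists_host_ne n s
  refine ⟨φ, fun h => hφ (eval_eq_zero_of_rootPoly_dvd_mul hβ hs ?_)⟩
  rw [hostPoly, B.add_block] at h
  exact (dvd_add_right ((rootPoly_dvd_of_le β hτ).trans (p _).2.2)).1 h

theorem capm_hostPoly (hβ : Function.Injective β) (a : Pat K R j)
    (p : B.κ → Special β R (t + j)) (n : (B.absorber a).N) :
    capm β R (B.hostPoly a p n) = patCount a.1 := by
  refine le_antisymm (fun s => ?_) (le_capm hβ a.2.1 (B.rootPoly_dvd_hostPoly a p n))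
  by_contra! hs
  obtain ⟨φ, hφ⟩ := B.exists_not_dvd hβ a p n (capm_le β R _) hs
  exact hφ (rootPoly_capm_dvd hβ R _ _)

theorem exists_not_special (hβ : Function.Injective β) (hj : j < ∑ s, R s) (a : Pat K R j)
    (p : B.κ → Special β R (t + j)) (n : (B.absorber a).N) :
    ∃ φ, ¬ rootPoly β R ∣ B.hostPoly a p n (B.block a p φ) := by
  rw [← a.2.2] at hj
  obtain ⟨s, -, hs⟩ := exists_lt_of_sum_lt hj
  exact B.exists_not_dvd hβ a p n le_rfl hs

theorem hostPoly_injective (hβ : Function.Injective β) (hj : j < ∑ s, R s) {a a' : Pat K R j}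
    {p p' : B.κ → Special β R (t + j)} {n : (B.absorber a).N} {n' : (B.absorber a').N}
    (h : B.hostPoly a p n = B.hostPoly a' p' n') : a = a' ∧ p = p' ∧ HEq n n' := by
  obtain ⟨φ, hφ⟩ := B.exists_not_special hβ hj a p n
  have hmem : B.block a p φ ∈ Set.range (B.block a' p') := by
    by_contra hc
    refine hφ ?_
    rw [h, hostPoly, B.add_of_notMem _ _ _ _ hc]
    exact (p' _).2.2
  obtain ⟨φ', hφ'⟩ := hmem
  obtain rfl := B.eq_of_meet _ _ _ _ _ _ hφ'
  have hb := B.block_eq_of_meet _ _ _ _ _ hφ'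
  obtain rfl : p = p' := by
    refine B.eq_of_block_eq _ _ _ hb.symm fun x hx => Subtype.ext ?_
    have := congrFun h x
    rwa [hostPoly, hostPoly, B.add_of_notMem _ _ _ _ hx, B.add_of_notMem _ _ _ _ (hb ▸ hx)] at this
  refine ⟨rfl, rfl, heq_of_eq ((B.absorber a').host_injective (funext fun φ => ?_))⟩
  have := congrFun h (B.block a' p φ)
  rw [hostPoly, hostPoly, B.add_block, B.add_block] at this
  exact mul_left_cancel₀ (rootPoly_monic β _).ne_zero (add_left_cancel this)

/-- The rows of the glued family that are kept. -/
structure IsKept (L : (B.κ → F[X]) → Set (K → M ⊕ S)) : Prop where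
  cap : ∀ f, ∀ w ∈ L f, nInf univ w ≤ capm β R f
  ge : ∀ f, ∀ w ∈ L f, j ≤ ∑ s, nInf univ w s
  simple : ∀ f, ∀ w ∈ L f, ∀ w' ∈ L f, ∀ T : Finset K, #T = t + j → (∀ i ∈ T, w i = w' i) → w = w'
  cover : ∀ f : B.κ → F[X], ∀ T : Finset K, #T = t + j → ∀ x : K → M ⊕ S, nInf T x ≤ capm β R f →
    j ≤ ∑ s, nInf T x s → (∃ w ∈ L f, ∀ i ∈ T, w i = x i) ∨ ∑ s, nInf T x s = j ∧
      (((∀ c, rootPoly β R ∣ f c) ∧ ¬ ∃ w ∈ W, ∀ i ∈ T, w i = x i) ∨ ∃ a p n,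
        f = B.hostPoly a p n ∧
          ∀ i ∈ T, fill a.1 (fun i => Sum.inl ((B.absorber a).ρ n i)) i = x i)
  mem_of_special : ∀ f : B.κ → F[X], (∀ c, rootPoly β R ∣ f c) → L f ⊆ W
  not_host : ∀ a p n, ∀ w ∈ L (B.hostPoly a p n), ∀ T : Finset K, #T = t + j →
    ¬ ∀ i ∈ T, w i = fill a.1 (fun i => Sum.inl ((B.absorber a).ρ n i)) i

theorem exists_isKept (hβ : Function.Injective β) (hj : j < ∑ s, R s)
    (hK : t + j ≤ Fintype.card K) (hW : IsP (t + j) R (j + 1) W)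
    (hD : ∀ R' ≤ R, R' ≠ R → ∃ W : Set (K → M ⊕ S), IsP (t + j) R' 0 W) :
    ∃ L, B.IsKept L := by
  have hcapm : ∀ f : B.κ → F[X], (∀ c, rootPoly β R ∣ f c) → capm β R f = R := fun f hf =>
    le_antisymm (capm_le _ _ _) (le_capm hβ le_rfl hf)
  have hG : ∀ f : B.κ → F[X], ∃ W' : Set (K → M ⊕ S), (¬ (∀ c, rootPoly β R ∣ f c) →
      IsP (t + j) (capm β R f) 0 W') ∧ ∀ a p n, f = B.hostPoly a p n →
      fill a.1 (fun i => Sum.inl ((B.absorber a).ρ n i)) ∈ W' := by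
    intro f
    by_cases hf : ∃ a p n, f = B.hostPoly a p n
    · obtain ⟨a, p, n, rfl⟩ := hf
      have hne : patCount a.1 ≠ R := by
        intro h
        rw [← h, a.2.2] at hj
        exact lt_irrefl _ hj
      obtain ⟨W₀, hW₀⟩ := hD _ a.2.1 hne
      obtain ⟨W', hW', hm⟩ := exists_isP_fill_mem a.1 (by rw [a.2.2]; omega) hK
        ((B.absorber a).ρ n) hW₀
      refine ⟨W', fun _ => by rwa [B.capm_hostPoly hβ], fun a' p' n' h => ?_⟩
      obtain ⟨rfl, rfl, h3⟩ := B.hostPoly_injective hβ hj h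
      obtain rfl := eq_of_heq h3
      exact hm
    · by_cases hs : ∀ c, rootPoly β R ∣ f c
      · exact ⟨∅, fun h => absurd hs h, fun a p n h => absurd ⟨a, p, n, h⟩ hf⟩
      · obtain ⟨W', hW'⟩ := hD (capm β R f) (capm_le _ _ _) fun h => hs fun c => by
          rw [← h]
          exact rootPoly_capm_dvd hβ R f c
        exact ⟨W', fun _ => hW', fun a p n h => absurd ⟨a, p, n, h⟩ hf⟩
  choose G hG1 hG2 using hG
  refine ⟨fun f => {w | ((∀ c, rootPoly β R ∣ f c) ∧ w ∈ W) ∨ (¬ (∀ c, rootPoly β R ∣ f c) ∧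
    w ∈ G f ∧ j ≤ ∑ s, nInf univ w s ∧ ∀ a p n, f = B.hostPoly a p n →
      w ≠ fill a.1 fun i => Sum.inl ((B.absorber a).ρ n i))}, ?_, ?_, ?_, ?_, ?_, ?_⟩
  · rintro f w (⟨hf, hw⟩ | ⟨hf, hw, -⟩)
    · rw [hcapm f hf]
      exact hW.cap w hw
    · exact (hG1 f hf).cap w hw
  · rintro f w (⟨hf, hw⟩ | ⟨hf, hw, hj, -⟩)
    · exact (Nat.le_succ j).trans (hW.ge w hw)
    · exact hj
  · rintro f w (⟨hf, hw⟩ | ⟨hf, hw, -⟩) w' (⟨hf', hw'⟩ | ⟨hf', hw', -⟩)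
    · exact hW.simple w hw w' hw'
    · exact absurd hf hf'
    · exact absurd hf' hf
    · exact (hG1 f hf).simple w hw w' hw'
  · intro f T hT x hx hjx
    by_cases hf : ∀ c, rootPoly β R ∣ f c
    · by_cases hw : ∃ w ∈ W, ∀ i ∈ T, w i = x i
      · obtain ⟨w, hw, h⟩ := hw
        exact Or.inl ⟨w, Or.inl ⟨hf, hw⟩, h⟩
      · refine Or.inr ⟨?_, Or.inl ⟨hf, hw⟩⟩
        by_contra hc
        rw [hcapm f hf] at hx
        exact hw (hW.cover T hT x hx (by omega))
    · obtain ⟨w, hw, h⟩ := (hG1 f hf).cover T hT x hx (Nat.zero_le _)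
      have hle : ∑ s, nInf T x s ≤ ∑ s, nInf univ w s := by
        rw [← nInf_congr fun i hi => congrArg Sum.getRight? (h i hi)]
        exact sum_le_sum fun s _ => nInf_mono (subset_univ T) w s
      by_cases hn : ∀ a p n, f = B.hostPoly a p n →
          w ≠ fill a.1 fun i => Sum.inl ((B.absorber a).ρ n i)
      · exact Or.inl ⟨w, Or.inr ⟨hf, hw, hjx.trans hle, hn⟩, h⟩
      · push Not at hn
        obtain ⟨a, p, n, hfn, rfl⟩ := hn
        rw [nInf_univ_fill, a.2.2] at hle
        exact Or.inr ⟨le_antisymm hle hjx, Or.inr ⟨a, p, n, hfn, h⟩⟩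
  · rintro f hf w (⟨-, hw⟩ | ⟨hf', -⟩)
    · exact hw
    · exact absurd hf hf'
  · rintro a p n w (⟨hf, -⟩ | ⟨hf, hw, -, hne⟩) T hT h
    · obtain ⟨φ, hφ⟩ := B.exists_not_special hβ hj a p n
      exact hφ (hf _)
    · exact hne a p n rfl ((hG1 _ hf).simple _ hw _ (hG2 _ a p n rfl) T hT h)

end Blocks

end blocks

section step

open Polynomial

variable {F K S M : Type} [Field F] [DecidableEq F] [Fintype F] [Fintype K] [DecidableEq K]
  [Fintype S] [DecidableEq S] [DecidableEq M]

theorem subset_withPat (a : K → Option S) (T : Finset K) :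
    T ⊆ withPat a (T.subtype fun i => a i = none) := by
  intro i hi
  rw [mem_withPat]
  by_cases h : a i = none
  · exact Or.inr ⟨h, by simpa using hi⟩
  · exact Or.inl (Option.ne_none_iff_exists'.1 h)

theorem isLeft_fill_iff {V : Type} [DecidableEq V] {a : K → Option S} (x : {i // a i = none} → V)
    (i : K) : (fill a (fun i => Sum.inl (x i)) i).isLeft ↔ a i = none := by
  rw [← getRight?_fill x i]
  exact (Sum.getRight?_eq_none_iff).symm

namespace Blocks

variable {α : K → F} {β : S → F} {t j : ℕ} {R : S → ℕ} {W : Set (K → M ⊕ S)}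
  (B : Blocks α β t j R W)

theorem add_zero_right {A : Type} [AddZeroClass A] (a : Pat K R j)
    (p : B.κ → Special β R (t + j)) (v : B.κ → A) : B.add a p v 0 = v := by
  funext x
  exact B.add_induction a p v 0 (q := fun z x => z = v x) (fun φ => by simp) (fun _ _ => rfl) x

/-- The row of the absorber of `a` with index `y`, added to the special coordinates `p`. -/
noncomputable def posRow (a : Pat K R j) (p : B.κ → Special β R (t + j)) (y : (B.absorber a).P) :
    K → (M × (B.κ → F)) ⊕ S :=
  fill a.1 fun i => Sum.inl (((B.absorber a).pos y i).2,
    B.add a p (fun x => (p x : F[X]).eval (α i)) ((B.absorber a).pos y i).1)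

theorem posRow_eq_lift (a : Pat K R j) (p : B.κ → Special β R (t + j)) (y : (B.absorber a).P)
    {T : Finset {i // a.1 i = none}} (g : (B.absorber a).Φ → F[X]) (m : {i // a.1 i = none} → M)
    (h : ∀ i ∈ T, (B.absorber a).pos y i = (fun φ => (g φ).eval (α i), m i)) :
    ∀ i ∈ withPat a.1 T, B.posRow a p y i = lift α (fill a.1 fun i => Sum.inl (m i))
      (B.add a p (fun x => (p x : F[X])) g) i := by
  refine forall_mem_withPat.2 ⟨fun i s hi => ?_, fun i hi => ?_⟩
  · rw [posRow, fill_some hi, lift, fill_some hi]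
    rfl
  · rw [posRow, fill_coe, lift, fill_coe, h i hi]
    refine congrArg Sum.inl (Prod.ext rfl (funext fun x => ?_))
    by_cases hx : x ∈ Set.range (B.block a p)
    · obtain ⟨φ, rfl⟩ := hx
      simp only [B.add_block, eval_add]
    · simp only [B.add_of_notMem _ _ _ _ hx]

theorem posRow_cases (a : Pat K R j) (p : B.κ → Special β R (t + j)) (y : (B.absorber a).P)
    {T : Finset {i // a.1 i = none}} (hT : #T = t) :
    (∃ m : {i // a.1 i = none} → M, (¬ ∃ w ∈ W,
      ∀ i ∈ withPat a.1 T, w i = fill a.1 (fun i => Sum.inl (m i)) i) ∧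
      ∀ i ∈ withPat a.1 T, B.posRow a p y i =
        lift α (fill a.1 fun i => Sum.inl (m i)) (fun x => (p x : F[X])) i) ∨
    ∃ n, ∀ i ∈ withPat a.1 T, B.posRow a p y i =
      lift α (fill a.1 fun i => Sum.inl ((B.absorber a).ρ n i)) (B.hostPoly a p n) i := by
  rcases (B.absorber a).pos_cases y T hT with ⟨h1, h2⟩ | ⟨n, h⟩
  · refine Or.inl ⟨_, h2, ?_⟩
    have := B.posRow_eq_lift a p y 0 (fun i => ((B.absorber a).pos y i).2) (T := T)
      fun i hi => Prod.ext ((h1 i hi).trans (by ext; simp)) rfl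
    rwa [B.add_zero_right] at this
  · exact Or.inr ⟨n, B.posRow_eq_lift a p y _ _ h⟩

theorem nInf_univ_posRow (a : Pat K R j) (p : B.κ → Special β R (t + j))
    (y : (B.absorber a).P) : nInf univ (B.posRow a p y) = patCount a.1 :=
  nInf_univ_fill _ _

theorem isLeft_posRow_iff (a : Pat K R j) (p : B.κ → Special β R (t + j))
    (y : (B.absorber a).P) (i : K) : (B.posRow a p y i).isLeft ↔ a.1 i = none :=
  isLeft_fill_iff _ i

theorem exists_withPat_eq (a : Pat K R j) (p : B.κ → Special β R (t + j))
    (y : (B.absorber a).P) {T : Finset K} (hT : #T = t + j) {v : K → (M × (B.κ → F)) ⊕ S}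
    (hv : ∀ i ∈ T, B.posRow a p y i = v i) {g : (B.absorber a).Φ → F[X]} {τ : S → ℕ}
    (hg : ∀ φ, (g φ).degree < (t + j : ℕ)) (hgτ : ∀ φ, rootPoly β τ ∣ g φ) (hτR : τ ≤ R)
    (hτj : j ≤ ∑ s, τ s) (hτ : nInf T v ≤ τ) (hgv : ∀ i ∈ T, ∀ m, v i = Sum.inl m →
      ∀ φ, m.2 (B.block a p φ) = (g φ).eval (α i)) :
    ∃ T' : Finset {i // a.1 i = none}, #T' = t ∧ withPat a.1 T' = T := by
  have hsub := subset_withPat a.1 T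
  have hcard := card_le_card hsub
  rw [card_withPat, hT, a.2.2] at hcard
  by_cases ht : #(T.subtype fun i => a.1 i = none) ≤ t
  · refine ⟨_, by omega, (eq_of_subset_of_card_le hsub ?_).symm⟩
    rw [card_withPat, hT, a.2.2]
    omega
  · exfalso
    have hn : nInf T (B.posRow a p y) = nInf T v :=
      nInf_congr fun i hi => congrArg Sum.getRight? (hv i hi)
    have hsum := sum_nInf_add T (B.posRow a p y)
    simp only [isLeft_posRow_iff] at hsum
    refine (B.absorber a).rigid y (fun φ => g φ - (p (B.block a p φ) : F[X]))
      (nInf T (B.posRow a p y)) τ (T.subtype fun i => a.1 i = none) (fun φ => ?_)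
      (fun φ => ?_) ?_ ?_ ?_ ?_ ?_ fun i hi φ => ?_
    · rw [a.2.2]
      exact (degree_sub_le _ _).trans_lt (max_lt (hg φ) (p _).2.1)
    · exact dvd_sub (hgτ φ) ((rootPoly_dvd_of_le β hτR).trans (p _).2.2)
    · rwa [a.2.2]
    · rw [← B.nInf_univ_posRow a p y]
      exact nInf_mono (subset_univ T) _
    · rwa [hn]
    · rw [a.2.2, card_subtype, add_comm, ← hT, ← hsum]
    · omega
    · rw [mem_subtype] at hi
      have h1 := hv i hi
      rw [posRow, fill_coe] at h1
      have h2 := hgv i hi _ h1.symm φ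
      dsimp only at h2
      rw [B.add_block] at h2
      rw [eval_sub, ← h2]
      ring

theorem eq_of_posRow_agree (a : Pat K R j) (p : B.κ → Special β R (t + j))
    {y y' : (B.absorber a).P} {T : Finset K} (hT : #T = t + j)
    (h : ∀ i ∈ T, B.posRow a p y i = B.posRow a p y' i) : y = y' := by
  have hcard : t ≤ #(T.subtype fun i => a.1 i = none) := by
    have h1 := sum_nInf_add T (B.posRow a p y)
    have h2 : ∑ s, nInf T (B.posRow a p y) s ≤ ∑ s, patCount a.1 s := by
      rw [← B.nInf_univ_posRow a p y]
      exact sum_le_sum fun s _ => nInf_mono (subset_univ T) _ s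
    simp only [isLeft_posRow_iff] at h1
    rw [card_subtype]
    rw [a.2.2] at h2
    omega
  obtain ⟨T', hT', hcard'⟩ := exists_subset_card_eq hcard
  refine (B.absorber a).pos_unique y y' T' hcard' fun i hi => ?_
  have h1 := h i (mem_subtype.1 (hT' hi))
  rw [posRow, posRow, fill_coe, fill_coe] at h1
  have h2 := Prod.mk.inj (Sum.inl.inj h1)
  refine Prod.ext (funext fun φ => ?_) h2.1
  have h3 := congrFun h2.2 (B.block a p φ)
  rw [B.add_block, B.add_block] at h3
  exact add_left_cancel h3

theorem eq_of_posRow_agree_of_meet {α : K → F} (hα : Function.Injective α)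
    (hαβ : ∀ i s, α i ≠ β s) (B : Blocks α β t j R W) (a : Pat K R j)
    {p p' : B.κ → Special β R (t + j)} {y y' : (B.absorber a).P}
    (hb : B.block a p = B.block a p') {T : Finset K} (hT : #T = t + j)
    (h : ∀ i ∈ T, B.posRow a p y i = B.posRow a p' y' i) : p = p' := by
  refine B.eq_of_block_eq _ _ _ hb fun x hx => Subtype.ext (sub_eq_zero.1 ?_)
  refine eq_zero_of_rootPoly_dvd hα hαβ (τ := R) (A := {i ∈ T | a.1 i = none}) (t := t + j) ?_
    ((degree_sub_le _ _).trans_lt (max_lt (p x).2.1 (p' x).2.1))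
    (dvd_sub (p x).2.2 (p' x).2.2) fun i hi => ?_
  · have h1 := sum_nInf_add T (B.posRow a p y)
    have h2 : ∑ s, nInf T (B.posRow a p y) s ≤ ∑ s, R s := by
      refine sum_le_sum fun s _ => le_trans (nInf_mono (subset_univ T) _ s) ?_
      rw [B.nInf_univ_posRow a p y]
      exact a.2.1 s
    simp only [isLeft_posRow_iff] at h1
    omega
  · rw [mem_filter] at hi
    lift i to {i // a.1 i = none} using hi.2
    have h1 := h i hi.1
    rw [posRow, posRow, fill_coe, fill_coe] at h1
    have h3 := congrFun (Prod.mk.inj (Sum.inl.inj h1)).2 x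
    rw [B.add_of_notMem _ _ _ _ hx, B.add_of_notMem _ _ _ _ (hb ▸ hx)] at h3
    rw [eval_sub, h3, sub_self]

theorem exists_withPat_eq_of_disjoint (a a' : Pat K R j) (p p' : B.κ → Special β R (t + j))
    (y : (B.absorber a).P) (y' : (B.absorber a').P) (hRj : j ≤ ∑ s, R s)
    (hb : ∀ φ φ', B.block a p φ ≠ B.block a' p' φ') {T : Finset K} (hT : #T = t + j)
    (h : ∀ i ∈ T, B.posRow a p y i = B.posRow a' p' y' i) :
    ∃ T' : Finset {i // a.1 i = none}, #T' = t ∧ withPat a.1 T' = T := by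
  refine B.exists_withPat_eq a p y hT h (g := fun φ => p' (B.block a p φ)) (τ := R)
    (fun φ => (p' _).2.1) (fun φ => (p' _).2.2) le_rfl hRj ?_ fun i hi m hm φ => ?_
  · refine (nInf_mono (subset_univ T) _).trans ?_
    rw [B.nInf_univ_posRow]
    exact a'.2.1
  · have hi' : a'.1 i = none := by
      rw [← B.isLeft_posRow_iff a' p' y', hm]
      rfl
    lift i to {i // a'.1 i = none} using hi'
    rw [posRow, fill_coe] at hm
    rw [← Sum.inl.inj hm]
    dsimp only
    rw [B.add_of_notMem]
    rintro ⟨φ', h'⟩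
    exact hb φ φ' h'.symm

theorem posRow_eq_of_agree {α : K → F} (hα : Function.Injective α)
    (hβ : Function.Injective β) (hαβ : ∀ i s, α i ≠ β s) (B : Blocks α β t j R W)
    (hj : j < ∑ s, R s) (a a' : Pat K R j) (p p' : B.κ → Special β R (t + j))
    (y : (B.absorber a).P) (y' : (B.absorber a').P) {T : Finset K} (hT : #T = t + j)
    (h : ∀ i ∈ T, B.posRow a p y i = B.posRow a' p' y' i) :
    B.posRow a p y = B.posRow a' p' y' := by
  by_cases hb : ∃ φ φ', B.block a p φ = B.block a' p' φ'
  · obtain ⟨φ, φ', hφ⟩ := hb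
    obtain rfl := B.eq_of_meet _ _ _ _ _ _ hφ
    obtain rfl := eq_of_posRow_agree_of_meet hα hαβ B a (B.block_eq_of_meet _ _ _ _ _ hφ) hT h
    rw [B.eq_of_posRow_agree a p hT h]
  · push Not at hb
    obtain ⟨T', hT', hTT'⟩ := B.exists_withPat_eq_of_disjoint a a' p p' y y' hj.le hb hT h
    obtain ⟨T'', -, hTT''⟩ := B.exists_withPat_eq_of_disjoint a' a p' p y' y hj.le
      (fun φ φ' => (hb φ' φ).symm) hT fun i hi => (h i hi).symm
    obtain rfl : a = a' := by
      refine Subtype.ext (funext fun i => ?_)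
      by_cases hi : i ∈ T
      · have := congrArg Sum.getRight? (h i hi)
        rwa [posRow, posRow, getRight?_fill, getRight?_fill] at this
      · have hnone : ∀ (a : Pat K R j) (T' : Finset {i // a.1 i = none}), withPat a.1 T' = T →
            a.1 i = none := fun a T' hT' => by
          by_contra hc
          exact hi (hT' ▸ mem_withPat.2 (Or.inl (Option.ne_none_iff_exists'.1 hc)))
        rw [hnone a T' hTT', hnone a' T'' hTT'']
    subst hTT'
    have hkey : ∀ (m m' : {i // a.1 i = none} → M) (f f' : B.κ → F[X]),
        (∀ c, (f c).degree < ((t + j : ℕ) : WithBot ℕ)) →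
        (∀ c, (f' c).degree < ((t + j : ℕ) : WithBot ℕ)) →
        (∀ c, rootPoly β (patCount a.1) ∣ f c) → (∀ c, rootPoly β (patCount a.1) ∣ f' c) →
        (∀ i ∈ withPat a.1 T', B.posRow a p y i = lift α (fill a.1 fun i => Sum.inl (m i)) f i) →
        (∀ i ∈ withPat a.1 T', B.posRow a p' y' i =
          lift α (fill a.1 fun i => Sum.inl (m' i)) f' i) → f = f' := by
      intro m m' f f' hf hf' hd hd' h1 h2
      rw [← nInf_univ_fill a.1 m] at hd
      rw [← nInf_univ_fill a.1 m'] at hd'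
      have h3 := fun i hi => (h1 i hi).symm.trans ((h i hi).trans (h2 i hi))
      exact (eq_of_lift_agree hα hαβ (q := 0) (by simpa only [sub_zero] using hf)
        (by simpa only [sub_zero] using hf') hd hd' hT h3).1
    have hsp : ∀ (p : B.κ → Special β R (t + j)) c, rootPoly β (patCount a.1) ∣ (p c : F[X]) :=
      fun p c => (rootPoly_dvd_of_le β a.2.1).trans (p c).2.2
    have hpp : p = p' := by
      rcases B.posRow_cases a p y hT' with ⟨m, -, h1⟩ | ⟨n, h1⟩ <;>
        rcases B.posRow_cases a p' y' hT' with ⟨m', -, h2⟩ | ⟨n', h2⟩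
      · have := hkey _ _ _ _ (fun c => (p c).2.1) (fun c => (p' c).2.1) (hsp p) (hsp p') h1 h2
        exact funext fun c => Subtype.ext (congrFun this c)
      · have := hkey _ _ _ _ (fun c => (p c).2.1) (B.degree_hostPoly a p' n') (hsp p)
          (B.rootPoly_dvd_hostPoly a p' n') h1 h2
        obtain ⟨φ, hφ⟩ := B.exists_not_special hβ hj a p' n'
        exact absurd (this ▸ (p _).2.2) hφ
      · have := hkey _ _ _ _ (B.degree_hostPoly a p n) (fun c => (p' c).2.1)
          (B.rootPoly_dvd_hostPoly a p n) (hsp p') h1 h2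
        obtain ⟨φ, hφ⟩ := B.exists_not_special hβ hj a p n
        exact absurd (this ▸ (p' _).2.2) hφ
      · exact (B.hostPoly_injective hβ hj (hkey _ _ _ _ (B.degree_hostPoly a p n)
          (B.degree_hostPoly a p' n') (B.rootPoly_dvd_hostPoly a p n)
          (B.rootPoly_dvd_hostPoly a p' n') h1 h2)).2.1
    subst hpp
    rw [B.eq_of_posRow_agree a p hT h]

theorem IsKept.rootPoly_dvd {α : K → F} {β : S → F} (hβ : Function.Injective β)
    {B : Blocks α β t j R W} {L : (B.κ → F[X]) → Set (K → M ⊕ S)} (hL : B.IsKept L)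
    (f : B.κ → F[X]) {w : K → M ⊕ S} (hw : w ∈ L f) (c : B.κ) : rootPoly β (nInf univ w) ∣ f c :=
  (rootPoly_dvd_of_le β (hL.cap f w hw)).trans (rootPoly_capm_dvd hβ R f c)

theorem IsKept.not_agree {α : K → F} (hα : Function.Injective α) {β : S → F}
    (hβ : Function.Injective β) (hαβ : ∀ i s, α i ≠ β s)
    {B : Blocks α β t j R W} {L : (B.κ → F[X]) → Set (K → M ⊕ S)} (hL : B.IsKept L)
    {f : B.κ → F[X]} {w : K → M ⊕ S} (hf : ∀ c, (f c).degree < ((t + j : ℕ) : WithBot ℕ))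
    (hw : w ∈ L f) (a : Pat K R j) (p : B.κ → Special β R (t + j)) (y : (B.absorber a).P)
    {T : Finset K} (hT : #T = t + j) : ¬ ∀ i ∈ T, B.posRow a p y i = lift α w f i := by
  intro h
  have hg : ∀ φ, rootPoly β (nInf univ w) ∣ f (B.block a p φ) := fun φ => hL.rootPoly_dvd hβ f hw _
  have hgv : ∀ i ∈ T, ∀ m, lift α w f i = Sum.inl m →
      ∀ φ, m.2 (B.block a p φ) = (f (B.block a p φ)).eval (α i) := by
    intro i hi m hm φ
    rw [lift] at hm
    rcases hwi : w i with m' | s <;> rw [hwi] at hm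
    · rw [← Sum.inl.inj hm]
    · cases hm
  have hn : nInf T (lift α w f) ≤ nInf univ w := by
    rw [nInf_lift]
    exact nInf_mono (subset_univ T) w
  obtain ⟨T', hT', rfl⟩ := B.exists_withPat_eq a p y hT h (g := fun φ => f (B.block a p φ))
    (fun φ => hf _) hg ((hL.cap f w hw).trans (capm_le _ _ _)) (hL.ge f w hw) hn hgv
  have hkey : ∀ (m : {i // a.1 i = none} → M) (f' : B.κ → F[X]),
      (∀ c, (f' c).degree < ((t + j : ℕ) : WithBot ℕ)) →
      (∀ c, rootPoly β (patCount a.1) ∣ f' c) →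
      (∀ i ∈ withPat a.1 T', B.posRow a p y i = lift α (fill a.1 fun i => Sum.inl (m i)) f' i) →
      f' = f ∧ ∀ i ∈ withPat a.1 T', fill a.1 (fun i => Sum.inl (m i)) i = w i := by
    intro m f' hf' hd h1
    rw [← nInf_univ_fill a.1 m] at hd
    have h3 := fun i hi => (h1 i hi).symm.trans (h i hi)
    exact eq_of_lift_agree hα hαβ (q := 0) (by simpa only [sub_zero] using hf')
      (by simpa only [sub_zero] using hf) hd (fun c => hL.rootPoly_dvd hβ f hw c) hT h3
  rcases B.posRow_cases a p y hT' with ⟨m, h1, h2⟩ | ⟨n, h2⟩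
  · obtain ⟨rfl, h4⟩ := hkey m _ (fun c => (p c).2.1)
      (fun c => (rootPoly_dvd_of_le β a.2.1).trans (p c).2.2) h2
    exact h1 ⟨w, hL.mem_of_special _ (fun c => (p c).2.2) hw, fun i hi => (h4 i hi).symm⟩
  · obtain ⟨rfl, h4⟩ := hkey _ _ (B.degree_hostPoly a p n) (B.rootPoly_dvd_hostPoly a p n) h2
    exact hL.not_host a p n w hw _ hT fun i hi => (h4 i hi).symm

theorem IsKept.exists_lift_or_posRow {α : K → F} (hα : Function.Injective α) {β : S → F}
    (hβ : Function.Injective β) (hαβ : ∀ i s, α i ≠ β s) (o : M)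
    {B : Blocks α β t j R W} {L : (B.κ → F[X]) → Set (K → M ⊕ S)} (hL : B.IsKept L)
    {T : Finset K} (hT : #T = t + j) {x : K → (M × (B.κ → F)) ⊕ S} (hx : nInf T x ≤ R)
    (hxj : j ≤ ∑ s, nInf T x s) :
    (∃ (f : B.κ → F[X]) (w : K → M ⊕ S), (∀ c, (f c).degree < ((t + j : ℕ) : WithBot ℕ)) ∧
      w ∈ L f ∧ ∀ i ∈ T, lift α w f i = x i) ∨ ∃ a p y, ∀ i ∈ T, B.posRow a p y i = x i := by
  obtain ⟨f, hf, hxf, hfx⟩ := exists_lift hα hαβ 0 hT x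
  simp only [sub_zero] at hf
  have hx0 := nInf_map_fst T x
  rcases hL.cover f T hT (fun i => (x i).map Prod.fst id)
      (by rw [hx0]; exact le_capm hβ hx hxf) (by rw [hx0]; exact hxj) with
    ⟨w, hw, hwx⟩ | ⟨hsum, ⟨hfR, hno⟩ | ⟨a, p, n, rfl, hwx⟩⟩
  · exact Or.inl ⟨f, w, hf, hw, hfx w hwx⟩
  · let a₀ : K → Option S := fun i => if i ∈ T then (x i).getRight? else none
    have ha₀ : ∀ i s, a₀ i = some s ↔ i ∈ T ∧ x i = Sum.inr s := fun i s => by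
      simp only [a₀]
      split_ifs with hi
      · rw [Sum.getRight?_eq_some_iff]
        exact ⟨fun h => ⟨hi, h⟩, fun h => h.2⟩
      · simp [hi]
    have hcount : patCount a₀ = nInf T x := funext fun s => by
      rw [patCount, nInf]
      congr 1
      ext i
      rw [mem_filter_univ, mem_filter, ha₀]
    let a : Pat K R j := ⟨a₀, by rwa [hcount], by rw [hcount, ← hx0, hsum]⟩
    have hTa : withPat a.1 (T.subtype fun i => a.1 i = none) = T := by
      refine Subset.antisymm (fun i hi => ?_) (subset_withPat _ _)
      rcases mem_withPat.1 hi with ⟨s, hs⟩ | ⟨h1, h2⟩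
      · exact ((ha₀ i s).1 hs).1
      · exact mem_subtype.1 h2
    have hT' : #(T.subtype fun i => a.1 i = none) = t := by
      have := card_withPat a.1 (T.subtype fun i => a.1 i = none)
      rw [hTa, hT, a.2.2] at this
      omega
    let m : {i // a.1 i = none} → M := fun i => Sum.elim Prod.fst (fun _ => o) (x i)
    have hm : ∀ i ∈ T, fill a.1 (fun i => Sum.inl (m i)) i = (x i).map Prod.fst id := by
      rw [← hTa]
      have h := agree_fill_iff (T := T.subtype fun i => a.1 i = none)
        (w := fun i => (x i).map Prod.fst id) (x := fun i => Sum.inl (m i))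
      refine fun i hi => Eq.symm (h.2 ⟨fun i s hs => ?_, fun i hi => ?_⟩ i hi)
      · simp only [((ha₀ i s).1 hs).2, Sum.map_inr, id]
      · simp only [m]
        rcases hxi : x i with m' | s
        · rfl
        · have h1 := (ha₀ i s).2 ⟨mem_subtype.1 hi, hxi⟩
          have h2 : a₀ i = none := i.2
          rw [h1] at h2
          cases h2
    obtain ⟨y, hy⟩ := (B.absorber a).exists_pos _ hT' m (by
      rintro ⟨w, hw, hwm⟩
      rw [hTa] at hwm
      exact hno ⟨w, hw, fun i hi => (hwm i hi).trans (hm i hi)⟩)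
    have h1 := B.posRow_eq_lift a (fun c => ⟨f c, hf c, hfR c⟩) y 0 m
      fun i hi => (hy i hi).trans (Prod.ext (funext fun _ => eval_zero.symm) rfl)
    rw [B.add_zero_right, hTa] at h1
    exact Or.inr ⟨a, _, y, fun i hi => (h1 i hi).trans (hfx _ hm i hi)⟩
  · have hT' : #(T.subtype fun i => a.1 i = none) = t := by
      have h1 := sum_nInf_add T (fill a.1 fun i => Sum.inl ((B.absorber a).ρ n i))
      rw [nInf_congr fun i hi => congrArg Sum.getRight? (hwx i hi), hsum, hT] at h1
      simp only [isLeft_fill_iff] at h1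
      rw [card_subtype]
      omega
    have hTa : withPat a.1 (T.subtype fun i => a.1 i = none) = T := by
      refine (eq_of_subset_of_card_le (subset_withPat _ _) ?_).symm
      rw [card_withPat, hT', a.2.2, hT, add_comm]
    obtain ⟨y, hy⟩ := (B.absorber a).exists_pos_host n _ hT'
    have h1 := B.posRow_eq_lift a p y _ _ hy
    rw [hTa] at h1
    exact Or.inr ⟨a, p, y, fun i hi => (h1 i hi).trans (hfx _ hwx i hi)⟩

end Blocks

theorem isP_step {α : K → F} (hα : Function.Injective α) {β : S → F}
    (hβ : Function.Injective β) (hαβ : ∀ i s, α i ≠ β s) (o : M) {t j : ℕ} {R : S → ℕ}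
    (hj : j < ∑ s, R s)
    {W : Set (K → M ⊕ S)} (B : Blocks α β t j R W) {L : (B.κ → F[X]) → Set (K → M ⊕ S)}
    (hL : B.IsKept L) :
    IsP (t + j) R j ({v | ∃ (f : B.κ → F[X]) (w : K → M ⊕ S),
      (∀ c, (f c).degree < ((t + j : ℕ) : WithBot ℕ)) ∧ w ∈ L f ∧ lift α w f = v} ∪
      {v | ∃ a p y, B.posRow a p y = v}) := by
  refine ⟨?_, ?_, ?_, ?_⟩
  · rintro _ (⟨f, w, -, hw, rfl⟩ | ⟨a, p, y, rfl⟩)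
    · rw [nInf_lift]
      exact (hL.cap f w hw).trans (capm_le _ _ _)
    · rw [B.nInf_univ_posRow]
      exact a.2.1
  · rintro _ (⟨f, w, -, hw, rfl⟩ | ⟨a, p, y, rfl⟩)
    · rw [nInf_lift]
      exact hL.ge f w hw
    · rw [B.nInf_univ_posRow, a.2.2]
  · intro T hT x hx hxj
    rcases hL.exists_lift_or_posRow hα hβ hαβ o hT hx hxj with ⟨f, w, hf, hw, h⟩ | ⟨a, p, y, h⟩
    · exact ⟨_, Or.inl ⟨f, w, hf, hw, rfl⟩, h⟩
    · exact ⟨_, Or.inr ⟨a, p, y, rfl⟩, h⟩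
  · rintro _ (⟨f, w, hf, hw, rfl⟩ | ⟨a, p, y, rfl⟩) _ (⟨f', w', hf', hw', rfl⟩ | ⟨a', p', y', rfl⟩)
      T hT h
    · obtain ⟨rfl, h1⟩ := eq_of_lift_agree hα hαβ (q := 0) (by simpa only [sub_zero] using hf)
        (by simpa only [sub_zero] using hf')
        (hL.rootPoly_dvd hβ f hw) (hL.rootPoly_dvd hβ f' hw') hT h
      rw [hL.simple f w hw w' hw' T hT h1]
    · exact absurd (fun i hi => (h i hi).symm) (hL.not_agree hα hβ hαβ hf hw a' p' y' hT)
    · exact absurd h (hL.not_agree hα hβ hαβ hf' hw' a p y hT)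
    · exact Blocks.posRow_eq_of_agree hα hβ hαβ B hj a a' p p' y y' hT h

theorem exists_step [Fintype M] {α : K → F} (hα : Function.Injective α) {β : S → F}
    (hβ : Function.Injective β) (hαβ : ∀ i s, α i ≠ β s) (o : M) {t j : ℕ} {R : S → ℕ}
    (hj : j < ∑ s, R s) (hK : t + j ≤ Fintype.card K) {W : Set (K → M ⊕ S)}
    (hW : IsP (t + j) R (j + 1) W)
    (hD : ∀ R' ≤ R, R' ≠ R → ∃ W : Set (K → M ⊕ S), IsP (t + j) R' 0 W) :
    ∃ (κ : Type) (_ : Fintype κ) (W' : Set (K → (M × (κ → F)) ⊕ S)), IsP (t + j) R j W' := by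
  have : Nonempty S := by
    by_contra hS
    rw [not_nonempty_iff] at hS
    simp at hj
  obtain ⟨B⟩ := nonempty_blocks fun a : Pat K R j =>
    nonempty_absorber o hα hβ hαβ hW hK a.1 a.2.1 a.2.2
  obtain ⟨L, hL⟩ := B.exists_isKept hβ hj hK hW hD
  exact ⟨B.κ, inferInstance, _, isP_step hα hβ hαβ o hj B hL⟩

end step

section relabel

variable {K M S M' S' : Type} [Fintype K] [DecidableEq K] [Fintype S] [DecidableEq S]
  [DecidableEq M] [Fintype S'] [DecidableEq S'] [DecidableEq M']

theorem IsP.relabel [Nonempty M] {t : ℕ} {R : S → ℕ} {W : Set (K → M ⊕ S)} (hW : IsP t R 0 W)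
    (R' : S' → ℕ) (h : M ⊕ S → M' ⊕ S')
    (hinj : ∀ z z', (∀ s, z = Sum.inr s → 0 < R s) → (∀ s, z' = Sum.inr s → 0 < R s) →
      h z = h z' → z = z')
    (hsurj : ∀ z', (∀ s', z' = Sum.inr s' → 0 < R' s') →
      ∃ z, (∀ s, z = Sum.inr s → 0 < R s) ∧ h z = z')
    (hcap : ∀ z s', (∀ s, z = Sum.inr s → 0 < R s) → h z = Sum.inr s' →
      ∃ s, z = Sum.inr s ∧ R s ≤ R' s')
    (hcap' : ∀ s, 0 < R s → t ≤ R s ∨ ∃ s', h (Sum.inr s) = Sum.inr s' ∧ R' s' ≤ R s) :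
    ∃ W' : Set (K → M' ⊕ S'), IsP t R' 0 W' := by
  have hpos : ∀ {M S : Type} [DecidableEq M] [Fintype S] [DecidableEq S] {R : S → ℕ} {T : Finset K}
      {w : K → M ⊕ S}, nInf T w ≤ R → ∀ i ∈ T, ∀ s, w i = Sum.inr s → 0 < R s := by
    intro M S _ _ _ R T w hw i hi s his
    exact (card_pos.2 ⟨i, mem_filter.2 ⟨hi, his⟩⟩).trans_le (hw s)
  refine ⟨{w' | ∃ w ∈ W, h ∘ w = w'}, ?_, fun _ _ => Nat.zero_le _, ?_, ?_⟩
  · rintro _ ⟨w, hw, rfl⟩ s'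
    have hal := fun i => hpos (hW.cap w hw) i (mem_univ i)
    by_cases he : ∃ i, h (w i) = Sum.inr s'
    · obtain ⟨i, hi⟩ := he
      obtain ⟨s, hs, hR⟩ := hcap _ s' (hal i) hi
      refine le_trans (card_le_card fun k hk => ?_) ((hW.cap w hw s).trans hR)
      rw [mem_filter_univ] at hk ⊢
      rw [← hs]
      exact hinj _ _ (hal k) (hal i) (hk.trans hi.symm)
    · push Not at he
      rw [nInf, filter_false_of_mem (p := fun i => (h ∘ w) i = Sum.inr s') fun i _ => he i]
      exact Nat.zero_le _
  · intro T hT x' hx' _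
    have : ∀ i : K, ∃ z, i ∈ T → (∀ s, z = Sum.inr s → 0 < R s) ∧ h z = x' i := by
      intro i
      by_cases hi : i ∈ T
      · obtain ⟨z, hz⟩ := hsurj (x' i) (hpos hx' i hi)
        exact ⟨z, fun _ => hz⟩
      · exact ⟨Sum.inl (Classical.arbitrary M), fun h => absurd h hi⟩
    choose x hx using this
    have hxR : nInf T x ≤ R := by
      intro s
      by_cases he : ∃ i ∈ T, x i = Sum.inr s
      · obtain ⟨i, hi, his⟩ := he
        rcases hcap' s ((hx i hi).1 s his) with h1 | ⟨s', h1, h2⟩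
        · exact ((card_filter_le _ _).trans hT.le).trans h1
        · refine le_trans (card_le_card fun k hk => ?_) ((hx' s').trans h2)
          rw [mem_filter] at hk ⊢
          rw [← (hx k hk.1).2, hk.2]
          exact ⟨hk.1, h1⟩
      · push Not at he
        rw [nInf, filter_false_of_mem he]
        exact Nat.zero_le _
    obtain ⟨w, hw, hwx⟩ := hW.cover T hT x hxR (Nat.zero_le _)
    exact ⟨_, ⟨w, hw, rfl⟩, fun i hi => by rw [Function.comp_apply, hwx i hi, (hx i hi).2]⟩
  · rintro _ ⟨w, hw, rfl⟩ _ ⟨w₁, hw₁, rfl⟩ T hT hag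
    rw [hW.simple w hw w₁ hw₁ T hT fun i hi => hinj _ _ (hpos (hW.cap w hw) i (mem_univ i))
      (hpos (hW.cap w₁ hw₁) i (mem_univ i)) (hag i hi)]

end relabel

section seeds

open Polynomial

variable {F K S : Type} [Field F] [DecidableEq F] [Fintype F] [Fintype K] [DecidableEq K]
  [Fintype S] [DecidableEq S]

theorem exists_isP_mul {M κ : Type} [DecidableEq M] [Fintype κ] {α : K → F}
    (hα : Function.Injective α) {β : S → F} (hβ : Function.Injective β) (hαβ : ∀ i s, α i ≠ β s)
    {t : ℕ} {R : S → ℕ} (hD : ∀ R' ≤ R, ∃ W : Set (K → M ⊕ S), IsP t R' 0 W) :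
    ∃ W : Set (K → (M × (κ → F)) ⊕ S), IsP t R 0 W :=
  exists_glued hα hβ hαβ 0 R fun f _ => hD _ (capm_le β R f)

theorem exists_isP_zero (M : Type) [DecidableEq M] [Unique M] (t : ℕ) :
    ∃ W : Set (K → M ⊕ S), IsP t 0 0 W := by
  refine ⟨{fun _ => Sum.inl default}, ?_, fun _ _ => Nat.zero_le _, fun T hT x hx _ => ?_, ?_⟩
  · rintro _ rfl s
    simp [nInf]
  · refine ⟨_, rfl, fun i hi => ?_⟩
    rcases hxi : x i with m | s
    · rw [Unique.eq_default m]
    · have : 0 < nInf T x s := card_pos.2 ⟨i, mem_filter.2 ⟨hi, hxi⟩⟩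
      exact absurd (hx s) (not_le.2 this)
  · rintro _ rfl _ rfl _ _ _
    rfl

theorem exists_isP_of_lt {M : Type} [Fintype M] [DecidableEq M] [Nonempty M] {α : K → F}
    (hα : Function.Injective α) {β : S → F} (hβ : Function.Injective β) (hαβ : ∀ i s, α i ≠ β s)
    {t : ℕ} (hK : t ≤ Fintype.card K) {R : S → ℕ} (hR : ∑ s, R s ≤ t) (hR0 : R ≠ 0)
    {D : Set (S → ℕ)} (hD : IsLowerSet D) (hRD : ∀ R' < R, R' ∈ D)
    (h : ∀ R' ∈ D, ∃ W : Set (K → M ⊕ S), IsP t R' 0 W) :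
    ∃ (M' : Type) (_ : Fintype M') (_ : DecidableEq M') (_ : Nonempty M'),
      (∀ R' ∈ D, ∃ W : Set (K → M' ⊕ S), IsP t R' 0 W) ∧ ∃ W : Set (K → M' ⊕ S), IsP t R 0 W := by
  suffices H : ∀ d ≤ ∑ s, R s, ∃ (M' : Type) (_ : Fintype M') (_ : DecidableEq M')
      (_ : Nonempty M'), (∀ R' ∈ D, ∃ W : Set (K → M' ⊕ S), IsP t R' 0 W) ∧
      ∃ W : Set (K → M' ⊕ S), IsP t R (∑ s, R s - d) W by
    simpa only [Nat.sub_self] using H _ le_rfl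
  intro d
  induction d with
  | zero =>
    intro _
    obtain ⟨W, hW⟩ := h 0 (hRD 0 (pos_iff_ne_zero.2 hR0))
    obtain ⟨W', hW'⟩ := exists_top hα R hR (Classical.arbitrary M) hW
    exact ⟨_, inferInstance, inferInstance, inferInstance,
      fun R' hR' => exists_isP_mul hα hβ hαβ fun R'' hR'' => h R'' (hD hR'' hR'), W', hW'⟩
  | succ d ih =>
    intro hd
    obtain ⟨M₁, _, _, _, h1, W₁, hW₁⟩ := ih (by omega)
    obtain ⟨j, hj⟩ : ∃ j, ∑ s, R s - (d + 1) = j := ⟨_, rfl⟩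
    have hj' : ∑ s, R s - d = j + 1 := by omega
    obtain ⟨t', rfl⟩ : ∃ t', t = t' + j := ⟨t - j, by omega⟩
    rw [hj'] at hW₁
    obtain ⟨κ, _, W', hW'⟩ := exists_step hα hβ hαβ (Classical.arbitrary M₁) (by omega) hK hW₁
      fun R' hR' hne => h1 R' (hRD R' (lt_of_le_of_ne hR' hne))
    have : DecidableEq κ := Classical.decEq κ
    rw [hj]
    exact ⟨_, inferInstance, inferInstance, inferInstance,
      fun R' hR' => exists_isP_mul hα hβ hαβ fun R'' hR'' => h1 R'' (hD hR'' hR'), W', hW'⟩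

theorem exists_isP {α : K → F} (hα : Function.Injective α) {β : S → F}
    (hβ : Function.Injective β) (hαβ : ∀ i s, α i ≠ β s) {t : ℕ} (hK : t ≤ Fintype.card K)
    (D : Finset (S → ℕ)) (hD : IsLowerSet (D : Set (S → ℕ))) (hDt : ∀ R ∈ D, ∑ s, R s ≤ t) :
    ∃ (M : Type) (_ : Fintype M) (_ : DecidableEq M) (_ : Nonempty M),
      ∀ R ∈ D, ∃ W : Set (K → M ⊕ S), IsP t R 0 W := by
  induction D using Finset.strongInduction with
  | H D ih =>
    rcases D.eq_empty_or_nonempty with rfl | hne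
    · exact ⟨Unit, inferInstance, inferInstance, inferInstance, by simp⟩
    · obtain ⟨R, hR⟩ := D.exists_maximal hne
      by_cases hR0 : R = 0
      · subst hR0
        refine ⟨Unit, inferInstance, inferInstance, inferInstance, fun R' hR' => ?_⟩
        obtain rfl : R' = 0 := le_antisymm (hR.2 hR' zero_le) zero_le
        exact exists_isP_zero Unit t
      · have hlow : IsLowerSet (D.erase R : Set (S → ℕ)) := by
          intro x y hyx hx
          rw [mem_coe, mem_erase] at hx ⊢
          refine ⟨?_, hD hyx hx.2⟩
          rintro rfl
          exact hx.1 (le_antisymm (hR.2 hx.2 hyx) hyx)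
        obtain ⟨M, _, _, _, hM⟩ := ih _ (erase_ssubset hR.1) hlow fun R' hR' =>
          hDt R' (mem_of_mem_erase hR')
        obtain ⟨M', i1, i2, i3, h1, h2⟩ := exists_isP_of_lt hα hβ hαβ hK (hDt R hR.1) hR0 hlow
          (fun R' hR' => mem_coe.2 (mem_erase.2 ⟨hR'.ne, hD hR'.le hR.1⟩)) hM
        refine ⟨M', i1, i2, i3, fun R' hR' => ?_⟩
        by_cases he : R' = R
        · rwa [he]
        · exact h1 R' (mem_coe.2 (mem_erase.2 ⟨he, hR'⟩))

end seeds

section seed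

open Polynomial

variable {K : Type} [Fintype K] [DecidableEq K]

/-- Designs of strength `t` on `m` uncapped symbols exist for all caps with sum at most `t`. -/
def Seed (K : Type) [Fintype K] [DecidableEq K] (t m : ℕ) : Prop :=
  0 < m ∧ ∀ R : Fin t → ℕ, ∑ k, R k ≤ t → ∃ W : Set (K → Fin m ⊕ Fin t), IsP t R 0 W

theorem IsP.map_equiv {M M' S : Type} [Fintype S] [DecidableEq S] [DecidableEq M] [DecidableEq M']
    [Nonempty M] {t : ℕ} {R : S → ℕ} {W : Set (K → M ⊕ S)} (hW : IsP t R 0 W) (e : M ≃ M') :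
    ∃ W' : Set (K → M' ⊕ S), IsP t R 0 W' := by
  refine hW.relabel R (e.sumCongr (Equiv.refl S)) (fun _ _ _ _ h => (Equiv.injective _ h))
    (fun z' hz' => ⟨(e.sumCongr (Equiv.refl S)).symm z', fun s hs => hz' s ?_,
      Equiv.apply_symm_apply _ _⟩) (fun z s' _ hs => ⟨s', ?_, le_rfl⟩)
    fun s _ => Or.inr ⟨s, rfl, le_rfl⟩
  · rw [Equiv.symm_apply_eq] at hs
    exact hs
  · rw [← Equiv.eq_symm_apply] at hs
    exact hs

theorem exists_embeddings (F S : Type) [Fintype F] [Fintype S]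
    (h : Fintype.card K + Fintype.card S ≤ Fintype.card F) : ∃ (α : K → F) (β : S → F),
      Function.Injective α ∧ Function.Injective β ∧ ∀ i s, α i ≠ β s := by
  obtain ⟨e⟩ := Function.Embedding.nonempty_of_card_le (α := K ⊕ S) (β := F) (by
    rwa [Fintype.card_sum])
  exact ⟨e ∘ Sum.inl, e ∘ Sum.inr, e.injective.comp Sum.inl_injective,
    e.injective.comp Sum.inr_injective, fun i s h => Sum.inl_ne_inr (e.injective h)⟩

theorem exists_seed {t : ℕ} (hK : t ≤ Fintype.card K) : ∃ m, Seed K t m := by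
  obtain ⟨p, hp, hpp⟩ := Nat.exists_infinite_primes (Fintype.card K + t)
  have : Fact p.Prime := ⟨hpp⟩
  obtain ⟨α, β, hα, hβ, hαβ⟩ := exists_embeddings (K := K) (ZMod p) (Fin t) (by
    rwa [Fintype.card_fin, ZMod.card])
  let D : Finset (Fin t → ℕ) :=
    {R ∈ Fintype.piFinset fun _ => range (t + 1) | ∑ k, R k ≤ t}
  have hD : ∀ R, R ∈ D ↔ ∑ k, R k ≤ t := fun R => by
    rw [mem_filter, Fintype.mem_piFinset]
    refine ⟨fun h => h.2, fun h => ⟨fun k => mem_range.2 (Nat.lt_succ_of_le ?_), h⟩⟩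
    exact (single_le_sum (fun _ _ => Nat.zero_le _) (mem_univ k)).trans h
  obtain ⟨M, _, _, _, hM⟩ := exists_isP hα hβ hαβ hK D (fun R R' hR hR' => by
    rw [mem_coe, hD] at hR' ⊢
    exact (sum_le_sum fun k _ => hR k).trans hR') fun R hR => (hD R).1 hR
  refine ⟨Fintype.card M, Fintype.card_pos, fun R hR => ?_⟩
  obtain ⟨W, hW⟩ := hM R ((hD R).2 hR)
  exact hW.map_equiv (Fintype.equivFin M)

theorem Seed.exists_isP {t m : ℕ} (h : Seed K t m) {S : Type} [Fintype S] [DecidableEq S]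
    (R : S → ℕ) (hR : ∑ s, R s ≤ t) : ∃ W : Set (K → Fin m ⊕ S), IsP t R 0 W := by
  have : NeZero m := ⟨h.1.ne'⟩
  have hsum : ∑ s : {s // 0 < R s}, R s = ∑ s, R s := by
    rw [← sum_subtype {s | 0 < R s} (by simp) R]
    exact sum_filter_of_ne fun s _ hs => Nat.pos_of_ne_zero hs
  have hcard : Fintype.card {s // 0 < R s} ≤ Fintype.card (Fin t) := by
    rw [Fintype.card_fin, Fintype.card_eq_sum_ones]
    exact ((sum_le_sum fun s _ => s.2).trans hsum.le).trans hR
  obtain ⟨e⟩ := Function.Embedding.nonempty_of_card_le hcard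
  let R' : Fin t → ℕ := Function.extend e (fun s => R s) 0
  have hR' : ∀ s : {s // 0 < R s}, R' (e s) = R s := fun s => e.injective.extend_apply _ _ _
  have hR'' : ∀ k, 0 < R' k → ∃ s, e s = k := fun k hk => by
    by_contra hc
    simp only [R', Function.extend_apply' _ _ _ hc, Pi.zero_apply, lt_irrefl] at hk
  have hsum' : ∑ k, R' k = ∑ s : {s // 0 < R s}, R s := by
    rw [← sum_congr rfl fun s _ => hR' s, ← sum_map univ e, eq_comm]
    refine sum_subset (subset_univ _) fun k _ hk => ?_
    by_contra hc
    obtain ⟨s, rfl⟩ := hR'' k (Nat.pos_of_ne_zero hc)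
    exact hk (mem_map_of_mem _ (mem_univ s))
  obtain ⟨W, hW⟩ := h.2 R' (by rw [hsum', hsum]; exact hR)
  let g : Fin t → Fin m ⊕ S := Function.extend e (fun s => Sum.inr s) fun _ => Sum.inl 0
  have hg : ∀ s : {s // 0 < R s}, g (e s) = Sum.inr s.1 := fun s => e.injective.extend_apply _ _ _
  refine hW.relabel R (Sum.elim Sum.inl g) ?_ ?_ ?_ ?_
  · rintro (x | k) (x' | k') hz hz' hzz
    · exact congrArg Sum.inl (Sum.inl.inj hzz)
    · obtain ⟨s, rfl⟩ := hR'' k' (hz' k' rfl)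
      simp [hg] at hzz
    · obtain ⟨s, rfl⟩ := hR'' k (hz k rfl)
      simp [hg] at hzz
    · obtain ⟨s, rfl⟩ := hR'' k (hz k rfl)
      obtain ⟨s', rfl⟩ := hR'' k' (hz' k' rfl)
      simp only [Sum.elim_inr, hg, Sum.inr.injEq] at hzz
      rw [Subtype.ext hzz]
  · rintro (x | s) hz
    · exact ⟨Sum.inl x, by simp, rfl⟩
    · refine ⟨Sum.inr (e ⟨s, hz s rfl⟩), fun k hk => ?_, hg _⟩
      rw [← Sum.inr.inj hk, hR']
      exact hz s rfl
  · rintro (x | k) s hz hs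
    · cases hs
    · obtain ⟨s', rfl⟩ := hR'' k (hz k rfl)
      rw [Sum.elim_inr, hg, Sum.inr.injEq] at hs
      exact ⟨_, rfl, by rw [hR', hs]⟩
  · intro k hk
    obtain ⟨s, rfl⟩ := hR'' k hk
    exact Or.inr ⟨s, hg s, (hR' s).ge⟩

theorem Seed.mul_add {t m u : ℕ} (ht : 0 < t) (h : Seed K t m) (F : Type) [Field F] [Fintype F]
    (hu : u + Fintype.card K + t ≤ Fintype.card F) : Seed K t (m * Fintype.card F + u) := by
  classical
  have : NeZero m := ⟨h.1.ne'⟩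
  refine ⟨Nat.add_pos_left (Nat.mul_pos h.1 Fintype.card_pos) _, fun R hR => ?_⟩
  obtain ⟨α, β, hα, hβ, hαβ⟩ := exists_embeddings (K := K) F (Fin u ⊕ Fin t) (by
    rw [Fintype.card_sum, Fintype.card_fin, Fintype.card_fin]
    omega)
  obtain ⟨W, hW⟩ := exists_glued (M := Fin m) (κ := Unit) (t := t) hα hβ hαβ (X ^ t)
    (Sum.elim (fun _ => t) R) fun f hf => h.exists_isP _ (by
      have h1 : (f ()).degree = t := by
        rw [← sub_add_cancel (f ()) (X ^ t), degree_add_eq_right_of_degree_lt (by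
          rw [degree_X_pow]
          exact hf ()), degree_X_pow]
      have h2 : f () ≠ 0 := by
        rintro h0
        rw [h0, degree_zero] at h1
        cases h1
      have h3 := degree_le_of_dvd (rootPoly_capm_dvd hβ (Sum.elim (fun _ => t) R) f ()) h2
      rw [degree_rootPoly, h1] at h3
      exact_mod_cast h3)
  have e : (Fin m × (Unit → F)) ⊕ Fin u ≃ Fin (m * Fintype.card F + u) :=
    Fintype.equivFinOfCardEq (by simp)
  have : Nonempty (Fin m × (Unit → F)) := inferInstance
  let e' : (Fin m × (Unit → F)) ⊕ (Fin u ⊕ Fin t) ≃ Fin (m * Fintype.card F + u) ⊕ Fin t :=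
    (Equiv.sumAssoc _ _ _).symm.trans (e.sumCongr (Equiv.refl _))
  have he' : ∀ z k, e' z = Sum.inr k ↔ z = Sum.inr (Sum.inr k) := fun z k => by
    rw [← Equiv.eq_symm_apply]
    rfl
  refine hW.relabel R e' (fun _ _ _ _ h => e'.injective h) ?_ ?_ ?_
  · intro z' hz'
    refine ⟨e'.symm z', ?_, e'.apply_symm_apply z'⟩
    rintro (s | k) hs
    · exact ht
    · exact hz' k (by rw [← (he' _ _).2 hs, e'.apply_symm_apply])
  · rintro z k hz hk
    exact ⟨_, (he' _ _).1 hk, le_rfl⟩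
  · rintro (s | k) hs
    · exact Or.inl le_rfl
    · exact Or.inr ⟨k, rfl, le_rfl⟩

end seed

theorem irrational_log_div_log {p : ℕ} (hp : p.Prime) (hp2 : p ≠ 2) :
    Irrational (Real.log 2 / Real.log p) := by
  have hlog : 0 < Real.log p := Real.log_pos (by exact_mod_cast hp.one_lt)
  have hlog2 : 0 < Real.log 2 := Real.log_pos one_lt_two
  rintro ⟨q, hq⟩
  have hq0 : 0 < q := by
    have := div_pos hlog2 hlog
    rw [← hq] at this
    exact_mod_cast this
  have hden : (0 : ℝ) < q.den := by exact_mod_cast q.den_pos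
  have hnum : (q.num.toNat : ℝ) = q * q.den := by
    have h1 : ((q.num.toNat : ℤ) : ℚ) = q * q.den := by
      rw [Int.toNat_of_nonneg (Rat.num_nonneg.2 hq0.le), Rat.mul_den_eq_num]
    exact_mod_cast h1
  have h : Real.log ((2 : ℝ) ^ q.den) = Real.log ((p : ℝ) ^ q.num.toNat) := by
    rw [Real.log_pow, Real.log_pow, hnum, hq]
    field_simp
  have h' : (2 : ℝ) ^ q.den = (p : ℝ) ^ q.num.toNat :=
    Real.log_injOn_pos (Set.mem_Ioi.2 (by positivity))
      (Set.mem_Ioi.2 (pow_pos (by exact_mod_cast hp.pos) _)) h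
  have h'' : 2 ^ q.den = p ^ q.num.toNat := by exact_mod_cast h'
  exact hp2 (((Nat.prime_dvd_prime_iff_eq Nat.prime_two hp).1
    (Nat.prime_two.dvd_of_dvd_pow (h'' ▸ dvd_pow_self 2 q.den_ne_zero))).symm)

theorem exists_approx_log {p : ℕ} (hp : p.Prime) (hp2 : p ≠ 2) (a₀ : ℕ) {δ : ℝ} (hδ : 0 < δ) :
    ∃ (A : ℕ) (L₀ : ℝ), ∀ L ≥ L₀, ∃ a b : ℕ, a₀ ≤ a ∧ a ≤ A ∧
      a * Real.log 2 + b * Real.log p ≤ L ∧ L < a * Real.log 2 + b * Real.log p + δ := by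
  have hlog : 0 < Real.log p := Real.log_pos (by exact_mod_cast hp.one_lt)
  obtain ⟨g, hg, hg0, hgδ⟩ := (dense_addSubgroupClosure_pair_iff.2
    (irrational_log_div_log hp hp2)).exists_between hδ
  obtain ⟨x, y, hxy⟩ := AddSubgroup.mem_closure_pair.1 hg
  simp only [zsmul_eq_mul] at hxy
  obtain ⟨N, hN⟩ := exists_nat_ge (Real.log p / g)
  refine ⟨a₀ + 2 * (x.natAbs * N), ((a₀ + x.natAbs * N : ℕ) : ℝ) * Real.log 2 +
    ((y.natAbs * N : ℕ) : ℝ) * Real.log p, fun L hL => ?_⟩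
  set a₁ : ℕ := a₀ + x.natAbs * N with ha₁
  set z := (L - a₁ * Real.log 2) / Real.log p with hz
  have hzlog : z * Real.log p = L - a₁ * Real.log 2 := div_mul_cancel₀ _ hlog.ne'
  have hyz : ((y.natAbs * N : ℕ) : ℤ) ≤ ⌊z⌋ := by
    rw [Int.le_floor, hz, le_div_iff₀ hlog, Int.cast_natCast]
    linarith
  set r := Int.fract z * Real.log p with hr
  have hr0 : 0 ≤ r := mul_nonneg (Int.fract_nonneg z) hlog.le
  have hr1 : r < Real.log p := mul_lt_of_lt_one_left hlog (Int.fract_lt_one z)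
  have hrL : r = L - a₁ * Real.log 2 - ⌊z⌋ * Real.log p := by
    rw [hr, Int.fract, sub_mul, hzlog]
  set k := ⌊r / g⌋₊ with hk
  have hkN : k ≤ N := by
    have : (k : ℝ) ≤ N := (Nat.floor_le (div_nonneg hr0 hg0.le)).trans
      ((div_le_div_of_nonneg_right hr1.le hg0.le).trans hN)
    exact_mod_cast this
  have hkr : k * g ≤ r := (le_div_iff₀ hg0).1 (Nat.floor_le (div_nonneg hr0 hg0.le))
  have hkr' : r < (k + 1) * g := (div_lt_iff₀ hg0).1 (Nat.lt_floor_add_one _)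
  have habs : ∀ w : ℤ, |w * k| ≤ (w.natAbs * N : ℕ) := fun w => by
    rw [abs_mul, Nat.cast_mul, Int.natCast_natAbs, Nat.abs_cast]
    exact mul_le_mul_of_nonneg_left (by exact_mod_cast hkN) (abs_nonneg w)
  obtain ⟨a, ha⟩ : ∃ a : ℕ, (a : ℤ) = a₁ + x * k :=
    Int.eq_ofNat_of_zero_le (by have := abs_le.1 (habs x); omega) |>.imp fun _ h => h.symm
  obtain ⟨b, hb⟩ : ∃ b : ℕ, (b : ℤ) = ⌊z⌋ + y * k :=
    Int.eq_ofNat_of_zero_le (by have := abs_le.1 (habs y); omega) |>.imp fun _ h => h.symm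
  have ha' : (a : ℝ) = a₁ + x * k := by exact_mod_cast congrArg (Int.cast (R := ℝ)) ha
  have hb' : (b : ℝ) = ⌊z⌋ + y * k := by exact_mod_cast congrArg (Int.cast (R := ℝ)) hb
  have hsum : a * Real.log 2 + b * Real.log p = L - r + k * g := by
    rw [ha', hb', hrL, ← hxy]
    ring
  refine ⟨a, b, ?_, ?_, ?_, ?_⟩
  · have := abs_le.1 (habs x)
    omega
  · have := abs_le.1 (habs x)
    omega
  · linarith
  · linarith

theorem exists_approx {p : ℕ} (hp : p.Prime) (hp2 : p ≠ 2) (a₀ : ℕ) {m : ℕ} (hm : 0 < m) :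
    ∃ A V : ℕ, ∀ v ≥ V, ∃ a b : ℕ, a₀ ≤ a ∧ a ≤ A ∧ m * 2 ^ a * p ^ b ≤ v ∧
      2 * v < (2 * m + 1) * 2 ^ a * p ^ b := by
  have hm' : (0 : ℝ) < m := by exact_mod_cast hm
  have hp' : (0 : ℝ) < p := by exact_mod_cast hp.pos
  obtain ⟨A, L₀, h⟩ := exists_approx_log hp hp2 a₀ (δ := Real.log ((2 * m + 1) / (2 * m)))
    (Real.log_pos (by rw [one_lt_div (by positivity)]; linarith))
  obtain ⟨V, hV⟩ := exists_nat_ge (m * Real.exp L₀)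
  refine ⟨A, V, fun v hv => ?_⟩
  have hv' : m * Real.exp L₀ ≤ v := hV.trans (by exact_mod_cast hv)
  have hv0 : (0 : ℝ) < v := lt_of_lt_of_le (by positivity) hv'
  obtain ⟨a, b, ha, haA, h1, h2⟩ := h (Real.log (v / m)) (by
    rw [ge_iff_le, Real.le_log_iff_exp_le (by positivity), le_div_iff₀ hm']
    linarith)
  have hlog : a * Real.log 2 + b * Real.log p = Real.log (2 ^ a * p ^ b) := by
    rw [Real.log_mul (by positivity) (by positivity), Real.log_pow, Real.log_pow]
  rw [hlog] at h1 h2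
  rw [← Real.log_mul (by positivity) (by positivity), Real.log_lt_log_iff (by positivity)
    (by positivity), div_lt_iff₀ hm'] at h2
  rw [Real.log_le_log_iff (by positivity) (by positivity), le_div_iff₀ hm'] at h1
  refine ⟨a, b, ha, haA, ?_, ?_⟩
  · have : (m : ℝ) * 2 ^ a * p ^ b ≤ v := by linarith
    exact_mod_cast this
  · have h3 : (2 ^ a * p ^ b * ((2 * m + 1) / (2 * m)) * m : ℝ) * 2 =
        (2 * m + 1) * 2 ^ a * p ^ b := by
      field_simp
    have : (2 : ℝ) * v < (2 * m + 1) * 2 ^ a * p ^ b := by linarith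
    exact_mod_cast this

theorem eventually_of_closed {P : ℕ → Prop} {κ m : ℕ} (hκ : 0 < κ) (hm : 0 < m) (hPm : P m)
    (hP : ∀ m n u, P m → IsPrimePow n → u + κ ≤ n → P (m * n + u)) : ∃ V, ∀ v ≥ V, P v := by
  let p : ℕ → ℕ := fun i => Nat.nth Nat.Prime (i + 1)
  have hp : ∀ i, (p i).Prime := fun i => Nat.prime_nth_prime _
  have hpinj : Function.Injective p :=
    (Nat.nth_injective Nat.infinite_setOfPred_prime).comp (add_left_injective 1)
  have hp2 : ∀ i, p i ≠ 2 := fun i h => by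
    rw [← Nat.nth_prime_zero_eq_two] at h
    exact Nat.succ_ne_zero i (Nat.nth_injective Nat.infinite_setOfPred_prime h)
  obtain ⟨a₀, ha₀⟩ : ∃ a₀, 2 * κ ≤ 2 ^ a₀ := ⟨2 * κ, Nat.lt_two_pow_self.le⟩
  choose A V h using fun i => exists_approx (hp i) (hp2 i) a₀ hm
  set X := (2 * m + 1) * 2 ^ (∑ i ∈ range κ, A i) with hX
  refine ⟨∑ i ∈ range κ, V i + X ^ 2 + κ, fun v hv => ?_⟩
  by_contra hPv
  have hXpos : 0 < X := by positivity
  have hkey : ∀ i ∈ range κ, ∃ n c, (∃ b, n = p i ^ b) ∧ 2 * v < X * n ∧ c ∈ Ico 1 κ ∧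
      n ∣ v + c := by
    intro i hi
    have hVi := single_le_sum (f := V) (fun _ _ => Nat.zero_le _) hi
    have hAi := single_le_sum (f := A) (fun _ _ => Nat.zero_le _) hi
    obtain ⟨a, b, ha, haA, h1, h2⟩ := h i v (by omega)
    set n := p i ^ b with hn
    have hXn : 2 * v < X * n := by
      refine h2.trans_le (Nat.mul_le_mul_right _ (Nat.mul_le_mul_left _ ?_))
      exact Nat.pow_le_pow_right two_pos (haA.trans hAi)
    have hnpos : 0 < n := Nat.pow_pos (hp i).pos
    have hb : b ≠ 0 := by
      rintro rfl
      rw [hn, pow_zero, mul_one] at hXn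
      nlinarith
    have haa : 2 ^ a₀ ≤ 2 ^ a := Nat.pow_le_pow_right two_pos ha
    have hq1 : m * 2 ^ a ≤ v / n := (Nat.le_div_iff_mul_le hnpos).2 h1
    have hq2 : 2 * (v / n) < (2 * m + 1) * 2 ^ a := by
      refine Nat.lt_of_mul_lt_mul_right (a := n) (lt_of_le_of_lt ?_ h2)
      rw [mul_assoc]
      exact Nat.mul_le_mul_left _ (Nat.div_mul_le_self v n)
    have hPq : P (v / n) := by
      obtain ⟨u, hu⟩ := Nat.exists_eq_add_of_le hq1
      rw [hu]
      refine hP m _ u hPm (Nat.prime_two.isPrimePow.pow ?_) ?_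
      · rintro rfl
        simp at haa
        omega
      · rw [hu] at hq2
        nlinarith
    have hlt := Nat.mod_lt v hnpos
    have hdiv := Nat.div_add_mod' v n
    have hbig : n < v % n + κ := by
      by_contra! hc
      apply hPv
      rw [← hdiv]
      exact hP _ n _ hPq ((hp i).isPrimePow.pow hb) hc
    refine ⟨n, n - v % n, ⟨b, rfl⟩, hXn, mem_Ico.2 ⟨by omega, by omega⟩, ?_⟩
    exact ⟨v / n + 1, by rw [mul_add, mul_one, mul_comm n]; omega⟩
  choose! n c hn hXn hc hdvd using hkey
  obtain ⟨i, hi, i', hi', hne, hcc⟩ := exists_ne_map_eq_of_card_lt_of_maps_to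
    (s := range κ) (t := Ico 1 κ) (by simp; omega) (f := c) fun i hi => hc i hi
  obtain ⟨b, hb⟩ := hn i hi
  obtain ⟨b', hb'⟩ := hn i' hi'
  have hcop : Nat.Coprime (n i) (n i') := by
    rw [hb, hb']
    exact Nat.Coprime.pow _ _ ((Nat.coprime_primes (hp i) (hp i')).2 fun h => hne (hpinj h))
  have hle := Nat.le_of_dvd (by omega)
    (hcop.mul_dvd_of_dvd_of_dvd (hdvd i hi) (hcc ▸ hdvd i' hi'))
  have hci := mem_Ico.1 (hc i hi)
  have h1 := hXn i hi
  have h2 := hXn i' hi'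
  have h3 : (2 * v) * (2 * v) < (X * n i) * (X * n i') := Nat.mul_lt_mul'' h1 h2
  have h4 : (X * n i) * (X * n i') ≤ X ^ 2 * (2 * v) := by
    rw [mul_mul_mul_comm, ← sq]
    exact Nat.mul_le_mul_left _ (by omega)
  have h5 : X ^ 2 * (2 * v) ≤ (2 * v) * (2 * v) := Nat.mul_le_mul_right _ (by omega)
  omega

theorem Seed.exists_array {K : Type} [Fintype K] [DecidableEq K] {t v : ℕ} (h : Seed K t v)
    (hK : t ≤ Fintype.card K) :
    ∃ A : Fin (v ^ t) → K → Fin v, ∀ T : Finset K, #T = t →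
      ∀ r r', (∀ i ∈ T, A r i = A r' i) → r = r' := by
  obtain ⟨W, hW⟩ := h.2 0 (by simp)
  have : NeZero v := ⟨h.1.ne'⟩
  have hfin : ∀ w ∈ W, ∀ i, ∃ a, w i = Sum.inl a := by
    intro w hw i
    rcases hwi : w i with a | k
    · exact ⟨a, rfl⟩
    · have := hW.cap w hw k
      rw [Pi.zero_apply, Nat.le_zero, nInf, card_eq_zero] at this
      exact absurd (mem_filter.2 ⟨mem_univ i, hwi⟩) (this ▸ notMem_empty i)
  obtain ⟨T₀, -, hT₀⟩ := exists_subset_card_eq (s := (univ : Finset K)) (n := t) (by simpa using hK)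
  let e : T₀ ≃ Fin t := T₀.equivFinOfCardEq hT₀
  let x : Fin (v ^ t) → K → Fin v := fun r i =>
    if hi : i ∈ T₀ then finFunctionFinEquiv.symm r (e ⟨i, hi⟩) else 0
  have hx : ∀ r r', (∀ i ∈ T₀, x r i = x r' i) → r = r' := by
    intro r r' hr
    refine finFunctionFinEquiv.symm.injective (funext fun k => ?_)
    have := hr (e.symm k) (e.symm k).2
    simpa [x] using this
  have hcover : ∀ r, ∃ w ∈ W, ∀ i ∈ T₀, w i = Sum.inl (x r i) := fun r =>
    hW.cover T₀ hT₀ (fun i => Sum.inl (x r i)) (fun k => by simp [nInf]) (Nat.zero_le _)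
  choose w hwW hw using hcover
  choose A hA using fun r => hfin (w r) (hwW r)
  refine ⟨A, fun T hT r r' hr => hx r r' fun i hi => ?_⟩
  have hww : w r = w r' := hW.simple _ (hwW r) _ (hwW r') T hT fun i hi => by
    rw [hA, hA, hr i hi]
  exact Sum.inl_injective (by rw [← hw r i hi, ← hw r' i hi, hww])

theorem Seed.existsAOA {s t k v : ℕ} (hst : s < t) (htk : t ≤ k)
    (h : Seed (Fin (k + t - s)) t v) : ExistsAOA s t k v := by
  obtain ⟨A, hA⟩ := h.exists_array (by rw [Fintype.card_fin]; omega)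
  let ι : Fin k ↪ Fin (k + t - s) := Fin.castLEEmb (by omega)
  let τ : Fin (t - s) ↪ Fin (k + t - s) :=
    ⟨fun j => ⟨k + j, by omega⟩, fun j j' hj => by
      rw [Fin.mk.injEq] at hj
      exact Fin.ext (by omega)⟩
  refine ⟨fun r i => A r (ι i), fun r => finFunctionFinEquiv fun j => A r (τ j),
    fun c hc => ?_, fun c hc => ?_⟩
  · refine (Fintype.bijective_iff_injective_and_card _).2 ⟨fun r r' hr => ?_, by simp⟩
    refine hA (univ.map (Function.Embedding.trans ⟨c, hc⟩ ι)) (by simp) r r' fun i hi => ?_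
    obtain ⟨j, -, rfl⟩ := mem_map.1 hi
    exact congrFun hr j
  · refine (Fintype.bijective_iff_injective_and_card _).2 ⟨fun r r' hr => ?_, by
      simp [← pow_add, Nat.add_sub_of_le hst.le]⟩
    obtain ⟨hr₁, hr₂⟩ := Prod.mk.inj hr
    have hdisj : Disjoint (univ.map (Function.Embedding.trans ⟨c, hc⟩ ι)) (univ.map τ) := by
      rw [disjoint_left]
      intro i hi hi'
      obtain ⟨j, -, rfl⟩ := mem_map.1 hi
      obtain ⟨j', -, hj'⟩ := mem_map.1 hi'
      have h1 : k + (j' : ℕ) = c j := congrArg Fin.val hj'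
      have h2 := (c j).2
      omega
    refine hA (univ.map (Function.Embedding.trans ⟨c, hc⟩ ι) ∪ univ.map τ) (by
      rw [card_union_of_disjoint hdisj]
      simp [Nat.add_sub_of_le hst.le]) r r' fun i hi => ?_
    rcases mem_union.1 hi with hi | hi
    · obtain ⟨j, -, rfl⟩ := mem_map.1 hi
      exact congrFun hr₁ j
    · obtain ⟨j, -, rfl⟩ := mem_map.1 hi
      exact congrFun (finFunctionFinEquiv.injective hr₂) j

theorem eventually_seed {t κ : ℕ} (ht : 0 < t) (hκ : t ≤ κ) :
    ∃ V, ∀ v ≥ V, Seed (Fin κ) t v := by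
  obtain ⟨m, hm⟩ := exists_seed (K := Fin κ) (t := t) (by rwa [Fintype.card_fin])
  refine eventually_of_closed (κ := κ + t) (by omega) hm.1 hm fun m n u hm hn hu => ?_
  have : NeZero n := ⟨hn.ne_zero⟩
  obtain ⟨hF⟩ := Fintype.nonempty_field_iff.2
    (by rwa [Fintype.card_fin] : IsPrimePow (Fintype.card (Fin n)))
  have := @Seed.mul_add (Fin κ) _ _ t m u ht hm (Fin n) hF _ (by
    rw [Fintype.card_fin, Fintype.card_fin]
    omega)
  rwa [Fintype.card_fin] at this

end AOAConstruction

theorem aoa_asymptotic :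
    ∃ V : ℕ → ℕ → ℕ, ∀ s t k : ℕ, 0 < s → s < t → t ≤ k →
      ∀ v : ℕ, V t (k + t - s) ≤ v → ExistsAOA s t k v := by
  have h : ∀ t κ : ℕ, ∃ V, 0 < t → t ≤ κ → ∀ v ≥ V, AOAConstruction.Seed (Fin κ) t v := by
    intro t κ
    by_cases h : 0 < t ∧ t ≤ κ
    · exact (AOAConstruction.eventually_seed h.1 h.2).imp fun _ hV _ _ => hV
    · exact ⟨0, fun h₁ h₂ => absurd ⟨h₁, h₂⟩ h⟩
  choose V hV using h
  exact ⟨V, fun s t k _ hst htk v hv =>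
    (hV t (k + t - s) (by omega) (by omega) v hv).existsAOA hst htk⟩
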